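/- Let (η, u) be a solution of (SW) on [0,1]×[0,T] with η ∈ C([0,T]; C⁴[0,1]), u ∈ C([0,T]; C₀⁴), η₀' ∈ C₀³, u₀'' ∈ C₀², and suppose 1 + η(x,t) ≥ α > 0 on [0,1]×[0,T] for some constant α. For N ≥ 2 and h = 1/N, let (η_h, u_h) be the solution on [0,T] of the semidiscrete Galerkin problem in the continuous piecewise linear spaces S_h × S_{h,0}: (∂_t η_h, φ) + (∂_x u_h, φ) + (∂_x(η_h u_h), φ) = 0 for all φ ∈ S_h, (∂_t u_h, χ) + (∂_x η_h, χ) + (u_h ∂_x u_h, χ) = 0 for all χ ∈ S_{h,0}, with η_h(0) = Pη₀, u_h(0) = P₀u₀. Then there exists a constant C independent of h such that max_{0≤t≤T} (‖η(·,t) − η_h(t)‖ + ‖u(·,t) − u_h(t)‖) ≤ C h² and max_{0≤t≤T} (‖η(·,t) − η_h(t)‖_{L^∞} + ‖u(·,t) − u_h(t)‖_{L^∞}) ≤ C h². -/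

import Mathlib

noncomputable section
open Set

/-- The L²(0,1) inner product of two real functions. -/
def ip (f g : ℝ → ℝ) : ℝ := ∫ y in (0:ℝ)..1, f y * g y

/-- The L²(0,1) norm. -/
def nrm (f : ℝ → ℝ) : ℝ := Real.sqrt (∫ y in (0:ℝ)..1, (f y)^2)

/-- `g` is the L²(0,1)-orthogonal projection of `f` onto `S`. -/
def IsL2ProjOn (S : Set (ℝ → ℝ)) (f g : ℝ → ℝ) : Prop :=
  g ∈ S ∧ ∀ χ ∈ S, ip (fun y => f y - g y) χ = 0

/-- The space `S_h` of `C^k` piecewise polynomials of degree ≤ r-1 on the partition `x`. -/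
def Sh (N r k : ℕ) (x : ℕ → ℝ) : Set (ℝ → ℝ) :=
  {φ | ContDiffOn ℝ k φ (Icc (0:ℝ) 1) ∧
    ∀ j < N, ∃ p : Polynomial ℝ, p.natDegree ≤ r - 1 ∧
      ∀ y ∈ Icc (x j) (x (j+1)), φ y = Polynomial.eval y p}

/-- The subspace `S_{h,0}` of functions in `S_h` vanishing at 0 and 1. -/
def Sh0 (N r k : ℕ) (x : ℕ → ℝ) : Set (ℝ → ℝ) :=
  {φ | φ ∈ Sh N r k x ∧ φ 0 = 0 ∧ φ 1 = 0}

/-- `x 0 = 0 < x 1 < ⋯ < x N = 1` is a partition of `[0,1]`. -/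
def IsPartition (N : ℕ) (x : ℕ → ℝ) : Prop :=
  x 0 = 0 ∧ x N = 1 ∧ ∀ i < N, x i < x (i+1)

/-- `h` is the maximal meshlength of the partition `x`. -/
def IsMeshSize (N : ℕ) (x : ℕ → ℝ) (h : ℝ) : Prop :=
  (∀ i < N, x (i+1) - x i ≤ h) ∧ ∃ i < N, x (i+1) - x i = h

/-- The partition is quasiuniform with constant γ : `h ≤ γ · min meshlength`. -/
def QuasiUniform (N : ℕ) (x : ℕ → ℝ) (h γ : ℝ) : Prop :=
  ∀ i < N, h ≤ γ * (x (i+1) - x i)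

/-- `fs j` is the j-th time derivative of `fs 0` on `[0,1]×[0,T]` for `j ≤ m`,
each being r times continuously differentiable in space and jointly continuous:
an encoding of `fs 0 ∈ C^m([0,T]; C^r[0,1])`. -/
def SmoothChain (T : ℝ) (r m : ℕ) (fs : ℕ → ℝ → ℝ → ℝ) : Prop :=
  (∀ j < m, ∀ y ∈ Icc (0:ℝ) 1, ∀ t ∈ Icc (0:ℝ) T,
    HasDerivWithinAt (fun s => fs j y s) (fs (j+1) y t) (Icc (0:ℝ) T) t) ∧
  (∀ j ≤ m, ∀ t ∈ Icc (0:ℝ) T, ContDiffOn ℝ r (fun y => fs j y t) (Icc (0:ℝ) 1)) ∧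
  (∀ j ≤ m, ContinuousOn (fun p : ℝ × ℝ => fs j p.1 p.2) ((Icc (0:ℝ) 1) ×ˢ (Icc (0:ℝ) T)))

/-- `(η,u)` (with time derivatives `ηt`, `ut`) solves the shallow water
system on `[0,1]×[0,T]` with homogeneous boundary conditions for `u`. -/
def SW (T : ℝ) (η u ηt ut : ℝ → ℝ → ℝ) : Prop :=
  (∀ y ∈ Icc (0:ℝ) 1, ∀ t ∈ Icc (0:ℝ) T,
    ηt y t + derivWithin (fun z => u z t) (Icc (0:ℝ) 1) y
      + derivWithin (fun z => η z t * u z t) (Icc (0:ℝ) 1) y = 0 ∧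
    ut y t + derivWithin (fun z => η z t) (Icc (0:ℝ) 1) y
      + u y t * derivWithin (fun z => u z t) (Icc (0:ℝ) 1) y = 0) ∧
  (∀ t ∈ Icc (0:ℝ) T, u 0 t = 0 ∧ u 1 t = 0)

/-- `(ηh, uh)` (with time derivatives `dηh`, `duh`) is a `C¹` in time solution of the
standard Galerkin semidiscretization of the shallow water system in
`Sh N r k x × Sh0 N r k x` on `[0,T]`. -/
def SolvesSWGalerkin (N r k : ℕ) (x : ℕ → ℝ) (T : ℝ)
    (ηh uh dηh duh : ℝ → ℝ → ℝ) : Prop :=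
  (∀ t ∈ Icc (0:ℝ) T, ηh t ∈ Sh N r k x ∧ uh t ∈ Sh0 N r k x ∧
      dηh t ∈ Sh N r k x ∧ duh t ∈ Sh0 N r k x) ∧
  (∀ y ∈ Icc (0:ℝ) 1, ∀ t ∈ Icc (0:ℝ) T,
      HasDerivWithinAt (fun s => ηh s y) (dηh t y) (Icc (0:ℝ) T) t ∧
      HasDerivWithinAt (fun s => uh s y) (duh t y) (Icc (0:ℝ) T) t) ∧
  (∀ y ∈ Icc (0:ℝ) 1, ContinuousOn (fun t => dηh t y) (Icc (0:ℝ) T) ∧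
      ContinuousOn (fun t => duh t y) (Icc (0:ℝ) T)) ∧
  (∀ t ∈ Icc (0:ℝ) T,
      (∀ φ ∈ Sh N r k x,
        ip (dηh t) φ + ip (deriv (uh t)) φ
          + ip (deriv (fun y => ηh t y * uh t y)) φ = 0) ∧
      (∀ χ ∈ Sh0 N r k x,
        ip (duh t) χ + ip (deriv (ηh t)) χ
          + ip (fun y => uh t y * deriv (uh t) y) χ = 0))


section
open Set

/-- Divided differences of the values `v` at the points `p`. -/
def dd (p v : ℕ → ℝ) : ℕ → ℕ → ℝ
  | 0, k => v k
  | n+1, k => (dd p v n (k+1) - dd p v n k) / (p (k+n+1) - p k)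

/-- Derivative of a divided difference when the points move with velocity `q`. -/
def emo (p v q : ℕ → ℝ) : ℕ → ℕ → ℝ
  | 0, _ => 0
  | n+1, k => (emo p v q n (k+1) - emo p v q n k) / (p (k+n+1) - p k)
      - dd p v (n+1) k * ((q (k+n+1) - q k) / (p (k+n+1) - p k))

def Inc (p : ℕ → ℝ) (n : ℕ) : Prop := ∀ i < n, p i < p (i+1)

def DB (n : ℕ) (f : ℝ → ℝ) (M : ℝ) : Prop :=
  ∀ p, Inc p n → |dd p (fun i => f (p i)) n 0| ≤ M

theorem Inc.lt {p : ℕ → ℝ} {n : ℕ} (h : Inc p n) {i j : ℕ} (hij : i < j) (hj : j ≤ n) :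
    p i < p j := by
  induction j with
  | zero => omega
  | succ j ih =>
    rcases Nat.lt_succ_iff_lt_or_eq.mp hij with h1 | h1
    · exact (ih h1 (by omega)).trans (h j (by omega))
    · subst h1; exact h i (by omega)

theorem dd_shift (p v : ℕ → ℝ) (n k l : ℕ) :
    dd p v n (k + l) = dd (fun i => p (i + l)) (fun i => v (i + l)) n k := by
  induction n generalizing k with
  | zero => simp [dd]
  | succ n ih =>
    simp only [dd]
    rw [← ih, ← ih]
    congr 2
    · congr 1; omega
    · congr 1; omega

theorem dd_congr {p v p' v' : ℕ → ℝ} (n k : ℕ) (hp : ∀ i ≤ k + n, p i = p' i)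
    (hv : ∀ i ≤ k + n, v i = v' i) : dd p v n k = dd p' v' n k := by
  induction n generalizing k with
  | zero => simp [dd]; exact hv k (by omega)
  | succ n ih =>
    simp only [dd]
    rw [ih (k+1) (fun i hi => hp i (by omega)) (fun i hi => hv i (by omega)),
      ih k (fun i hi => hp i (by omega)) (fun i hi => hv i (by omega)),
      hp (k+n+1) (by omega), hp k (by omega)]

theorem dd_trans (p v : ℕ → ℝ) (n k : ℕ) (c : ℝ) :
    dd (fun i => p i + c) v n k = dd p v n k := by
  induction n generalizing k with
  | zero => simp [dd]
  | succ n ih => simp only [dd, ih]; congr 1; ring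

theorem dd_lin (p v w : ℕ → ℝ) (n k : ℕ) (a b : ℝ) :
    dd p (fun i => a * v i + b * w i) n k = a * dd p v n k + b * dd p w n k := by
  induction n generalizing k with
  | zero => simp [dd]
  | succ n ih => simp only [dd, ih]; ring

/-- divided differences of reflected data -/
theorem dd_refl (p v : ℕ → ℝ) (m n k : ℕ) (h : k + n ≤ m) :
    dd (fun i => - p (m - i)) (fun i => v (m - i)) n k = (-1)^n * dd p v n (m - k - n) := by
  induction n generalizing k with
  | zero => simp [dd]
  | succ n ih =>
    simp only [dd]
    rw [ih (k+1) (by omega), ih k (by omega)]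
    have e1 : m - (k+1) - n = m - k - (n+1) := by omega
    have e2 : m - k - n = m - k - (n+1) + 1 := by omega
    have e3 : m - (k+n+1) = m - k - (n+1) := by omega
    have e4 : m - k - (n+1) + n + 1 = m - k := by omega
    rw [e1, e2, e3, e4, pow_succ]
    have : -p (m - k - (n+1)) - -p (m - k) = p (m-k) - p (m - k - (n+1)) := by ring
    rw [this]; ring

theorem DB.bound {n : ℕ} {f : ℝ → ℝ} {M : ℝ} (h : DB n f M) {p : ℕ → ℝ} {k m : ℕ}
    (hp : Inc p m) (hk : k + n ≤ m) : |dd p (fun i => f (p i)) n k| ≤ M := by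
  have := dd_shift p (fun i => f (p i)) n 0 k
  rw [zero_add] at this
  rw [this]
  exact h (fun i => p (i + k)) (fun i hi => by
    have := hp (i+k) (by omega)
    simpa [add_right_comm] using this)

theorem DB.refl {n : ℕ} {f : ℝ → ℝ} {M : ℝ} (h : DB n f M) : DB n (fun x => f (-x)) M := by
  intro p hp
  have := dd_refl (fun i => - p (n - i)) (fun i => f (- p (n-i))) n n 0 (by omega)
  have e : dd p (fun i => f (-p i)) n 0 = dd (fun i => - (fun i => - p (n-i)) (n - i))
      (fun i => (fun i => f (- p (n-i))) (n - i)) n 0 := by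
    apply dd_congr
    · intro i hi; simp; congr 1; omega
    · intro i hi; simp; congr 3; omega
  rw [e, this, abs_mul, abs_pow, abs_neg, abs_one, one_pow, one_mul]
  have : n - 0 - n = 0 := by omega
  rw [this]
  apply h (fun i => - p (n-i))
  intro i hi
  have := hp (n - (i+1)) (by omega)
  have e : n - (i+1) + 1 = n - i := by omega
  rw [e] at this
  simpa using this

theorem DB.lin {n : ℕ} {f g : ℝ → ℝ} {M K : ℝ} (h : DB n f M) (hg : DB n g K) (a b : ℝ) :
    DB n (fun x => a * f x + b * g x) (|a| * M + |b| * K) := by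
  intro p hp
  rw [dd_lin]
  refine (abs_add_le _ _).trans ?_
  rw [abs_mul, abs_mul]
  have := h p hp
  have := hg p hp
  gcongr

theorem DB.mono {n : ℕ} {f : ℝ → ℝ} {M K : ℝ} (h : DB n f M) (hMK : M ≤ K) : DB n f K :=
  fun p hp => (h p hp).trans hMK

theorem dd_hasDeriv {P V : ℝ → ℕ → ℝ} {q v' : ℕ → ℝ} {s : Set ℝ} {τ : ℝ} {m : ℕ}
    (hP : ∀ i, HasDerivWithinAt (fun t => P t i) (q i) s τ)
    (hV : ∀ i, HasDerivWithinAt (fun t => V t i) (v' i) s τ) (hinc : Inc (P τ) m)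
    (n k : ℕ) (hk : k + n ≤ m) :
    HasDerivWithinAt (fun t => dd (P t) (V t) n k)
      (dd (P τ) v' n k + emo (P τ) (V τ) q n k) s τ := by
  induction n generalizing k with
  | zero => simpa [dd, emo] using hV k
  | succ n ih =>
    have h1 := ih (k+1) (by omega)
    have h2 := ih k (by omega)
    have hne : P τ (k+n+1) - P τ k ≠ 0 := by
      have := hinc.lt (i := k) (j := k+n+1) (by omega) (by omega)
      linarith
    have h3 := (h1.fun_sub h2).fun_div ((hP (k+n+1)).fun_sub (hP k)) hne
    refine h3.congr_deriv ?_
    simp only [dd, emo]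
    field_simp
    ring

theorem dd_succ_bound {n : ℕ} {f : ℝ → ℝ} {M : ℝ} (h : DB n f M) {p : ℕ → ℝ}
    (hp : Inc p (n+1)) : |dd p (fun i => f (p i)) (n+1) 0| ≤ 2 * M / (p (n+1) - p 0) := by
  have hlt := hp.lt (i := 0) (j := n+1) (by omega) le_rfl
  simp only [dd, zero_add]
  rw [abs_div, abs_of_pos (sub_pos.2 hlt)]
  have h1 := h.bound (k := 1) hp (by omega)
  have h2 := h.bound (k := 0) hp (by omega)
  have := abs_sub (dd p (fun i => f (p i)) n 1) (dd p (fun i => f (p i)) n 0)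
  have h3 := sub_pos.2 hlt
  gcongr
  linarith

/-- barrier -/
def bet (ε : ℝ) (m n : ℕ) (p : ℕ → ℝ) : ℝ :=
  1 + ε * ∑ i ∈ Finset.range n, ((p (i+1) - p i)^m)⁻¹

def bet' (ε : ℝ) (m n : ℕ) (p q : ℕ → ℝ) : ℝ :=
  - (ε * ∑ i ∈ Finset.range n, m * (q (i+1) - q i) * ((p (i+1) - p i)^(m+1))⁻¹)

theorem bet_ge_one {ε : ℝ} (hε : 0 < ε) {m n : ℕ} {p : ℕ → ℝ} (hp : Inc p n) : 1 ≤ bet ε m n p := by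
  have : 0 ≤ ∑ i ∈ Finset.range n, ((p (i+1) - p i)^m)⁻¹ := Finset.sum_nonneg fun i hi => by
    have := hp i (Finset.mem_range.1 hi)
    have : 0 < p (i+1) - p i := by linarith
    positivity
  unfold bet; nlinarith [mul_nonneg hε.le this]

theorem bet_ge_gap {ε : ℝ} (hε : 0 < ε) {m n : ℕ} {p : ℕ → ℝ} (hp : Inc p n) {i : ℕ} (hi : i < n) :
    ε * ((p (i+1) - p i)^m)⁻¹ < bet ε m n p := by
  have h0 : ∀ i ∈ Finset.range n, 0 ≤ ((p (i+1) - p i)^m)⁻¹ := fun i hi => by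
    have := hp i (Finset.mem_range.1 hi)
    have : 0 < p (i+1) - p i := by linarith
    positivity
  have := Finset.single_le_sum h0 (Finset.mem_range.2 hi)
  have := mul_le_mul_of_nonneg_left this hε.le
  unfold bet; linarith

theorem bet_hasDeriv (ε : ℝ) (m n : ℕ) {p q : ℕ → ℝ} (hp : Inc p n) :
    HasDerivAt (fun τ : ℝ => bet ε m n (fun i => p i + τ * q i)) (bet' ε m n p q) 0 := by
  unfold bet bet'
  have key : ∀ i ∈ Finset.range n, HasDerivAt
      (fun τ : ℝ => (((p (i+1) + τ * q (i+1)) - (p i + τ * q i))^m)⁻¹)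
      (-(m * (q (i+1) - q i) * ((p (i+1) - p i)^(m+1))⁻¹)) 0 := by
    intro i hi
    have hlt := hp i (Finset.mem_range.1 hi)
    have h1 : HasDerivAt (fun τ : ℝ => (p (i+1) + τ * q (i+1)) - (p i + τ * q i))
        (q (i+1) - q i) 0 := by
      have := (((hasDerivAt_id (0:ℝ)).mul_const (q (i+1))).const_add (p (i+1))).fun_sub
        (((hasDerivAt_id (0:ℝ)).mul_const (q i)).const_add (p i))
      simpa using this
    have h2 := (h1.fun_pow m).fun_inv (by
      have : p (i+1) - p i ≠ 0 := by linarith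
      simp [this])
    refine h2.congr_deriv ?_
    have : p (i+1) - p i ≠ 0 := by linarith
    rcases m with _ | m
    · simp
    · simp only [zero_mul, add_zero]
      simp only [Nat.add_sub_cancel]
      field_simp
      try ring
  have := ((HasDerivAt.fun_sum key).const_mul ε).const_add 1
  refine this.congr_deriv ?_
  rw [Finset.sum_neg_distrib]; ring

theorem bet_congr {ε : ℝ} {m n : ℕ} {p p' : ℕ → ℝ} (h : ∀ i ≤ n, p i = p' i) :
    bet ε m n p = bet ε m n p' := by
  unfold bet
  congr 2
  apply Finset.sum_congr rfl
  intro i hi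
  have := Finset.mem_range.1 hi
  rw [h (i+1) (by omega), h i (by omega)]

theorem bet_trans {ε : ℝ} {m n : ℕ} {p : ℕ → ℝ} (c : ℝ) :
    bet ε m n (fun i => p i + c) = bet ε m n p := by
  unfold bet; congr 2; apply Finset.sum_congr rfl; intro i _; congr 2; ring

theorem bet_refl {ε : ℝ} {m n : ℕ} {p : ℕ → ℝ} :
    bet ε m n (fun i => - p (n - i)) = bet ε m n p := by
  unfold bet
  congr 2
  rw [← Finset.sum_range_reflect]
  apply Finset.sum_congr rfl
  intro i hi
  have := Finset.mem_range.1 hi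
  have e1 : n - (n - 1 - i) = i + 1 := by omega
  have e2 : n - (n - 1 - i + 1) = i := by omega
  simp only [e1, e2]; congr 2; ring

end

section
open Set

structure RS (T : ℝ) (r rx lam : ℝ → ℝ → ℝ) : Prop where
  hc : ContinuousOn (fun p : ℝ × ℝ => r p.1 p.2) (univ ×ˢ Icc (0:ℝ) T)
  per : ∀ x, ∀ t ∈ Icc (0:ℝ) T, r (x + 2) t = r x t
  dx : ∀ x, ∀ t ∈ Icc (0:ℝ) T, HasDerivAt (fun y => r y t) (rx x t) x
  dt : ∀ x, ∀ t ∈ Icc (0:ℝ) T,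
    HasDerivWithinAt (fun s => r x s) (-(lam x t * rx x t)) (Icc (0:ℝ) T) t

theorem emo_zero (p v : ℕ → ℝ) (n k : ℕ) : emo p v (fun _ => 0) n k = 0 := by
  induction n generalizing k with
  | zero => simp [emo]
  | succ n ih => simp [emo, ih]

theorem dd_neg (p v : ℕ → ℝ) (n k : ℕ) : dd p (fun i => - v i) n k = - dd p v n k := by
  have := dd_lin p v v n k (-1) 0
  simpa using this

theorem dd_contOn {X : Type*} [TopologicalSpace X] {P V : X → ℕ → ℝ} {s : Set X} {m : ℕ}
    (hP : ∀ i, ContinuousOn (fun x => P x i) s) (hV : ∀ i, ContinuousOn (fun x => V x i) s)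
    (hinc : ∀ x ∈ s, Inc (P x) m) (n k : ℕ) (hk : k + n ≤ m) :
    ContinuousOn (fun x => dd (P x) (V x) n k) s := by
  induction n generalizing k with
  | zero => simpa [dd] using hV k
  | succ n ih =>
    simp only [dd]
    refine ((ih (k+1) (by omega)).sub (ih k (by omega))).div ((hP _).sub (hP _)) ?_
    intro x hx
    have := (hinc x hx).lt (i := k) (j := k+n+1) (by omega) (by omega)
    linarith

theorem bet_contOn {X : Type*} [TopologicalSpace X] {P : X → ℕ → ℝ} {s : Set X} {ε : ℝ} {m n : ℕ}
    (hP : ∀ i, ContinuousOn (fun x => P x i) s)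
    (hinc : ∀ x ∈ s, Inc (P x) n) :
    ContinuousOn (fun x => bet ε m n (P x)) s := by
  unfold bet
  refine continuousOn_const.add (continuousOn_const.mul (continuousOn_finsetSum _ fun i hi => ?_))
  refine (((hP _).sub (hP _)).pow m).inv₀ ?_
  intro x hx
  have := hinc x hx i (Finset.mem_range.1 hi)
  exact pow_ne_zero _ (by simp only [Pi.sub_apply]; linarith)

theorem left_deriv_nonneg {g : ℝ → ℝ} {a b c g' : ℝ} (hg : HasDerivWithinAt g g' (Icc a b) c)
    (hac : a < c) (hcb : c ≤ b) (hle : ∀ s, a ≤ s → s < c → g s ≤ g c) : 0 ≤ g' := by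
  have h1 : HasDerivWithinAt g g' (Ico a c) c :=
    hg.mono (fun s hs => ⟨hs.1, hs.2.le.trans hcb⟩)
  rw [hasDerivWithinAt_iff_tendsto_slope' (by simp)] at h1
  have : (nhdsWithin c (Ico a c)).NeBot := by
    rw [← mem_closure_iff_nhdsWithin_neBot, closure_Ico hac.ne]
    exact ⟨hac.le, le_rfl⟩
  refine ge_of_tendsto h1 ?_
  filter_upwards [self_mem_nhdsWithin] with s hs
  rw [slope_def_field]
  have := hle s hs.1 hs.2
  have h2 := hs.2
  exact div_nonneg_of_nonpos (by linarith) (by linarith)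

theorem touch {T : ℝ} {r rx lam : ℝ → ℝ → ℝ} (h : RS T r rx lam) (n m : ℕ)
    {ε g0 : ℝ} (hg0 : 0 < g0) {ψ ψ' : ℝ → ℝ}
    (hψ : ∀ t ∈ Icc (0:ℝ) T, HasDerivWithinAt ψ (ψ' t) (Icc (0:ℝ) T) t)
    (hgap : ∀ t ∈ Icc (0:ℝ) T, ∀ p, Inc p n → ((∃ i < n, p (i+1) - p i < g0) ∨ 1 < p n - p 0) →
      |dd p (fun i => r (p i) t) n 0| < ψ t * bet ε m n p)
    (h0 : ∀ p, Inc p n → |dd p (fun i => r (p i) 0) n 0| < ψ 0 * bet ε m n p)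
    (hE : ∀ t ∈ Icc (0:ℝ) T, ∀ p, Inc p n →
      (∀ p', Inc p' n → |dd p' (fun i => r (p' i) t) n 0| ≤ ψ t * bet ε m n p') →
      ∀ σ : ℝ, (σ = 1 ∨ σ = -1) → σ * dd p (fun i => r (p i) t) n 0 = ψ t * bet ε m n p →
      σ * emo p (fun i => r (p i) t) (fun i => lam (p i) t) n 0
        < ψ' t * bet ε m n p + ψ t * bet' ε m n p (fun i => lam (p i) t)) :
    ∀ t ∈ Icc (0:ℝ) T, ∀ p, Inc p n → |dd p (fun i => r (p i) t) n 0| < ψ t * bet ε m n p := by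
  by_contra hcon
  push Not at hcon
  obtain ⟨t1, ht1, p1, hp1, hv1⟩ := hcon
  -- the compact set
  set B : Set (ℕ → ℝ) := Set.pi univ (fun _ => Icc (0:ℝ) 3) with hB
  have hBc : IsCompact B := isCompact_univ_pi fun _ => isCompact_Icc
  set Kc : Set ((ℕ → ℝ) × ℝ) := (B ×ˢ Icc (0:ℝ) T) ∩ {q | ∀ i < n, g0 ≤ q.1 (i+1) - q.1 i} with hKc
  have hcl : IsClosed {q : (ℕ → ℝ) × ℝ | ∀ i < n, g0 ≤ q.1 (i+1) - q.1 i} := by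
    simp only [ofPred_forall]
    refine isClosed_iInter fun i => isClosed_iInter fun _ => ?_
    exact isClosed_le continuous_const (by fun_prop)
  have hKcc : IsCompact Kc := (hBc.prod isCompact_Icc).inter_right hcl
  have hinc : ∀ q ∈ Kc, Inc q.1 n := fun q hq i hi => by
    have : g0 ≤ q.1 (i+1) - q.1 i := hq.2 i hi
    linarith
  have hPc : ∀ i, ContinuousOn (fun q : (ℕ → ℝ) × ℝ => q.1 i) Kc := fun i => by fun_prop
  have hVc : ∀ i, ContinuousOn (fun q : (ℕ → ℝ) × ℝ => r (q.1 i) q.2) Kc := fun i => by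
    refine h.hc.comp (f := fun q : (ℕ → ℝ) × ℝ => (q.1 i, q.2)) (by fun_prop) ?_
    intro q hq
    exact ⟨mem_univ _, hq.1.2⟩
  have hψc : ContinuousOn ψ (Icc 0 T) := fun t ht => (hψ t ht).continuousWithinAt
  have hψc2 : ContinuousOn (fun q : (ℕ → ℝ) × ℝ => ψ q.2) Kc :=
    hψc.comp (by fun_prop) (fun q hq => hq.1.2)
  have hF : ContinuousOn (fun q : (ℕ → ℝ) × ℝ =>
      |dd q.1 (fun i => r (q.1 i) q.2) n 0| - ψ q.2 * bet ε m n q.1) Kc :=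
    (dd_contOn hPc hVc hinc n 0 (by omega)).abs.sub (hψc2.mul (bet_contOn hPc hinc))
  set Z := Kc ∩ (fun q : (ℕ → ℝ) × ℝ =>
      |dd q.1 (fun i => r (q.1 i) q.2) n 0| - ψ q.2 * bet ε m n q.1) ⁻¹' (Ici 0) with hZ
  have hZc : IsCompact Z := hKcc.of_isClosed_subset
    (hF.preimage_isClosed_of_isClosed hKcc.isClosed isClosed_Ici) inter_subset_left
  -- normalization
  have norm : ∀ t ∈ Icc (0:ℝ) T, ∀ p, Inc p n → ψ t * bet ε m n p ≤ |dd p (fun i => r (p i) t) n 0| →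
      ∃ q, (q, t) ∈ Z := by
    intro t ht p hp hv
    have hng : ¬ ((∃ i < n, p (i+1) - p i < g0) ∨ 1 < p n - p 0) := fun hh => by
      have := hgap t ht p hp hh; linarith
    push Not at hng
    have hper : ∀ k : ℤ, ∀ x, r (x + k * 2) t = r x t := by
      have hP : Function.Periodic (fun x => r x t) 2 := fun x => h.per x t ht
      intro k x
      exact hP.int_mul k x
    set k : ℤ := - ⌊p 0 / 2⌋ with hk
    refine ⟨fun i => if i ≤ n then p i + k * 2 else 0, ⟨⟨⟨?_, ht⟩, ?_⟩, ?_⟩⟩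
    · intro i _
      dsimp only
      split_ifs with hi
      · have h1 := Int.floor_le (p 0 / 2)
        have h2 := Int.lt_floor_add_one (p 0 / 2)
        have h3 : p 0 ≤ p i := by
          rcases Nat.eq_zero_or_pos i with h | h
          · rw [h]
          · exact (hp.lt h hi).le
        have h4 : p i ≤ p n := by
          rcases Nat.eq_or_lt_of_le hi with h | h
          · rw [h]
          · exact (hp.lt h le_rfl).le
        have h5 := hng.2
        simp only [hk]; push_cast
        constructor <;> linarith
      · norm_num
    · intro i hi
      have := hng.1 i hi
      simp only [show i ≤ n by omega, show i + 1 ≤ n by omega, if_true]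
      linarith
    · have e1 : dd (fun i => if i ≤ n then p i + k * 2 else 0)
          (fun i => r ((fun i => if i ≤ n then p i + k * 2 else 0) i) t) n 0
          = dd p (fun i => r (p i) t) n 0 := by
        rw [← dd_trans p _ n 0 (k * 2)]
        apply dd_congr
        · intro i hi; simp [show i ≤ n by omega]
        · intro i hi; simp only [show i ≤ n by omega, if_true]; exact hper k _
      have e2 : bet ε m n (fun i => if i ≤ n then p i + k * 2 else 0) = bet ε m n p := by
        rw [← bet_trans (p := p) (k * 2)]
        exact bet_congr (fun i hi => by simp [hi])
      simp only [mem_preimage, mem_Ici]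
      rw [e1, e2]; linarith
  obtain ⟨q1, hq1⟩ := norm t1 ht1 p1 hp1 hv1
  obtain ⟨⟨p, ts⟩, hpZ, hmin⟩ := hZc.exists_isMinOn ⟨_, hq1⟩ (f := fun q => q.2) (by fun_prop)
  have hts : ts ∈ Icc (0:ℝ) T := hpZ.1.1.2
  have hp : Inc p n := hinc _ hpZ.1
  have hviol : ψ ts * bet ε m n p ≤ |dd p (fun i => r (p i) ts) n 0| := by
    have := hpZ.2
    simp only [mem_preimage, mem_Ici] at this
    linarith
  have hts0 : 0 < ts := by
    rcases hts.1.lt_or_eq with h | h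
    · exact h
    · exfalso
      rw [← h] at hviol
      exact absurd (h0 p hp) (not_lt.2 hviol)
  have hbefore : ∀ s, 0 ≤ s → s < ts → ∀ p', Inc p' n →
      |dd p' (fun i => r (p' i) s) n 0| < ψ s * bet ε m n p' := by
    intro s hs hs2 p' hp'
    by_contra hcc
    obtain ⟨q, hq⟩ := norm s ⟨hs, hs2.le.trans hts.2⟩ p' hp' (not_lt.1 hcc)
    have := hmin hq
    simp only [mem_ofPred_eq] at this
    linarith
  have hVt : ∀ p' : ℕ → ℝ, ∀ i, ∀ t ∈ Icc (0:ℝ) T, HasDerivWithinAt (fun s => r (p' i) s)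
      (-(lam (p' i) t * rx (p' i) t)) (Icc (0:ℝ) T) t := fun p' i t ht => h.dt _ t ht
  have hall : ∀ p', Inc p' n → |dd p' (fun i => r (p' i) ts) n 0| ≤ ψ ts * bet ε m n p' := by
    intro p' hp'
    have hcont : ContinuousWithinAt (fun s => ψ s * bet ε m n p' - |dd p' (fun i => r (p' i) s) n 0|)
        (Ico 0 ts) ts := by
      have h1 : ContinuousOn (fun s => dd p' (fun i => r (p' i) s) n 0) (Icc 0 T) :=
        dd_contOn (P := fun _ => p') (V := fun s i => r (p' i) s) (fun i => continuousOn_const)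
          (fun i t ht => (hVt p' i t ht).continuousWithinAt) (fun _ _ => hp') n 0 (by omega)
      exact ((hψc.mul continuousOn_const).sub h1.abs ts hts).mono
        (fun s hs => ⟨hs.1, hs.2.le.trans hts.2⟩)
    have : (nhdsWithin ts (Ico 0 ts)).NeBot := by
      rw [← mem_closure_iff_nhdsWithin_neBot, closure_Ico hts0.ne]
      exact ⟨hts0.le, le_rfl⟩
    have := ge_of_tendsto hcont (b := 0) (by
      filter_upwards [self_mem_nhdsWithin] with s hs
      have := hbefore s hs.1 hs.2 p' hp'
      linarith)
    linarith
  have hequal := le_antisymm (hall p hp) hviol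
  obtain ⟨σ, hσ, hσe, hσabs⟩ : ∃ σ : ℝ, (σ = 1 ∨ σ = -1) ∧
      σ * dd p (fun i => r (p i) ts) n 0 = ψ ts * bet ε m n p ∧ ∀ y, σ * y ≤ |y| := by
    rcases abs_cases (dd p (fun i => r (p i) ts) n 0) with h | h
    · exact ⟨1, Or.inl rfl, by rw [one_mul, ← h.1, hequal], fun y => by rw [one_mul]; exact le_abs_self y⟩
    · exact ⟨-1, Or.inr rfl, by rw [neg_one_mul, ← h.1, hequal],
        fun y => by rw [neg_one_mul]; exact neg_le_abs y⟩
  have key := hE ts hts p hp hall σ hσ hσe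
  -- space derivative
  set v' : ℕ → ℝ := fun i => lam (p i) ts * rx (p i) ts with hv'
  set lp : ℕ → ℝ := fun i => lam (p i) ts with hlp
  have hP1 : ∀ i, HasDerivAt (fun τ : ℝ => p i + τ * lp i) (lp i) 0 := fun i => by
    have := ((hasDerivAt_id (0:ℝ)).mul_const (lp i)).const_add (p i)
    simpa using this
  have hV1 : ∀ i, HasDerivAt (fun τ : ℝ => r (p i + τ * lp i) ts) (v' i) 0 := fun i => by
    have h1 : HasDerivAt (fun y => r y ts) (rx (p i) ts) (p i + 0 * lp i) := by
      simpa using h.dx (p i) ts hts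
    have := h1.comp (0:ℝ) (hP1 i)
    refine this.congr_deriv ?_
    simp only [hv', hlp]; ring
  have hd1 := dd_hasDeriv (P := fun τ i => p i + τ * lp i) (V := fun τ i => r (p i + τ * lp i) ts)
    (s := univ) (τ := 0) (m := n) (fun i => (hP1 i).hasDerivWithinAt)
    (fun i => (hV1 i).hasDerivWithinAt) (by simpa using hp) n 0 (by omega)
  rw [hasDerivWithinAt_univ] at hd1
  have hd2 := bet_hasDeriv ε m n (q := lp) hp
  have hd3 := (hd1.const_mul σ).fun_sub (hd2.const_mul (ψ ts))
  have hmax : IsLocalMax (fun τ : ℝ => σ * dd (fun i => p i + τ * lp i)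
      (fun i => r (p i + τ * lp i) ts) n 0 - ψ ts * bet ε m n (fun i => p i + τ * lp i)) 0 := by
    have hev : ∀ᶠ τ : ℝ in nhds 0, Inc (fun i => p i + τ * lp i) n := by
      have : ∀ᶠ τ : ℝ in nhds 0, ∀ i ∈ Finset.range n, p i + τ * lp i < p (i+1) + τ * lp (i+1) := by
        rw [Filter.eventually_all_finset]
        intro i hi
        have hlt := hp i (Finset.mem_range.1 hi)
        have c1 : ContinuousAt (fun τ : ℝ => p i + τ * lp i) 0 := by fun_prop
        have c2 : ContinuousAt (fun τ : ℝ => p (i+1) + τ * lp (i+1)) 0 := by fun_prop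
        exact c1.eventually_lt c2 (by simpa using hlt)
      filter_upwards [this] with τ hτ i hi using hτ i (Finset.mem_range.2 hi)
    filter_upwards [hev] with τ hτ
    have h1 := hall _ hτ
    have h2 := hσabs (dd (fun i => p i + τ * lp i) (fun i => r (p i + τ * lp i) ts) n 0)
    simp only [zero_mul, add_zero]
    linarith
  have hz := hmax.hasDerivAt_eq_zero hd3
  simp only [zero_mul, add_zero] at hz
  -- time derivative
  have hd4 := dd_hasDeriv (P := fun _ => p) (V := fun s i => r (p i) s) (q := fun _ => 0)
    (s := Icc 0 T) (τ := ts) (m := n) (fun i => hasDerivWithinAt_const _ _ _)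
    (fun i => hVt p i ts hts) hp n 0 (by omega)
  rw [emo_zero, dd_neg] at hd4
  have hd5 := (hd4.const_mul σ).fun_sub ((hψ ts hts).mul_const (bet ε m n p))
  have hnn := left_deriv_nonneg hd5 hts0 hts.2 (fun s hs1 hs2 => by
    have h1 := hbefore s hs1 hs2 p hp
    have h2 := hσabs (dd p (fun i => r (p i) s) n 0)
    linarith)
  change σ * emo p (fun i => r (p i) ts) lp n 0
        < ψ' ts * bet ε m n p + ψ ts * bet' ε m n p lp at key
  have e : dd p (fun i => lam (p i) ts * rx (p i) ts) n 0 = dd p v' n 0 := rfl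
  rw [e] at hnn
  linarith

end

section
open Set

/-- the concrete transport structure -/
def RT (T A B : ℝ) (r rx : ℝ → ℝ → ℝ) : Prop :=
  RS T r rx (fun x t => A * r x t + B * r (-x) t)

theorem RT.mono {T T' A B : ℝ} {r rx : ℝ → ℝ → ℝ} (h : RT T A B r rx) (hT : T' ≤ T) :
    RT T' A B r rx where
  hc := h.hc.mono (prod_mono subset_rfl (Icc_subset_Icc_right hT))
  per x t ht := h.per x t ⟨ht.1, ht.2.trans hT⟩
  dx x t ht := h.dx x t ⟨ht.1, ht.2.trans hT⟩
  dt x t ht := (h.dt x t ⟨ht.1, ht.2.trans hT⟩).mono (Icc_subset_Icc_right hT)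

theorem RT.fwd {T A B t0 : ℝ} {r rx : ℝ → ℝ → ℝ} (h : RT T A B r rx) (ht0 : 0 ≤ t0) :
    RT (T - t0) A B (fun x s => r x (t0 + s)) (fun x s => rx x (t0 + s)) where
  hc := h.hc.comp (f := fun p : ℝ × ℝ => (p.1, t0 + p.2)) (by fun_prop)
    (fun p hp => ⟨mem_univ _, by have := hp.2.1; show 0 ≤ t0 + p.2; linarith,
      by have := hp.2.2; show t0 + p.2 ≤ T; linarith⟩)
  per x t ht := h.per x _ ⟨by linarith [ht.1], by linarith [ht.2]⟩
  dx x t ht := h.dx x _ ⟨by linarith [ht.1], by linarith [ht.2]⟩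
  dt x t ht := by
    have h1 := h.dt x (t0 + t) ⟨by linarith [ht.1], by linarith [ht.2]⟩
    have h2 : HasDerivWithinAt (fun s : ℝ => t0 + s) 1 (Icc 0 (T - t0)) t :=
      ((hasDerivAt_id t).const_add t0).hasDerivWithinAt
    have := h1.comp t h2 (fun s hs => ⟨by linarith [hs.1], by linarith [hs.2]⟩)
    refine this.congr_deriv ?_
    ring

theorem RT.bwd {T A B t0 : ℝ} {r rx : ℝ → ℝ → ℝ} (h : RT T A B r rx) (ht0 : t0 ≤ T) :
    RT t0 (-A) (-B) (fun x s => r x (t0 - s)) (fun x s => rx x (t0 - s)) where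
  hc := h.hc.comp (f := fun p : ℝ × ℝ => (p.1, t0 - p.2)) (by fun_prop)
    (fun p hp => ⟨mem_univ _, by have := hp.2.2; show 0 ≤ t0 - p.2; linarith,
      by have := hp.2.1; show t0 - p.2 ≤ T; linarith⟩)
  per x t ht := h.per x _ ⟨by linarith [ht.2], by linarith [ht.1]⟩
  dx x t ht := h.dx x _ ⟨by linarith [ht.2], by linarith [ht.1]⟩
  dt x t ht := by
    have h1 := h.dt x (t0 - t) ⟨by linarith [ht.2], by linarith [ht.1]⟩
    have h2 : HasDerivWithinAt (fun s : ℝ => t0 - s) (-1) (Icc 0 t0) t :=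
      ((hasDerivAt_id t).const_sub t0).hasDerivWithinAt
    have := h1.comp t h2 (fun s hs => ⟨by linarith [hs.2], by linarith [hs.1]⟩)
    refine this.congr_deriv ?_
    ring

theorem RS.shift {T : ℝ} {r rx lam : ℝ → ℝ → ℝ} (h : RS T r rx lam) (x : ℝ) :
    ∃ c : ℝ, 0 ≤ x + c ∧ x + c ≤ 2 ∧ ∀ y, ∀ t ∈ Icc (0:ℝ) T, r (y + c) t = r y t := by
  refine ⟨(-⌊x / 2⌋ : ℤ) * 2, ?_, ?_, ?_⟩
  · have h1 := Int.floor_le (x / 2); push_cast; linarith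
  · have h2 := Int.lt_floor_add_one (x / 2); push_cast; linarith
  · intro y t ht
    have hP : Function.Periodic (fun x => r x t) 2 := fun x => h.per x t ht
    exact hP.int_mul _ y

theorem RS.bdd {T : ℝ} {r rx lam : ℝ → ℝ → ℝ} (h : RS T r rx lam) :
    ∃ M, 0 ≤ M ∧ ∀ x, ∀ t ∈ Icc (0:ℝ) T, |r x t| ≤ M := by
  obtain ⟨C, hC⟩ := ((isCompact_Icc (a := (0:ℝ)) (b := 2)).prod
    (isCompact_Icc (a := (0:ℝ)) (b := T))).exists_bound_of_continuousOn
    (h.hc.mono (prod_mono (subset_univ _) subset_rfl))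
  refine ⟨|C|, abs_nonneg _, fun x t ht => ?_⟩
  obtain ⟨c, h1, h2, h3⟩ := h.shift x
  rw [← h3 x t ht]
  exact (hC (x + c, t) ⟨⟨h1, h2⟩, ht⟩).trans (le_abs_self _)

theorem RS.unif {T : ℝ} {r rx lam : ℝ → ℝ → ℝ} (h : RS T r rx lam) {e : ℝ} (he : 0 < e) :
    ∃ g, 0 < g ∧ ∀ x y, ∀ t ∈ Icc (0:ℝ) T, x < y → y - x < g → |r y t - r x t| < e := by
  have hK := ((isCompact_Icc (a := (0:ℝ)) (b := 3)).prod
    (isCompact_Icc (a := (0:ℝ)) (b := T)))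
  have hu := hK.uniformContinuousOn_of_continuous
    (h.hc.mono (prod_mono (subset_univ _) subset_rfl))
  rw [Metric.uniformContinuousOn_iff] at hu
  obtain ⟨d, hd, hu⟩ := hu e he
  refine ⟨min d 1, by positivity, fun x y t ht hxy hyx => ?_⟩
  obtain ⟨c, h1, h2, h3⟩ := h.shift x
  have h4 := lt_min_iff.1 hyx
  have := hu (y + c, t) ⟨⟨by show 0 ≤ y + c; linarith, by show y + c ≤ 3; linarith⟩, ht⟩
    (x + c, t) ⟨⟨by show 0 ≤ x + c; linarith, by show x + c ≤ 3; linarith⟩, ht⟩ (by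
      rw [Prod.dist_eq, Real.dist_eq, Real.dist_eq]
      simp only [add_sub_add_right_eq_sub, sub_self, abs_zero]
      rw [abs_of_pos (by linarith)]
      exact max_lt h4.1 hd)
  rw [Real.dist_eq] at this
  simpa only [h3 _ t ht] using this

/-- barrier bound for the reflected function -/
theorem refl_bound {ε K : ℝ} {m n : ℕ} {f : ℝ → ℝ}
    (h : ∀ p', Inc p' n → |dd p' (fun i => f (p' i)) n 0| ≤ K * bet ε m n p')
    {p : ℕ → ℝ} (hp : Inc p n) : |dd p (fun i => f (- p i)) n 0| ≤ K * bet ε m n p := by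
  have := dd_refl (fun i => - p (n - i)) (fun i => f (- p (n-i))) n n 0 (by omega)
  have e : dd p (fun i => f (-p i)) n 0 = dd (fun i => - (fun i => - p (n-i)) (n - i))
      (fun i => (fun i => f (- p (n-i))) (n - i)) n 0 := by
    apply dd_congr
    · intro i hi; simp; congr 1; omega
    · intro i hi; simp; congr 3; omega
  rw [e, this, abs_mul, abs_pow, abs_neg, abs_one, one_pow, one_mul]
  have : n - 0 - n = 0 := by omega
  rw [this, ← bet_refl (p := p)]
  apply h (fun i => - p (n-i))
  intro i hi
  have := hp (n - (i+1)) (by omega)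
  have e : n - (i+1) + 1 = n - i := by omega
  rw [e] at this
  simpa using this

theorem lam_bound {A B K : ℝ} (hA : |A| ≤ 1) (hB : |B| ≤ 1) {n : ℕ} {f : ℝ → ℝ} {p : ℕ → ℝ}
    (h1 : |dd p (fun i => f (p i)) n 0| ≤ K) (h2 : |dd p (fun i => f (- p i)) n 0| ≤ K) :
    |dd p (fun i => A * f (p i) + B * f (- p i)) n 0| ≤ 2 * K := by
  rw [dd_lin p (fun i => f (p i)) (fun i => f (- p i))]
  refine (abs_add_le _ _).trans ?_
  rw [abs_mul, abs_mul]
  have := abs_nonneg A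
  have := abs_nonneg B
  have := abs_nonneg (dd p (fun i => f (p i)) n 0)
  have := abs_nonneg (dd p (fun i => f (-p i)) n 0)
  nlinarith

theorem prop1_arith {ψ β L m' : ℝ} (hm : 0 < m') (h1 : m' ≤ ψ) (h2 : ψ ≤ 2 * m') (hβ : 1 ≤ β)
    (hL : |L| ≤ 2 * (ψ * β)) : -(ψ * β) * L < 16 * m' ^ 2 * β + ψ * (-((β - 1) * L)) := by
  have h6 := (abs_le.1 hL).1
  have h0 : 0 < ψ := by linarith
  have h7 : -(ψ * β) * L = ψ * (-((β - 1) * L)) - ψ * L := by ring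
  have h8 : ψ * (-L) ≤ ψ * (2 * (ψ * β)) := mul_le_mul_of_nonneg_left (by linarith) h0.le
  have h9 : ψ * ψ ≤ (2 * m') * (2 * m') := by gcongr
  have h10 : (ψ * ψ) * β ≤ ((2 * m') * (2 * m')) * β := by gcongr
  have h11 : 0 < m' ^ 2 * β := by positivity
  nlinarith

theorem prop1 {T A B m : ℝ} {r rx : ℝ → ℝ → ℝ} (h : RT T A B r rx) (hA : |A| ≤ 1) (hB : |B| ≤ 1)
    (hT : 0 ≤ T) (hm : DB 1 (fun x => r x 0) m) :
    ∃ δ M, 0 < δ ∧ ∀ t ∈ Icc (0:ℝ) T, t ≤ δ → DB 1 (fun x => r x t) M := by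
  obtain ⟨M0, hM0, hb⟩ := RS.bdd h
  set m' : ℝ := |m| + 2 * M0 + 1 with hm'
  have hm'0 : 0 < m' := by positivity
  refine ⟨1 / (16 * m'), 2 * m', by positivity, fun t ht htδ p hp => ?_⟩
  set T' := min T (1 / (16 * m')) with hT'
  have h' : RT T' A B r rx := h.mono (min_le_left _ _)
  have htT : t ∈ Icc 0 T' := ⟨ht.1, le_min ht.2 htδ⟩
  have hψ2 : ∀ t ∈ Icc 0 T', m' + 16 * m' ^ 2 * t ≤ 2 * m' ∧ m' ≤ m' + 16 * m' ^ 2 * t := by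
    intro t ht
    have h1 : t ≤ 1 / (16 * m') := ht.2.trans (min_le_right _ _)
    rw [le_div_iff₀ (by positivity)] at h1
    have h0 := ht.1
    constructor
    · nlinarith
    · have : 0 ≤ 16 * m' ^ 2 * t := by positivity
      linarith
  have claim : ∀ ε : ℝ, 0 < ε → |dd p (fun i => r (p i) t) 1 0| < 2 * m' * bet ε 1 1 p := by
    intro ε hε
    obtain ⟨g, hg, hu⟩ := RS.unif h (e := ε * m') (by positivity)
    have := touch h' 1 1 (ε := ε) hg (ψ := fun t => m' + 16 * m' ^ 2 * t)
      (ψ' := fun _ => 16 * m' ^ 2) ?_ ?_ ?_ ?_ t htT p hp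
    · refine this.trans_le ?_
      have := bet_ge_one hε (m := 1) hp
      have := (hψ2 t htT).1
      nlinarith
    · intro t _
      have := ((hasDerivAt_id t).const_mul (16 * m' ^ 2)).const_add m'
      simpa using this.hasDerivWithinAt
    · intro t ht p hp hcase
      have h01 := hp 0 (by omega)
      have hd : 0 < p 1 - p 0 := by simp at h01; linarith
      have hψ := (hψ2 t ht).2
      have htT : t ∈ Icc 0 T := ⟨ht.1, ht.2.trans (min_le_left _ _)⟩
      have hβ := bet_ge_one hε (m := 1) hp
      simp only [dd, zero_add]
      rw [abs_div, abs_of_pos hd]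
      rcases hcase with ⟨i, hi, hgi⟩ | hcase
      · have hi0 : i = 0 := by omega
        subst hi0
        simp only [zero_add] at hgi
        have h1 := hu (p 0) (p 1) t htT (by linarith) hgi
        have h2 := bet_ge_gap hε (m := 1) hp (i := 0) (by omega)
        simp only [zero_add, pow_one] at h2
        have h3 : |r (p 1) t - r (p 0) t| / (p 1 - p 0) < m' * (ε * (p 1 - p 0)⁻¹) := by
          rw [div_eq_mul_inv]
          have : 0 < (p 1 - p 0)⁻¹ := by positivity
          nlinarith
        refine h3.trans_le ?_
        nlinarith
      · have h1 := abs_sub (r (p 1) t) (r (p 0) t)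
        have h2 := hb (p 1) t htT
        have h3 := hb (p 0) t htT
        rw [div_lt_iff₀ hd]
        have h4 : 2 * M0 < m' := by have := abs_nonneg m; linarith
        have h5 : m' ≤ (m' + 16 * m' ^ 2 * t) * bet ε 1 1 p := by nlinarith
        nlinarith
    · intro p hp
      have hβ := bet_ge_one hε (m := 1) hp
      refine (hm p hp).trans_lt ?_
      have := le_abs_self m
      have : m < m' := by linarith
      simp only [mul_zero, add_zero]
      nlinarith
    · intro t ht p hp hall σ hσ heq
      have h01 := hp 0 (by omega)
      have hd : 0 < p 1 - p 0 := by simp at h01; linarith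
      have hβ := bet_ge_one hε (m := 1) hp
      have hl := lam_bound hA hB (f := fun x => r x t) (hall p hp) (refl_bound (f := fun x => r x t) hall hp)
      have e1 : emo p (fun i => r (p i) t) (fun i => A * r (p i) t + B * r (-p i) t) 1 0
          = - (dd p (fun i => r (p i) t) 1 0 *
            dd p (fun i => A * r (p i) t + B * r (-p i) t) 1 0) := by
        simp [emo, dd]
      have e2 : bet' ε 1 1 p (fun i => A * r (p i) t + B * r (-p i) t)
          = -((bet ε 1 1 p - 1) * dd p (fun i => A * r (p i) t + B * r (-p i) t) 1 0) := by
        simp only [bet', bet, dd, Finset.sum_range_one, zero_add]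
        field_simp
        push_cast; ring
      rw [e1, e2]
      set L := dd p (fun i => A * r (p i) t + B * r (-p i) t) 1 0
      set D := dd p (fun i => r (p i) t) 1 0
      set β := bet ε 1 1 p
      have h5 := hψ2 t ht
      set ψ := m' + 16 * m' ^ 2 * t
      have : σ * -(D * L) = -(σ * D) * L := by ring
      rw [this, heq]
      exact prop1_arith hm'0 h5.2 h5.1 hβ hl
  have h01 := hp 0 (by omega)
  have hd : 0 < p 1 - p 0 := by simp at h01; linarith
  refine le_of_forall_pos_lt_add fun e he => ?_
  have := claim (e * (p 1 - p 0) / (2 * m')) (by positivity)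
  refine this.trans_eq ?_
  simp only [bet, Finset.sum_range_one, zero_add]
  field_simp

/-- uniform Lipschitz bound -/
theorem unif1 {T A B : ℝ} {r rx : ℝ → ℝ → ℝ} (h : RT T A B r rx) (hA : |A| ≤ 1) (hB : |B| ≤ 1)
    (hm : ∀ t ∈ Icc (0:ℝ) T, ∃ m, DB 1 (fun x => r x t) m) :
    ∃ M, ∀ t ∈ Icc (0:ℝ) T, DB 1 (fun x => r x t) M := by
  refine (isCompact_Icc (a := (0:ℝ)) (b := T)).induction_on
    (p := fun s => ∃ M, ∀ t ∈ s, t ∈ Icc (0:ℝ) T → DB 1 (fun x => r x t) M) ?_ ?_ ?_ ?_ |>.imp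
      (fun M hM t ht => hM t ht ht)
  · exact ⟨0, by simp⟩
  · rintro s t hst ⟨M, hM⟩; exact ⟨M, fun x hx => hM x (hst hx)⟩
  · rintro s t ⟨M, hM⟩ ⟨K, hK⟩
    refine ⟨max M K, fun x hx hxT => ?_⟩
    rcases hx with hx | hx
    · exact (hM x hx hxT).mono (le_max_left _ _)
    · exact (hK x hx hxT).mono (le_max_right _ _)
  · intro t0 ht0
    obtain ⟨m, hm⟩ := hm t0 ht0
    obtain ⟨δ1, M1, hδ1, hM1⟩ := prop1 (h.fwd ht0.1) hA hB (by linarith [ht0.2])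
      (by simpa using hm)
    obtain ⟨δ2, M2, hδ2, hM2⟩ := prop1 (h.bwd ht0.2) (by simpa using hA) (by simpa using hB) ht0.1
      (by simpa using hm)
    refine ⟨Ioo (t0 - δ2) (t0 + δ1), mem_nhdsWithin_of_mem_nhds
      (Ioo_mem_nhds (by linarith) (by linarith)), max M1 M2, fun t ht htT => ?_⟩
    rcases le_total t0 t with hle | hle
    · have := hM1 (t - t0) ⟨by linarith, by linarith [htT.2]⟩ (by linarith [ht.2])
      simp only [add_sub_cancel] at this
      exact this.mono (le_max_left _ _)
    · have := hM2 (t0 - t) ⟨by linarith, by linarith [htT.1]⟩ (by linarith [ht.1])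
      simp only [sub_sub_cancel] at this
      exact this.mono (le_max_right _ _)

end

section
open Set

theorem dd_rel {p v : ℕ → ℝ} {n k m : ℕ} (hp : Inc p m) (h : k + n + 1 ≤ m) :
    dd p v n (k+1) = dd p v n k + dd p v (n+1) k * (p (k+n+1) - p k) := by
  have := hp.lt (i := k) (j := k+n+1) (by omega) h
  have : p (k+n+1) - p k ≠ 0 := by linarith
  simp only [dd]; field_simp; ring

theorem slope2 {p q : ℕ → ℝ} {m : ℕ} (hp : Inc p m) (k : ℕ) (h : k + 2 ≤ m) :
    (q (k+2) - q k) / (p (k+2) - p k) = dd p q 1 k + dd p q 2 k * (p (k+2) - p (k+1)) := by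
  have := hp.lt (i := k) (j := k+2) (by omega) h
  have h1 : p (k+2) - p k ≠ 0 := by linarith
  have e1 := dd_rel (v := q) (n := 0) (k := k+1) hp (by omega)
  have e2 := dd_rel (v := q) (n := 0) (k := k) hp (by omega)
  have e3 := dd_rel (v := q) (n := 1) (k := k) hp (by omega)
  simp only [show k + 1 + 0 + 1 = k + 2 by ring, show k + 0 + 1 = k + 1 by ring,
    show k + 1 + 1 = k + 2 by ring, zero_add, one_add_one_eq_two] at e1 e2 e3
  have f0 : ∀ j, dd p q 0 j = q j := fun j => rfl
  rw [f0, f0] at e1 e2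
  rw [div_eq_iff h1, e1, e2, e3]; ring

theorem slope3 {p q : ℕ → ℝ} {m : ℕ} (hp : Inc p m) (k : ℕ) (h : k + 3 ≤ m) :
    (q (k+3) - q k) / (p (k+3) - p k) = dd p q 1 k + dd p q 2 k * (p (k+3) - p (k+1))
      + dd p q 3 k * ((p (k+3) - p (k+1)) * (p (k+3) - p (k+2))) := by
  have := hp.lt (i := k) (j := k+3) (by omega) h
  have h1 : p (k+3) - p k ≠ 0 := by linarith
  have := hp.lt (i := k+1) (j := k+3) (by omega) h
  have h2 : p (k+3) - p (k+1) ≠ 0 := by linarith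
  have e0 := slope2 (q := q) hp (k+1) (by omega)
  have e2 := dd_rel (v := q) (n := 0) (k := k) hp (by omega)
  have e3 := dd_rel (v := q) (n := 1) (k := k) hp (by omega)
  have e4 := dd_rel (v := q) (n := 2) (k := k) hp (by omega)
  simp only [show k + 1 + 2 = k + 3 by ring, show k + 0 + 1 = k + 1 by ring,
    show k + 1 + 1 = k + 2 by ring, show k + 2 + 1 = k + 3 by ring,
    zero_add, one_add_one_eq_two, Nat.reduceAdd] at e0 e2 e3 e4
  have f0 : ∀ j, dd p q 0 j = q j := fun j => rfl
  rw [f0, f0] at e2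
  rw [div_eq_iff h2, e2, e3, e4] at e0
  rw [div_eq_iff h1]
  linear_combination e0

theorem emo1 (p v q : ℕ → ℝ) (k : ℕ) : emo p v q 1 k = - (dd p v 1 k * dd p q 1 k) := by
  simp [emo, dd]

theorem emo2 {p v q : ℕ → ℝ} {m : ℕ} (hp : Inc p m) (k : ℕ) (h : k + 2 ≤ m) :
    emo p v q 2 k = - dd p v 2 k * (dd p q 1 k + (q (k+2) - q k) / (p (k+2) - p k))
      - dd p v 1 (k+1) * dd p q 2 k := by
  have := hp.lt (i := k) (j := k+2) (by omega) h
  have h1 : p (k+2) - p k ≠ 0 := by linarith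
  have e1 := dd_rel (v := q) (n := 1) (k := k) hp (by omega)
  have e2 := dd_rel (v := v) (n := 1) (k := k) hp (by omega)
  have : emo p v q 2 k = (emo p v q 1 (k+1) - emo p v q 1 k) / (p (k+2) - p k)
      - dd p v 2 k * ((q (k+2) - q k) / (p (k+2) - p k)) := rfl
  simp only [show k + 1 + 1 = k + 2 by ring, one_add_one_eq_two] at e1 e2
  rw [this, emo1, emo1, sub_eq_iff_eq_add, div_eq_iff h1, e1, e2]
  ring

theorem emo3 {p v q : ℕ → ℝ} {m : ℕ} (hp : Inc p m) (k : ℕ) (h : k + 3 ≤ m) :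
    emo p v q 3 k = - dd p v 3 k * (dd p q 1 k + (q (k+2) - q k) / (p (k+2) - p k)
        + (q (k+3) - q k) / (p (k+3) - p k))
      - dd p v 2 (k+1) * (dd p q 2 k + (dd p q 2 k + dd p q 3 k * (p (k+3) - p (k+2))))
      - dd p v 1 (k+2) * dd p q 3 k := by
  have := hp.lt (i := k) (j := k+3) (by omega) h
  have h1 : p (k+3) - p k ≠ 0 := by linarith
  have e1 := dd_rel (v := q) (n := 1) (k := k) hp (by omega)
  have e1' := dd_rel (v := q) (n := 2) (k := k) hp (by omega)
  have e2 := dd_rel (v := v) (n := 1) (k := k+1) hp (by omega)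
  have e3 := dd_rel (v := v) (n := 2) (k := k) hp (by omega)
  have : emo p v q 3 k = (emo p v q 2 (k+1) - emo p v q 2 k) / (p (k+3) - p k)
      - dd p v 3 k * ((q (k+3) - q k) / (p (k+3) - p k)) := rfl
  simp only [show k + 1 + 1 = k + 2 by ring, show k + 2 + 1 = k + 3 by ring, Nat.reduceAdd] at e1 e2 e3 e1'
  rw [this, emo2 hp k (by omega), emo2 hp (k+1) (by omega), slope2 hp (k+1) (by omega),
    slope2 hp k (by omega), sub_eq_iff_eq_add, div_eq_iff h1]
  simp only [show k + 1 + 1 = k + 2 by ring, show k + 1 + 2 = k + 3 by ring]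
  rw [e1, e2, e1', e3]
  ring

theorem emo4 {p v q : ℕ → ℝ} {m : ℕ} (hp : Inc p m) (k : ℕ) (h : k + 4 ≤ m) :
    emo p v q 4 k = - dd p v 4 k * (dd p q 1 k + (q (k+2) - q k) / (p (k+2) - p k)
        + (q (k+3) - q k) / (p (k+3) - p k) + (q (k+4) - q k) / (p (k+4) - p k))
      - dd p v 3 (k+1) * (dd p q 2 k + (dd p q 2 k + dd p q 3 k * (p (k+3) - p (k+2)))
          + (dd p q 2 k + dd p q 3 k * (p (k+4) - p (k+2))
            + dd p q 4 k * ((p (k+4) - p (k+2)) * (p (k+4) - p (k+3)))))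
      - dd p v 2 (k+2) * (dd p q 3 k + (dd p q 3 k + dd p q 4 k * (p (k+4) - p (k+3))))
      - dd p v 1 (k+3) * dd p q 4 k := by
  have := hp.lt (i := k) (j := k+4) (by omega) h
  have h1 : p (k+4) - p k ≠ 0 := by linarith
  have e1 := dd_rel (v := q) (n := 1) (k := k) hp (by omega)
  have e1' := dd_rel (v := q) (n := 2) (k := k) hp (by omega)
  have e1'' := dd_rel (v := q) (n := 3) (k := k) hp (by omega)
  have e2 := dd_rel (v := v) (n := 1) (k := k+2) hp (by omega)
  have e3 := dd_rel (v := v) (n := 2) (k := k+1) hp (by omega)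
  have e4 := dd_rel (v := v) (n := 3) (k := k) hp (by omega)
  have : emo p v q 4 k = (emo p v q 3 (k+1) - emo p v q 3 k) / (p (k+4) - p k)
      - dd p v 4 k * ((q (k+4) - q k) / (p (k+4) - p k)) := rfl
  simp only [show k + 1 + 1 = k + 2 by ring, show k + 2 + 1 = k + 3 by ring,
    show k + 3 + 1 = k + 4 by ring, show k + 1 + 2 = k + 3 by ring, Nat.reduceAdd]
    at e1 e2 e3 e1' e4 e1''
  rw [this, emo3 hp k (by omega), emo3 hp (k+1) (by omega), slope2 hp (k+1) (by omega),
    slope2 hp k (by omega), slope3 hp (k+1) (by omega),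
    slope3 hp k (by omega), sub_eq_iff_eq_add, div_eq_iff h1]
  simp only [show k + 1 + 1 = k + 2 by ring, show k + 1 + 2 = k + 3 by ring,
    show k + 1 + 3 = k + 4 by ring]
  rw [e1, e1', e1'', e2, e3, e4]
  ring

/-- hypothesis on the commutator -/
def EmoB (n : ℕ) : Prop := ∀ (M : ℝ) (f l : ℝ → ℝ) (p : ℕ → ℝ), 0 ≤ M → Inc p n → p n - p 0 ≤ 1 →
  (∀ k, 1 ≤ k → k < n → DB k f M ∧ DB k l M) →
  |emo p (fun i => f (p i)) (fun i => l (p i)) n 0| ≤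
    4 * M * |dd p (fun i => f (p i)) n 0| + 10 * M ^ 2 + 3 * M * |dd p (fun i => l (p i)) n 0|

theorem DB.lip {f : ℝ → ℝ} {M : ℝ} (h : DB 1 f M) {x y : ℝ} (hxy : x < y) :
    |(f y - f x) / (y - x)| ≤ M := by
  have := h (fun i => if i = 0 then x else y) (by
    intro i hi
    have : i = 0 := by omega
    subst this; simpa using hxy)
  simpa [dd] using this

theorem gap_bound {p : ℕ → ℝ} {n : ℕ} (hp : Inc p n) (hd : p n - p 0 ≤ 1) {i j : ℕ} (hij : i < j) (hj : j ≤ n) :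
    0 ≤ p j - p i ∧ p j - p i ≤ 1 := by
  have h1 := hp.lt hij hj
  have h2 : p 0 ≤ p i := by
    rcases Nat.eq_zero_or_pos i with h | h
    · rw [h]
    · exact (hp.lt h (by omega)).le
  have h4 : p j ≤ p n := by
    rcases Nat.eq_or_lt_of_le hj with h | h
    · rw [h]
    · exact (hp.lt h le_rfl).le
  constructor <;> linarith

theorem abm {a b A B : ℝ} (h1 : |a| ≤ A) (h2 : |b| ≤ B) : |a * b| ≤ A * B := by
  rw [abs_mul]; exact mul_le_mul h1 h2 (abs_nonneg _) ((abs_nonneg _).trans h1)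

theorem abg {a g A : ℝ} (h1 : |a| ≤ A) (h2 : 0 ≤ g ∧ g ≤ 1) : |a * g| ≤ A := by
  have := abm h1 (show |g| ≤ 1 by rw [abs_of_nonneg h2.1]; exact h2.2)
  linarith

theorem emoB2 : EmoB 2 := by
  intro M f l p hM hp hd hk
  rw [emo2 hp 0 (by omega)]
  have h1 := (hk 1 le_rfl (by omega)).2.bound (k := 0) hp (by omega)
  have h2 := (hk 1 le_rfl (by omega)).2.lip (hp.lt (i := 0) (j := 2) (by omega) le_rfl)
  have h3 := (hk 1 le_rfl (by omega)).1.bound (k := 1) hp (by omega)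
  simp only [zero_add] at *
  have a1 := abm (le_refl |dd p (fun i => f (p i)) 2 0|) ((abs_add_le _ _).trans (add_le_add h1 h2))
  have a2 := abm h3 (le_refl |dd p (fun i => l (p i)) 2 0|)
  rw [neg_mul, abs_le]
  rw [abs_le] at a1 a2
  have := mul_nonneg hM (abs_nonneg (dd p (fun i => f (p i)) 2 0))
  have := mul_nonneg hM (abs_nonneg (dd p (fun i => l (p i)) 2 0))
  constructor <;> nlinarith

theorem emoB3 : EmoB 3 := by
  intro M f l p hM hp hd hk
  rw [emo3 hp 0 (by omega)]
  have hl := (hk 1 le_rfl (by omega)).2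
  have h1 := hl.bound (k := 0) hp (by omega)
  have h2 := hl.lip (hp.lt (i := 0) (j := 2) (by omega) (by omega))
  have h2' := hl.lip (hp.lt (i := 0) (j := 3) (by omega) le_rfl)
  have h3 := (hk 1 le_rfl (by omega)).1.bound (k := 2) hp (by omega)
  have h4 := (hk 2 (by omega) (by omega)).1.bound (k := 1) hp (by omega)
  have h5 := (hk 2 (by omega) (by omega)).2.bound (k := 0) hp (by omega)
  have g1 := gap_bound hp hd (i := 2) (j := 3) (by omega) (by omega)
  simp only [zero_add] at *
  have a1 := abm (le_refl |dd p (fun i => f (p i)) 3 0|)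
    ((abs_add_le _ _).trans (add_le_add ((abs_add_le _ _).trans (add_le_add h1 h2)) h2'))
  have a2 := abm h3 (le_refl |dd p (fun i => l (p i)) 3 0|)
  have a3 := abm h4 ((abs_add_le _ _).trans (add_le_add h5 ((abs_add_le _ _).trans
    (add_le_add h5 (abg (le_refl |dd p (fun i => l (p i)) 3 0|) g1)))))
  rw [neg_mul, abs_le]
  rw [abs_le] at a1 a2 a3
  have := mul_nonneg hM (abs_nonneg (dd p (fun i => f (p i)) 3 0))
  have := mul_nonneg hM (abs_nonneg (dd p (fun i => l (p i)) 3 0))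
  constructor <;> nlinarith

theorem emoB4 : EmoB 4 := by
  intro M f l p hM hp hd hk
  rw [emo4 hp 0 (by omega)]
  have hl := (hk 1 le_rfl (by omega)).2
  have h1 := hl.bound (k := 0) hp (by omega)
  have h2 := hl.lip (hp.lt (i := 0) (j := 2) (by omega) (by omega))
  have h2' := hl.lip (hp.lt (i := 0) (j := 3) (by omega) (by omega))
  have h2'' := hl.lip (hp.lt (i := 0) (j := 4) (by omega) le_rfl)
  have h3 := (hk 1 le_rfl (by omega)).1.bound (k := 3) hp (by omega)
  have h4 := (hk 2 (by omega) (by omega)).1.bound (k := 2) hp (by omega)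
  have h4' := (hk 3 (by omega) (by omega)).1.bound (k := 1) hp (by omega)
  have h5 := (hk 2 (by omega) (by omega)).2.bound (k := 0) hp (by omega)
  have h6 := (hk 3 (by omega) (by omega)).2.bound (k := 0) hp (by omega)
  have g1 := gap_bound hp hd (i := 2) (j := 3) (by omega) (by omega)
  have g2 := gap_bound hp hd (i := 2) (j := 4) (by omega) (by omega)
  have g3 := gap_bound hp hd (i := 3) (j := 4) (by omega) (by omega)
  have g4 : 0 ≤ (p 4 - p 2) * (p 4 - p 3) ∧ (p 4 - p 2) * (p 4 - p 3) ≤ 1 :=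
    ⟨mul_nonneg g2.1 g3.1, mul_le_one₀ g2.2 g3.1 g3.2⟩
  simp only [zero_add] at *
  have a1 := abm (le_refl |dd p (fun i => f (p i)) 4 0|)
    ((abs_add_le _ _).trans (add_le_add
    ((abs_add_le _ _).trans (add_le_add ((abs_add_le _ _).trans (add_le_add h1 h2)) h2')) h2''))
  have a2 := abm h3 (le_refl |dd p (fun i => l (p i)) 4 0|)
  have l4 := le_refl |dd p (fun i => l (p i)) 4 0|
  have a3 := abm h4' ((abs_add_le _ _).trans (add_le_add
    ((abs_add_le _ _).trans (add_le_add h5 ((abs_add_le _ _).trans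
    (add_le_add h5 (abg h6 g1))))) ((abs_add_le _ _).trans (add_le_add
    ((abs_add_le _ _).trans (add_le_add h5 (abg h6 g2))) (abg l4 g4)))))
  have a4 := abm h4 ((abs_add_le _ _).trans (add_le_add h6 ((abs_add_le _ _).trans
    (add_le_add h6 (abg l4 g3)))))
  rw [neg_mul, abs_le]
  rw [abs_le] at a1 a2 a3 a4
  have := mul_nonneg hM (abs_nonneg (dd p (fun i => f (p i)) 4 0))
  have := mul_nonneg hM (abs_nonneg (dd p (fun i => l (p i)) 4 0))
  constructor <;> nlinarith

end

section
open Set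

theorem bet'_bound {ε M : ℝ} (hε : 0 < ε) {n : ℕ} {p q : ℕ → ℝ} (hp : Inc p n)
    (hq : ∀ i < n, |q (i+1) - q i| ≤ M * (p (i+1) - p i)) :
    |bet' ε 2 n p q| ≤ 2 * M * (bet ε 2 n p - 1) := by
  unfold bet' bet
  rw [abs_neg, abs_mul, abs_of_pos hε, add_sub_cancel_left]
  have : |∑ i ∈ Finset.range n, ((2:ℕ):ℝ) * (q (i+1) - q i) * ((p (i+1) - p i)^(2+1))⁻¹|
      ≤ ∑ i ∈ Finset.range n, 2 * M * ((p (i+1) - p i)^2)⁻¹ := by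
    refine (Finset.abs_sum_le_sum_abs _ _).trans (Finset.sum_le_sum fun i hi => ?_)
    have hi := Finset.mem_range.1 hi
    have hg : 0 < p (i+1) - p i := by have := hp i hi; linarith
    have h1 := hq i hi
    rw [abs_mul, abs_mul, abs_of_pos (a := ((p (i+1) - p i)^(2+1))⁻¹) (by positivity)]
    simp only [Nat.cast_ofNat, Nat.abs_ofNat]
    calc 2 * |q (i+1) - q i| * ((p (i+1) - p i)^(2+1))⁻¹
        ≤ 2 * (M * (p (i+1) - p i)) * ((p (i+1) - p i)^(2+1))⁻¹ := by gcongr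
      _ = 2 * M * ((p (i+1) - p i)^2)⁻¹ := by field_simp
  rw [← Finset.mul_sum] at this
  calc _ ≤ ε * (2 * M * ∑ i ∈ Finset.range n, ((p (i+1) - p i)^2)⁻¹) := by gcongr
    _ = _ := by ring

theorem touch_arith {M ψ β b' D L E K σ : ℝ} (hM : 0 ≤ M) (hψ : 1 ≤ ψ) (hβ : 1 ≤ β)
    (hσ : σ = 1 ∨ σ = -1) (hD : σ * D = ψ * β) (hL : |L| ≤ 2 * (ψ * β))
    (hE : |E| ≤ 4 * (2 * M) * |D| + 10 * (2 * M)^2 + 3 * (2 * M) * |L|)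
    (hb : |b'| ≤ 2 * (2 * M) * (β - 1)) (hK : K = 24 * M + 40 * M^2 + 1) :
    σ * E < K * ψ * β + ψ * b' := by
  have hψβ : 1 ≤ ψ * β := by nlinarith
  have hD' : |D| = ψ * β := by
    have : |σ * D| = |D| := by rcases hσ with h | h <;> simp [h]
    rw [← this, hD, abs_of_pos (by linarith)]
  have hE' : σ * E ≤ |E| := by
    rcases hσ with h | h
    · rw [h, one_mul]; exact le_abs_self _
    · rw [h, neg_one_mul]; exact neg_le_abs _
  rw [hD'] at hE
  have h1 : |E| ≤ 8 * M * (ψ * β) + 40 * M^2 * (ψ * β) + 12 * M * (ψ * β) := by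
    have : 40 * M^2 * 1 ≤ 40 * M^2 * (ψ * β) := by gcongr
    have : 3 * (2 * M) * |L| ≤ 3 * (2 * M) * (2 * (ψ * β)) := by gcongr
    linarith
  have h2 : - (ψ * b') ≤ 4 * M * (ψ * β) := by
    have : ψ * (-b') ≤ ψ * (2 * (2 * M) * (β - 1)) := by
      have := (abs_le.1 hb).1
      gcongr; linarith
    nlinarith [mul_nonneg hM (by linarith : (0:ℝ) ≤ ψ)]
  rw [hK]
  nlinarith

theorem DB.refl_lin {n : ℕ} {f : ℝ → ℝ} {M A B : ℝ} (hM : 0 ≤ M) (hA : |A| ≤ 1) (hB : |B| ≤ 1)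
    (h : DB n f M) : DB n (fun x => A * f x + B * f (-x)) (2 * M) := by
  refine (h.lin h.refl A B).mono ?_
  nlinarith

theorem propn {T A B M m : ℝ} {r rx : ℝ → ℝ → ℝ} {n : ℕ} (hn : 2 ≤ n) (hEB : EmoB n)
    (h : RT T A B r rx) (hA : |A| ≤ 1) (hB : |B| ≤ 1) (hM : 0 ≤ M)
    (hlow : ∀ t ∈ Icc (0:ℝ) T, ∀ k, 1 ≤ k → k < n → DB k (fun x => r x t) M)
    (hm : DB n (fun x => r x 0) m) :
    ∃ M', ∀ t ∈ Icc (0:ℝ) T, DB n (fun x => r x t) M' := by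
  set K : ℝ := 24 * M + 40 * M^2 + 1 with hK
  have hK0 : 0 < K := by positivity
  set m' : ℝ := |m| + 2 * M + 1 with hm'
  have hm'1 : 1 ≤ m' := by have := abs_nonneg m; linarith
  refine ⟨m' * Real.exp (K * T), fun t ht p hp => ?_⟩
  have hψ : ∀ t ∈ Icc (0:ℝ) T, m' ≤ m' * Real.exp (K * t) := by
    intro t ht
    have : 1 ≤ Real.exp (K * t) := Real.one_le_exp (mul_nonneg hK0.le ht.1)
    nlinarith
  have claim : ∀ ε : ℝ, 0 < ε → |dd p (fun i => r (p i) t) n 0| < m' * Real.exp (K * T) * bet ε 2 n p := by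
    intro ε hε
    have := touch h n 2 (ε := ε) hε (ψ := fun t => m' * Real.exp (K * t))
      (ψ' := fun t => K * (m' * Real.exp (K * t))) ?_ ?_ ?_ ?_ t ht p hp
    · refine this.trans_le ?_
      have := bet_ge_one hε (m := 2) hp
      have h2 := ht.2
      gcongr
    · intro t _
      have h1 : HasDerivAt (fun t : ℝ => K * t) K t := by
        simpa using (hasDerivAt_id t).const_mul K
      have := (h1.exp.const_mul m').hasDerivWithinAt (s := Icc 0 T)
      refine this.congr_deriv ?_
      ring
    · intro t ht p hp hcase
      have hψt := hψ t ht
      have hβ := bet_ge_one hε (m := 2) hp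
      have hlt := hp.lt (i := 0) (j := n) (by omega) le_rfl
      have hd : 0 < p n - p 0 := by linarith
      obtain ⟨n', rfl⟩ : ∃ n', n = n' + 1 := ⟨n - 1, by omega⟩
      refine (dd_succ_bound (hlow t ht n' (by omega) (by omega)) hp).trans_lt ?_
      have h4 : 2 * M < m' := by have := abs_nonneg m; linarith
      rcases hcase with ⟨i, hi, hgi⟩ | hcase
      · have hg : 0 < p (i+1) - p i := by have := hp i hi; linarith
        have hb := bet_ge_gap hε (m := 2) hp hi
        have hgd : p (i+1) - p i ≤ p (n'+1) - p 0 := by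
          have h2 : p 0 ≤ p i := by
            rcases Nat.eq_zero_or_pos i with h | h
            · rw [h]
            · exact (hp.lt h (by omega)).le
          have h4 : p (i+1) ≤ p (n'+1) := by
            rcases Nat.eq_or_lt_of_le (show i+1 ≤ n'+1 by omega) with h | h
            · rw [h]
            · exact (hp.lt h le_rfl).le
          linarith
        calc 2 * M / (p (n'+1) - p 0) ≤ 2 * M / (p (i+1) - p i) := by gcongr
          _ ≤ m' / (p (i+1) - p i) := by gcongr
          _ ≤ m' * (ε * ((p (i+1) - p i)^2)⁻¹) := by
            rw [div_eq_mul_inv]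
            gcongr
            rw [← div_eq_mul_inv, le_div_iff₀ (by positivity), pow_two, ← mul_assoc,
              inv_mul_cancel₀ hg.ne', one_mul]
            exact hgi.le
          _ < m' * Real.exp (K * t) * bet ε 2 (n'+1) p := by
            have : 0 < m' := by linarith
            calc _ < m' * bet ε 2 (n'+1) p := by gcongr
              _ ≤ _ := by gcongr
      · rw [div_lt_iff₀ hd]
        calc 2 * M < m' := h4
          _ ≤ m' * Real.exp (K * t) := hψt
          _ ≤ m' * Real.exp (K * t) * (bet ε 2 (n'+1) p * (p (n'+1) - p 0)) := by
            refine le_mul_of_one_le_right (by positivity) ?_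
            nlinarith
          _ = _ := by ring
    · intro p hp
      have hβ := bet_ge_one hε (m := 2) hp
      refine (hm p hp).trans_lt ?_
      have := le_abs_self m
      have : m < m' := by linarith
      simp only [mul_zero, Real.exp_zero, mul_one]
      nlinarith
    · intro t ht p hp hall σ hσ heq
      have hβ := bet_ge_one hε (m := 2) hp
      have hψt := hψ t ht
      have hl := lam_bound hA hB (f := fun x => r x t) (hall p hp)
        (refl_bound (f := fun x => r x t) hall hp)
      have hlt := hp.lt (i := 0) (j := n) (by omega) le_rfl
      have habs : m' * Real.exp (K * t) * bet ε 2 n p ≤ |dd p (fun i => r (p i) t) n 0| := by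
        refine heq.symm.le.trans ?_
        rcases hσ with h | h
        · rw [h, one_mul]; exact le_abs_self _
        · rw [h, neg_one_mul]; exact neg_le_abs _
      have hdiam : p n - p 0 ≤ 1 := by
        by_contra hcc
        push Not at hcc
        have hd : 0 < p n - p 0 := by linarith
        obtain ⟨n', rfl⟩ : ∃ n', n = n' + 1 := ⟨n - 1, by omega⟩
        have h1 := dd_succ_bound (hlow t ht n' (by omega) (by omega)) hp
        have h4 : 2 * M < m' := by have := abs_nonneg m; linarith
        have h2 : 2 * M / (p (n'+1) - p 0) ≤ 2 * M := div_le_self (by positivity) hcc.le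
        nlinarith
      refine touch_arith (E := emo p (fun i => r (p i) t) (fun i => A * r (p i) t + B * r (-p i) t) n 0)
        hM (by linarith) hβ hσ heq hl ?_ ?_ hK
      · exact hEB (2 * M) (fun x => r x t) (fun x => A * r x t + B * r (-x) t) p (by linarith) hp hdiam
          (fun k hk1 hk2 => ⟨(hlow t ht k hk1 hk2).mono (by linarith),
            (hlow t ht k hk1 hk2).refl_lin hM hA hB⟩)
      · refine bet'_bound hε hp fun i hi => ?_
        have h1 := ((hlow t ht 1 le_rfl (by omega)).refl_lin hM hA hB).lip (hp i hi)
        have hg : 0 < p (i+1) - p i := by have := hp i hi; linarith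
        rwa [abs_div, abs_of_pos hg, div_le_iff₀ hg] at h1
  -- let ε → 0
  set S := ∑ i ∈ Finset.range n, ((p (i+1) - p i)^2)⁻¹ with hS
  have hS0 : 0 ≤ S := Finset.sum_nonneg fun i hi => by positivity
  refine le_of_forall_pos_lt_add fun e he => ?_
  have hC : 0 < m' * Real.exp (K * T) := by positivity
  have := claim (e / (m' * Real.exp (K * T) * (S + 1))) (by positivity)
  refine this.trans_le ?_
  unfold bet
  rw [← hS, mul_add, mul_one]
  gcongr
  rw [← mul_assoc, mul_div_assoc', div_mul_eq_mul_div, div_le_iff₀ (by positivity)]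
  nlinarith [mul_pos hC he]

theorem unifn {T A B M m ts : ℝ} {r rx : ℝ → ℝ → ℝ} {n : ℕ} (hn : 2 ≤ n) (hEB : EmoB n)
    (h : RT T A B r rx) (hA : |A| ≤ 1) (hB : |B| ≤ 1) (hM : 0 ≤ M) (hts : ts ∈ Icc (0:ℝ) T)
    (hlow : ∀ t ∈ Icc (0:ℝ) T, ∀ k, 1 ≤ k → k < n → DB k (fun x => r x t) M)
    (hm : DB n (fun x => r x ts) m) :
    ∃ M', ∀ t ∈ Icc (0:ℝ) T, DB n (fun x => r x t) M' := by
  obtain ⟨M1, hM1⟩ := propn hn hEB (h.fwd hts.1) hA hB hM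
    (fun t ht => hlow _ ⟨by linarith [ht.1, hts.1], by linarith [ht.2]⟩) (by simpa using hm)
  obtain ⟨M2, hM2⟩ := propn hn hEB (h.bwd hts.2) (by simpa using hA) (by simpa using hB) hM
    (fun t ht => hlow _ ⟨by linarith [ht.2], by linarith [ht.1, hts.2]⟩) (by simpa using hm)
  refine ⟨max M1 M2, fun t htT => ?_⟩
  rcases le_total ts t with hle | hle
  · have := hM1 (t - ts) ⟨by linarith, by linarith [htT.2]⟩
    simp only [add_sub_cancel] at this
    exact this.mono (le_max_left _ _)
  · have := hM2 (ts - t) ⟨by linarith, by linarith [htT.1]⟩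
    simp only [sub_sub_cancel] at this
    exact this.mono (le_max_right _ _)

end

section
open Set

theorem dd_const (p : ℕ → ℝ) (c : ℝ) (n k : ℕ) : dd p (fun _ => c) (n+1) k = 0 := by
  induction n generalizing k with
  | zero => simp [dd]
  | succ n ih => rw [dd, ih, ih]; simp

theorem dd_leib {p w : ℕ → ℝ} {m : ℕ} (hp : Inc p m) (c : ℝ) (n k : ℕ) (h : k + n + 1 ≤ m) :
    dd p (fun i => (p i - c) * w i) (n+1) k
      = dd p w n k + (p (k+n+1) - c) * dd p w (n+1) k := by
  induction n generalizing k with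
  | zero =>
    have := hp.lt (i := k) (j := k+1) (by omega) (by omega)
    have : p (k+1) - p k ≠ 0 := by linarith
    simp only [dd, add_zero]
    field_simp
    ring
  | succ n ih =>
    rw [dd, ih (k+1) (by omega), ih k (by omega)]
    have := hp.lt (i := k) (j := k+(n+1)+1) (by omega) (by omega)
    have h1 : p (k+(n+1)+1) - p k ≠ 0 := by linarith
    have e := dd_rel (v := w) (n := n) (k := k) hp (by omega)
    have e2 := dd_rel (v := w) (n := n+1) (k := k) hp (by omega)
    rw [show k + 1 + n + 1 = k + (n+1) + 1 by ring]
    rw [div_eq_iff h1, e, e2, show k + n + 1 = k + (n+1) by ring]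
    ring

theorem dd_scale (p v : ℕ → ℝ) (c τ : ℝ) (hτ : τ ≠ 0) (n k : ℕ) :
    dd p v n k = τ ^ n * dd (fun i => c + τ * (p i - c)) v n k := by
  induction n generalizing k with
  | zero => simp [dd]
  | succ n ih =>
    simp only [dd]
    rw [ih (k+1), ih k]
    have : c + τ * (p (k+n+1) - c) - (c + τ * (p k - c)) = τ * (p (k+n+1) - p k) := by ring
    rw [this, pow_succ]
    rcases eq_or_ne (p (k+n+1) - p k) 0 with h | h
    · simp [h]
    · field_simp

theorem DB.nonneg {n : ℕ} {f : ℝ → ℝ} {M : ℝ} (h : DB n f M) : 0 ≤ M :=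
  (abs_nonneg _).trans (h (fun i => (i:ℝ)) (fun i _ => by push_cast; linarith))

theorem DB.deriv {n : ℕ} {F G : ℝ → ℝ} {M : ℝ} (hd : ∀ x, HasDerivAt F (G x) x) (h : DB n G M) :
    DB (n+1) F M := by
  intro p hp
  set c := p (n+1) with hc
  have hlin : ∀ i (τ : ℝ), HasDerivAt (fun τ : ℝ => c + τ * (p i - c)) (p i - c) τ := fun i τ => by
    simpa using ((hasDerivAt_id τ).mul_const (p i - c)).const_add c
  have hder : ∀ τ ∈ Icc (0:ℝ) 1, HasDerivWithinAt (fun τ => dd p (fun i => F (c + τ * (p i - c))) (n+1) 0)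
      (dd p (fun i => G (c + τ * (p i - c))) n 0) (Icc 0 1) τ := by
    intro τ _
    have := dd_hasDeriv (P := fun _ => p) (V := fun τ i => F (c + τ * (p i - c))) (q := fun _ => 0)
      (v' := fun i => (p i - c) * G (c + τ * (p i - c)))
      (s := Icc 0 1) (τ := τ) (m := n+1) (fun i => hasDerivWithinAt_const _ _ _)
      (fun i => by
        have := (hd (c + τ * (p i - c))).comp τ (hlin i τ)
        refine (this.congr_deriv ?_).hasDerivWithinAt
        ring) hp (n+1) 0 (by omega)
    rw [emo_zero, add_zero, dd_leib hp c n 0 (by omega)] at this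
    refine this.congr_deriv ?_
    rw [show 0 + n + 1 = n + 1 by ring, ← hc]; ring
  have hb : ∀ τ ∈ Ico (0:ℝ) 1, ‖dd p (fun i => G (c + τ * (p i - c))) n 0‖ ≤ M := by
    intro τ hτ
    rcases hτ.1.eq_or_lt with h0 | h0
    · rcases n with _ | n
      · exact h (fun i => c + τ * (p i - c)) (fun i hi => by omega)
      · subst h0
        simp only [zero_mul, add_zero]
        rw [dd_const]; simpa using h.nonneg
    · rw [dd_scale p _ c τ h0.ne', Real.norm_eq_abs, abs_mul, abs_of_pos (by positivity)]
      have h1 := h (fun i => c + τ * (p i - c)) (fun i hi => by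
        have := hp i (by omega)
        have : τ * p i < τ * p (i+1) := by gcongr
        simp only; nlinarith)
      have h2 : τ ^ n ≤ 1 := pow_le_one₀ hτ.1 hτ.2.le
      have := abs_nonneg (dd (fun i => c + τ * (p i - c)) (fun i => G (c + τ * (p i - c))) n 0)
      have h3 := h.nonneg
      calc _ ≤ 1 * M := by gcongr
        _ = M := one_mul _
  have := norm_image_sub_le_of_norm_deriv_le_segment_01' hder hb
  simp only [zero_mul, add_zero, one_mul, dd_const, sub_zero, Real.norm_eq_abs] at this
  simpa using this

theorem DB.of_bdd {f : ℝ → ℝ} {M : ℝ} (h : ∀ x, |f x| ≤ M) : DB 0 f M := fun p _ => h _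

theorem DB.of_lip {f : ℝ → ℝ} {M : ℝ} (h : ∀ x y, |f y - f x| ≤ M * |y - x|) : DB 1 f M := by
  intro p hp
  have := hp 0 (by omega)
  simp only [zero_add] at this
  have hd : 0 < |p 1 - p 0| := by rw [abs_of_pos] <;> linarith
  simp only [dd, zero_add]
  rw [abs_div, div_le_iff₀ hd]
  exact h _ _

/-- reduced variable in `[-1,1)` -/
def red (x : ℝ) : ℝ := x - 2 * round (x / 2)

theorem red_mem (x : ℝ) : -1 ≤ red x ∧ red x < 1 := by
  unfold red; rw [round_eq]
  have h1 := Int.floor_le (x / 2 + 1 / 2)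
  have h2 := Int.lt_floor_add_one (x / 2 + 1 / 2)
  constructor <;> linarith

theorem red_add (x : ℝ) : red (x + 2) = red x := by
  unfold red
  have : (x + 2) / 2 = x / 2 + (1:ℤ) := by push_cast; ring
  rw [this, round_add_intCast]; push_cast; ring

theorem red_self {x : ℝ} (h : -1 ≤ x) (h1 : x < 1) : red x = x := by
  unfold red; rw [round_eq]
  have : ⌊x / 2 + 1 / 2⌋ = 0 := by rw [Int.floor_eq_zero_iff]; constructor <;> linarith
  rw [this]; simp

theorem red_one : red 1 = -1 := by
  have := red_add (-1)
  rw [red_self le_rfl (by norm_num)] at this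
  rw [← this]; norm_num

/-- reflection-extension with sign `s` and period 2 -/
def ex (s : ℝ) (g : ℝ → ℝ) (x : ℝ) : ℝ := if 0 ≤ red x then g (red x) else s * g (- red x)

theorem ex_per (s : ℝ) (g : ℝ → ℝ) (x : ℝ) : ex s g (x + 2) = ex s g x := by
  unfold ex; rw [red_add]

theorem ex_mem {s : ℝ} {g : ℝ → ℝ} (h1 : g 1 = s * g 1) {x : ℝ} (hx : x ∈ Icc (0:ℝ) 1) :
    ex s g x = g x := by
  rcases hx.2.lt_or_eq with h | h
  · unfold ex; rw [red_self (by linarith [hx.1]) h, if_pos hx.1]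
  · subst h; unfold ex; rw [red_one]; norm_num; exact h1.symm

theorem ex_neg {s : ℝ} (hs : s * s = 1) {g : ℝ → ℝ} (h0 : g 0 = s * g 0) (h1 : g 1 = s * g 1) (x : ℝ) :
    ex s g (-x) = s * ex s g x := by
  have hP : Function.Periodic (ex s g) 2 := ex_per s g
  obtain ⟨k, hk⟩ : ∃ k : ℤ, x = red x + k * 2 := ⟨round (x/2), by unfold red; ring⟩
  have e1 : ex s g x = ex s g (red x) := by rw [hk, hP.int_mul]; rw [← hk]
  have e2 : ex s g (-x) = ex s g (-red x) := by
    rw [hk, neg_add, show -((k:ℝ) * 2) = ((-k : ℤ):ℝ) * 2 by push_cast; ring, hP.int_mul, ← hk]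
  rw [e1, e2]
  have hr := red_mem x
  set y := red x
  rcases lt_trichotomy y 0 with h | h | h
  · rw [ex_mem h1 (x := -y) ⟨by linarith, by linarith⟩]
    unfold ex
    rw [red_self hr.1 hr.2, if_neg (by linarith), ← mul_assoc, hs, one_mul]
  · rw [h, neg_zero, ex_mem h1 (x := 0) (by simp)]; exact h0
  · rw [ex_mem h1 (x := y) ⟨by linarith, by linarith⟩]
    unfold ex
    rw [red_self (x := -y) (by linarith) (by linarith), if_neg (by linarith), neg_neg]

theorem ex_deriv {s : ℝ} {F G : ℝ → ℝ} (hF : ∀ x, F (-x) = s * F x) (hFp : ∀ x, F (x+2) = F x)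
    (hG : ∀ x, G (-x) = -s * G x) (hGp : ∀ x, G (x+2) = G x)
    (hd : ∀ x ∈ Icc (0:ℝ) 1, HasDerivWithinAt F (G x) (Icc 0 1) x) (x : ℝ) : HasDerivAt F (G x) x := by
  have hd2 : ∀ x ∈ Icc (-1:ℝ) 0, HasDerivWithinAt F (G x) (Icc (-1) 0) x := by
    intro x hx
    have h1 := hd (-x) ⟨by linarith [hx.2], by linarith [hx.1]⟩
    have h2 : HasDerivWithinAt (fun y : ℝ => -y) (-1) (Icc (-1) 0) x :=
      (hasDerivAt_neg x).hasDerivWithinAt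
    have hmap : MapsTo (fun y : ℝ => -y) (Icc (-1) 0) (Icc 0 1) :=
      fun y hy => ⟨by linarith [hy.2], by linarith [hy.1]⟩
    have h3 := (h1.comp x h2 hmap).const_mul s
    have e : ∀ y, F y = s * F (-y) := fun y => by
      have := hF (-y); rwa [neg_neg] at this
    have e2 : G x = -s * G (-x) := by have := hG (-x); rwa [neg_neg] at this
    refine (h3.congr_deriv ?_).congr (fun y _ => e y) (e x)
    rw [e2]; ring
  have hsh : ∀ (k : ℤ) (a b x : ℝ), HasDerivWithinAt F (G (x + k * 2)) (Icc (a + k * 2) (b + k * 2)) (x + k * 2) →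
      HasDerivWithinAt F (G x) (Icc a b) x := by
    intro k a b x h
    have hP : Function.Periodic F 2 := hFp
    have hPG : Function.Periodic G 2 := hGp
    have h2 : HasDerivWithinAt (fun y : ℝ => y + k * 2) 1 (Icc a b) x :=
      ((hasDerivAt_id x).add_const _).hasDerivWithinAt
    have hmap : MapsTo (fun y : ℝ => y + k * 2) (Icc a b) (Icc (a + k * 2) (b + k * 2)) :=
      fun y hy => ⟨by linarith [hy.1], by linarith [hy.2]⟩
    have h3 := h.comp x h2 hmap
    have e : (F ∘ fun y : ℝ => y + k * 2) = F := by
      funext y; exact hP.int_mul k y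
    rw [e, hPG.int_mul, mul_one] at h3
    exact h3
  -- general
  have main : ∀ y ∈ Icc (-1:ℝ) 1, y < 1 → HasDerivAt F (G y) y := by
    intro y hy hy1
    rcases lt_trichotomy y 0 with h | h | h
    · rcases hy.1.eq_or_lt with h' | h'
      · subst h'
        have a1 := hd2 (-1) (by simp)
        have a2 : HasDerivWithinAt F (G (-1)) (Icc (-2) (-1)) (-1) :=
          hsh 1 _ _ _ (by convert hd 1 (by simp) using 2 <;> norm_num)
        have := a2.union a1
        refine this.hasDerivAt ?_
        rw [Icc_union_Icc_eq_Icc (by norm_num) (by norm_num)]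
        exact Icc_mem_nhds (by norm_num) (by norm_num)
      · exact (hd2 y ⟨hy.1, h.le⟩).hasDerivAt (Icc_mem_nhds h' h)
    · subst h
      have := (hd2 0 (by simp)).union (hd 0 (by simp))
      refine this.hasDerivAt ?_
      rw [Icc_union_Icc_eq_Icc (by norm_num) (by norm_num)]
      exact Icc_mem_nhds (by norm_num) (by norm_num)
    · exact (hd y ⟨h.le, hy.2⟩).hasDerivAt (Icc_mem_nhds h hy1)
  have hr := red_mem x
  have h1 := main (red x) ⟨hr.1, hr.2.le⟩ hr.2
  have hx : red x = x + (-round (x/2) : ℤ) * 2 := by unfold red; push_cast; ring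
  have hP : Function.Periodic F 2 := hFp
  have hPG : Function.Periodic G 2 := hGp
  rw [hx, hPG.int_mul] at h1
  have h2 : HasDerivAt (fun y : ℝ => y + (-round (x/2) : ℤ) * 2) 1 x := (hasDerivAt_id x).add_const _
  have h3 := h1.comp x h2
  have e : (F ∘ fun y : ℝ => y + (-round (x/2) : ℤ) * 2) = F := by
    funext y; exact hP.int_mul _ y
  rwa [e, mul_one] at h3

theorem ex_bdd {s M : ℝ} (hs : |s| = 1) {g : ℝ → ℝ} (h : ∀ x ∈ Icc (0:ℝ) 1, |g x| ≤ M) (x : ℝ) :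
    |ex s g x| ≤ M := by
  have hr := red_mem x
  unfold ex
  split_ifs with h0
  · exact h _ ⟨h0, hr.2.le⟩
  · rw [abs_mul, hs, one_mul]; exact h _ ⟨by linarith, by linarith⟩

theorem ex_one_eq (g : ℝ → ℝ) (x : ℝ) : ex 1 g x = g |red x| := by
  unfold ex
  split_ifs with h0
  · rw [abs_of_nonneg h0]
  · rw [one_mul, abs_of_neg (by linarith)]

theorem abs_red_sub (x y : ℝ) : |(|red x| - |red y|)| ≤ |x - y| := by
  have key : ∀ x y : ℝ, |red x| - |red y| ≤ |x - y| := by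
    intro x y
    have h1 : |red x| ≤ |x - 2 * round (y/2)| := by
      have := round_le (x/2) (round (y/2))
      have e1 : |red x| = 2 * |x / 2 - round (x/2)| := by
        unfold red
        rw [← abs_two, ← abs_mul, abs_two]; congr 1; ring
      have e2 : |x - 2 * round (y/2)| = 2 * |x / 2 - round (y/2)| := by
        rw [← abs_two, ← abs_mul, abs_two]; congr 1; ring
      rw [e1, e2]; linarith
    have h2 : |x - 2 * round (y/2)| ≤ |x - y| + |red y| := by
      have : x - 2 * round (y/2) = (x - y) + red y := by unfold red; ring
      rw [this]; exact abs_add_le _ _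
    linarith
  rw [abs_le]
  constructor
  · have := key y x; rw [abs_sub_comm] at this; linarith
  · exact key x y

theorem ex_lip {M : ℝ} (hM : 0 ≤ M) {g : ℝ → ℝ}
    (h : ∀ x ∈ Icc (0:ℝ) 1, ∀ y ∈ Icc (0:ℝ) 1, |g y - g x| ≤ M * |y - x|) :
    DB 1 (ex 1 g) M := by
  apply DB.of_lip
  intro x y
  rw [ex_one_eq, ex_one_eq]
  have m : ∀ x, |red x| ∈ Icc (0:ℝ) 1 := fun x => by
    have := red_mem x
    exact ⟨abs_nonneg _, abs_le.2 ⟨this.1, this.2.le⟩⟩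
  refine (h _ (m x) _ (m y)).trans ?_
  have := abs_red_sub y x
  gcongr

end

section
open Set

abbrev II : Set ℝ := Icc (0:ℝ) 1
def Dk (k : ℕ) (f : ℝ → ℝ) : ℝ → ℝ := iteratedDerivWithin k f II

theorem Dk_zero (f : ℝ → ℝ) : Dk 0 f = f := by unfold Dk; exact iteratedDerivWithin_zero

theorem Dk_one (f : ℝ → ℝ) (x : ℝ) : Dk 1 f x = derivWithin f II x := by
  unfold Dk; rw [iteratedDerivWithin_one]

theorem Dk_deriv {f : ℝ → ℝ} (hf : ContDiffOn ℝ 4 f II) {k : ℕ} (hk : k < 4) {x : ℝ} (hx : x ∈ II) :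
    HasDerivWithinAt (Dk k f) (Dk (k+1) f x) II x := by
  have hu : UniqueDiffOn ℝ II := uniqueDiffOn_Icc (by norm_num)
  have := (hf.differentiableOn_iteratedDerivWithin (m := k) (by exact_mod_cast hk) hu) x hx
  have h2 := this.hasDerivWithinAt
  unfold Dk
  rwa [iteratedDerivWithin_succ]

theorem Dk_cont {f : ℝ → ℝ} (hf : ContDiffOn ℝ 4 f II) {k : ℕ} (hk : k ≤ 4) : ContinuousOn (Dk k f) II :=
  hf.continuousOn_iteratedDerivWithin (by exact_mod_cast hk) (uniqueDiffOn_Icc (by norm_num))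

theorem Dk_bdd {f : ℝ → ℝ} (hf : ContDiffOn ℝ 4 f II) {k : ℕ} (hk : k ≤ 4) :
    ∃ M, 0 ≤ M ∧ ∀ x ∈ II, |Dk k f x| ≤ M := by
  obtain ⟨C, hC⟩ := isCompact_Icc.exists_bound_of_continuousOn (Dk_cont hf hk)
  exact ⟨C, (norm_nonneg _).trans (hC 0 (by simp)), hC⟩

theorem Dk_lip {f : ℝ → ℝ} (hf : ContDiffOn ℝ 4 f II) {k : ℕ} (hk : k < 4) :
    ∃ M, 0 ≤ M ∧ ∀ x ∈ II, ∀ y ∈ II, |Dk k f y - Dk k f x| ≤ M * |y - x| := by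
  obtain ⟨M, hM, hb⟩ := Dk_bdd hf (k := k+1) (by omega)
  refine ⟨M, hM, fun x hx y hy => ?_⟩
  exact (convex_Icc (0:ℝ) 1).norm_image_sub_le_of_norm_hasDerivWithin_le
    (fun z hz => Dk_deriv hf hk hz) (fun z hz => hb z hz) hx hy

theorem exD_even {f : ℝ → ℝ} (hf : ContDiffOn ℝ 4 f II) {k : ℕ} (hk : k < 4)
    (h0 : Dk (k+1) f 0 = 0) (h1 : Dk (k+1) f 1 = 0) (x : ℝ) :
    HasDerivAt (ex 1 (Dk k f)) (ex (-1) (Dk (k+1) f) x) x := by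
  refine ex_deriv (s := 1) (fun x => ex_neg (by norm_num) (by simp) (by simp) x) (ex_per _ _)
    (fun x => by rw [ex_neg (by norm_num) (by simp [h0]) (by simp [h1])]) (ex_per _ _) ?_ x
  intro x hx
  have := Dk_deriv hf hk hx
  rw [ex_mem (by simp [h1]) hx]
  exact this.congr (fun y hy => ex_mem (by simp) hy) (ex_mem (by simp) hx)

theorem exD_odd {f : ℝ → ℝ} (hf : ContDiffOn ℝ 4 f II) {k : ℕ} (hk : k < 4)
    (h0 : Dk k f 0 = 0) (h1 : Dk k f 1 = 0) (x : ℝ) :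
    HasDerivAt (ex (-1) (Dk k f)) (ex 1 (Dk (k+1) f) x) x := by
  refine ex_deriv (s := -1) (fun x => ex_neg (by norm_num) (by simp [h0]) (by simp [h1]) x) (ex_per _ _)
    (fun x => by rw [ex_neg (by norm_num) (by simp) (by simp)]; norm_num) (ex_per _ _) ?_ x
  intro x hx
  have := Dk_deriv hf hk hx
  rw [ex_mem (by simp) hx]
  exact this.congr (fun y hy => ex_mem (by simp [h1]) hy) (ex_mem (by simp [h1]) hx)

theorem DB.add {n : ℕ} {f g : ℝ → ℝ} (hf : ∃ M, DB n f M) (hg : ∃ M, DB n g M) :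
    ∃ M, DB n (fun x => f x + g x) M := by
  obtain ⟨M, hM⟩ := hf
  obtain ⟨K, hK⟩ := hg
  exact ⟨_, by simpa using hM.lin hK 1 1⟩

section dbs
variable {f g : ℝ → ℝ} (hf : ContDiffOn ℝ 4 f II) (hg : ContDiffOn ℝ 4 g II)
  (f0 : Dk 1 f 0 = 0) (f1 : Dk 1 f 1 = 0) (g0 : Dk 0 g 0 = 0) (g1 : Dk 0 g 1 = 0)

theorem db1 (hf : ContDiffOn ℝ 4 f II) (hg : ContDiffOn ℝ 4 g II)
    (f0 : Dk 1 f 0 = 0) (f1 : Dk 1 f 1 = 0) (g0 : Dk 0 g 0 = 0) (g1 : Dk 0 g 1 = 0) :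
    ∃ M, DB 1 (fun x => ex (-1) g x + ex 1 f x) M := by
  obtain ⟨M, -, hM⟩ := Dk_bdd hf (k := 1) (by omega)
  obtain ⟨K, -, hK⟩ := Dk_bdd hg (k := 1) (by omega)
  apply DB.add
  · have := exD_odd hg (k := 0) (by omega) g0 g1
    rw [Dk_zero] at this
    exact ⟨K, DB.deriv this (DB.of_bdd (ex_bdd (by norm_num) hK))⟩
  · have := exD_even hf (k := 0) (by omega) f0 f1
    rw [Dk_zero] at this
    exact ⟨M, DB.deriv this (DB.of_bdd (ex_bdd (by norm_num) hM))⟩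

theorem db2 (hf : ContDiffOn ℝ 4 f II) (hg : ContDiffOn ℝ 4 g II)
    (f0 : Dk 1 f 0 = 0) (f1 : Dk 1 f 1 = 0) (g0 : Dk 0 g 0 = 0) (g1 : Dk 0 g 1 = 0) :
    ∃ M, DB 2 (fun x => ex (-1) g x + ex 1 f x) M := by
  obtain ⟨M, -, hM⟩ := Dk_bdd hf (k := 2) (by omega)
  obtain ⟨K, hK0, hK⟩ := Dk_lip hg (k := 1) (by omega)
  apply DB.add
  · have := exD_odd hg (k := 0) (by omega) g0 g1
    rw [Dk_zero] at this
    exact ⟨K, DB.deriv this (ex_lip hK0 hK)⟩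
  · have := exD_even hf (k := 0) (by omega) f0 f1
    rw [Dk_zero] at this
    exact ⟨M, DB.deriv this (DB.deriv (exD_odd hf (k := 1) (by omega) f0 f1)
      (DB.of_bdd (ex_bdd (by norm_num) hM)))⟩

theorem db3 (hf : ContDiffOn ℝ 4 f II) (hg : ContDiffOn ℝ 4 g II)
    (f0 : Dk 1 f 0 = 0) (f1 : Dk 1 f 1 = 0) (g0 : Dk 0 g 0 = 0) (g1 : Dk 0 g 1 = 0)
    (g20 : Dk 2 g 0 = 0) (g21 : Dk 2 g 1 = 0) :
    ∃ M, DB 3 (fun x => ex (-1) g x + ex 1 f x) M := by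
  obtain ⟨M, hM0, hM⟩ := Dk_lip hf (k := 2) (by omega)
  obtain ⟨K, -, hK⟩ := Dk_bdd hg (k := 3) (by omega)
  apply DB.add
  · have := exD_odd hg (k := 0) (by omega) g0 g1
    rw [Dk_zero] at this
    exact ⟨K, DB.deriv this (DB.deriv (exD_even hg (k := 1) (by omega) g20 g21)
      (DB.deriv (exD_odd hg (k := 2) (by omega) g20 g21) (DB.of_bdd (ex_bdd (by norm_num) hK))))⟩
  · have := exD_even hf (k := 0) (by omega) f0 f1
    rw [Dk_zero] at this
    exact ⟨M, DB.deriv this (DB.deriv (exD_odd hf (k := 1) (by omega) f0 f1) (ex_lip hM0 hM))⟩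

theorem db4 (hf : ContDiffOn ℝ 4 f II) (hg : ContDiffOn ℝ 4 g II)
    (f0 : Dk 1 f 0 = 0) (f1 : Dk 1 f 1 = 0) (g0 : Dk 0 g 0 = 0) (g1 : Dk 0 g 1 = 0)
    (g20 : Dk 2 g 0 = 0) (g21 : Dk 2 g 1 = 0) (f30 : Dk 3 f 0 = 0) (f31 : Dk 3 f 1 = 0) :
    ∃ M, DB 4 (fun x => ex (-1) g x + ex 1 f x) M := by
  obtain ⟨M, -, hM⟩ := Dk_bdd hf (k := 4) (by omega)
  obtain ⟨K, hK0, hK⟩ := Dk_lip hg (k := 3) (by omega)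
  apply DB.add
  · have := exD_odd hg (k := 0) (by omega) g0 g1
    rw [Dk_zero] at this
    exact ⟨K, DB.deriv this (DB.deriv (exD_even hg (k := 1) (by omega) g20 g21)
      (DB.deriv (exD_odd hg (k := 2) (by omega) g20 g21) (ex_lip hK0 hK)))⟩
  · have := exD_even hf (k := 0) (by omega) f0 f1
    rw [Dk_zero] at this
    exact ⟨M, DB.deriv this (DB.deriv (exD_odd hf (k := 1) (by omega) f0 f1)
      (DB.deriv (exD_even hf (k := 2) (by omega) f30 f31) (DB.deriv
        (exD_odd hf (k := 3) (by omega) f30 f31) (DB.of_bdd (ex_bdd (by norm_num) hM)))))⟩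
end dbs

theorem ex_cont {s : ℝ} (hs : s * s = 1) {g : ℝ → ℝ → ℝ} {J : Set ℝ} (hJ : IsClosed J)
    (hg : ContinuousOn (fun p : ℝ × ℝ => g p.1 p.2) (II ×ˢ J))
    (h0 : ∀ t ∈ J, g 0 t = s * g 0 t) (h1 : ∀ t ∈ J, g 1 t = s * g 1 t) :
    ContinuousOn (fun p : ℝ × ℝ => ex s (fun y => g y p.2) p.1) (univ ×ˢ J) := by
  set H : ℝ × ℝ → ℝ := fun p => ex s (fun y => g y p.2) p.1 with hH
  have hper : ∀ (k : ℤ) x t, H (x + k * 2, t) = H (x, t) := fun k x t =>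
    (show Function.Periodic (ex s (fun y => g y t)) 2 from ex_per _ _).int_mul k x
  have c1 : ContinuousOn H (Icc 0 1 ×ˢ J) :=
    hg.congr (fun p hp => ex_mem (g := fun y => g y p.2) (h1 _ hp.2) hp.1)
  have c2 : ContinuousOn H (Icc (-1) 0 ×ˢ J) := by
    have : ContinuousOn (fun p : ℝ × ℝ => s * H (-p.1, p.2)) (Icc (-1) 0 ×ˢ J) := by
      refine continuousOn_const.mul (c1.comp (f := fun p : ℝ × ℝ => (-p.1, p.2)) (by fun_prop) ?_)
      intro p hp
      exact ⟨⟨by show 0 ≤ -p.1; linarith [hp.1.2], by show -p.1 ≤ 1; linarith [hp.1.1]⟩, hp.2⟩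
    refine this.congr fun p hp => ?_
    have := ex_neg (g := fun y => g y p.2) hs (h0 _ hp.2) (h1 _ hp.2) (-p.1)
    simp only [neg_neg] at this
    exact this
  have shift : ∀ (k : ℤ) (a b : ℝ), ContinuousOn H (Icc (a + k * 2) (b + k * 2) ×ˢ J) →
      ContinuousOn H (Icc a b ×ˢ J) := by
    intro k a b h
    refine (h.comp (f := fun p : ℝ × ℝ => (p.1 + k * 2, p.2)) (s := Icc a b ×ˢ J) (by fun_prop) ?_).congr ?_
    · intro p hp
      exact ⟨⟨by show _ ≤ p.1 + k * 2; linarith [hp.1.1], by show p.1 + k * 2 ≤ _; linarith [hp.1.2]⟩, hp.2⟩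
    · intro p _; exact (hper k p.1 p.2).symm
  have c3 : ContinuousOn H (Icc (-2) (-1) ×ˢ J) := shift 1 _ _ (by convert c1 using 3 <;> norm_num)
  have cl : ∀ a b : ℝ, IsClosed (Icc a b ×ˢ J) := fun a b => isClosed_Icc.prod hJ
  have c4 : ContinuousOn H (Icc (-2) 1 ×ˢ J) := by
    have h1 := c3.union_of_isClosed c2 (cl _ _) (cl _ _)
    rw [← union_prod, Icc_union_Icc_eq_Icc (by norm_num) (by norm_num)] at h1
    have h2 := h1.union_of_isClosed c1 (cl _ _) (cl _ _)
    rwa [← union_prod, Icc_union_Icc_eq_Icc (by norm_num) (by norm_num)] at h2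
  intro p hp
  have hr := red_mem p.1
  have hx : red p.1 = p.1 + (-round (p.1/2) : ℤ) * 2 := by unfold red; push_cast; ring
  have c5 : ContinuousOn H (Icc (-2 + ((round (p.1/2) : ℤ) : ℝ) * 2) (1 + ((round (p.1/2) : ℤ) : ℝ) * 2) ×ˢ J) :=
    shift (-round (p.1/2)) _ _ (by
      convert c4 using 3 <;> · push_cast; ring)
  have hmem : p ∈ Icc (-2 + (round (p.1/2) : ℝ) * 2) (1 + (round (p.1/2) : ℝ) * 2) ×ˢ J := by
    unfold red at hr
    exact ⟨⟨by linarith [hr.1], by linarith [hr.2]⟩, hp.2⟩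
  refine (c5 p hmem).mono_of_mem_nhdsWithin ?_
  rw [nhdsWithin_prod_eq]
  refine Filter.prod_mem_prod ?_ self_mem_nhdsWithin
  rw [nhdsWithin_univ]
  unfold red at hr
  exact Icc_mem_nhds (by linarith [hr.1]) (by linarith [hr.2])

end

section
open Set

/-- The hypotheses on the exact solution. -/
structure HY (T α : ℝ) (ηs us : ℕ → ℝ → ℝ → ℝ) : Prop where
  hT : 0 < T
  hα : 0 < α
  hη : SmoothChain T 4 1 ηs
  hu : SmoothChain T 4 1 us
  hsol : SW T (ηs 0) (us 0) (ηs 1) (us 1)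
  hlow : ∀ y ∈ Icc (0:ℝ) 1, ∀ t ∈ Icc (0:ℝ) T, α ≤ 1 + ηs 0 y t
  hc10 : derivWithin (fun y => ηs 0 y 0) (Icc (0:ℝ) 1) 0 = 0
  hc11 : derivWithin (fun y => ηs 0 y 0) (Icc (0:ℝ) 1) 1 = 0
  hc20 : iteratedDerivWithin 2 (fun y => us 0 y 0) (Icc (0:ℝ) 1) 0 = 0
  hc21 : iteratedDerivWithin 2 (fun y => us 0 y 0) (Icc (0:ℝ) 1) 1 = 0

def kap (ηs : ℕ → ℝ → ℝ → ℝ) (t x : ℝ) : ℝ := 2 * Real.sqrt (1 + ηs 0 x t)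
def vel (us : ℕ → ℝ → ℝ → ℝ) (t x : ℝ) : ℝ := us 0 x t
def rr (ηs us : ℕ → ℝ → ℝ → ℝ) (x t : ℝ) : ℝ := ex (-1) (vel us t) x + ex 1 (kap ηs t) x
def rrx (ηs us : ℕ → ℝ → ℝ → ℝ) (x t : ℝ) : ℝ :=
  ex 1 (Dk 1 (vel us t)) x + ex (-1) (Dk 1 (kap ηs t)) x

namespace HY
variable {T α : ℝ} {ηs us : ℕ → ℝ → ℝ → ℝ}

theorem uD (h : HY T α ηs us) : UniqueDiffOn ℝ (Icc (0:ℝ) T) := uniqueDiffOn_Icc h.hT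
theorem uI : UniqueDiffOn ℝ II := uniqueDiffOn_Icc (by norm_num)

theorem cu (h : HY T α ηs us) {t : ℝ} (ht : t ∈ Icc 0 T) : ContDiffOn ℝ 4 (vel us t) II := by
  exact h.hu.2.1 0 (by omega) t ht
theorem ce (h : HY T α ηs us) {t : ℝ} (ht : t ∈ Icc 0 T) : ContDiffOn ℝ 4 (fun y => ηs 0 y t) II :=
  h.hη.2.1 0 (by omega) t ht
theorem epos (h : HY T α ηs us) {t y : ℝ} (ht : t ∈ Icc 0 T) (hy : y ∈ II) : 0 < 1 + ηs 0 y t :=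
  h.hα.trans_le (h.hlow y hy t ht)
theorem ck (h : HY T α ηs us) {t : ℝ} (ht : t ∈ Icc 0 T) : ContDiffOn ℝ 4 (kap ηs t) II := by
  unfold kap
  exact contDiffOn_const.mul ((contDiffOn_const.add (h.ce ht)).sqrt (fun y hy => (h.epos ht hy).ne'))
theorem kpos (h : HY T α ηs us) {t y : ℝ} (ht : t ∈ Icc 0 T) (hy : y ∈ II) : 0 < kap ηs t y := by
  unfold kap; have := Real.sqrt_pos.2 (h.epos ht hy); linarith
theorem ke (h : HY T α ηs us) {t y : ℝ} (ht : t ∈ Icc 0 T) (hy : y ∈ II) :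
    ηs 0 y t = (kap ηs t y)^2/4 - 1 := by
  unfold kap; rw [mul_pow, Real.sq_sqrt (h.epos ht hy).le]; ring
theorem u0 (h : HY T α ηs us) {t : ℝ} (ht : t ∈ Icc 0 T) : vel us t 0 = 0 := (h.hsol.2 t ht).1
theorem u1 (h : HY T α ηs us) {t : ℝ} (ht : t ∈ Icc 0 T) : vel us t 1 = 0 := (h.hsol.2 t ht).2

theorem dk (h : HY T α ηs us) {t y : ℝ} (ht : t ∈ Icc 0 T) (hy : y ∈ II) :
    HasDerivWithinAt (kap ηs t) (Dk 1 (kap ηs t) y) II y := by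
  have := Dk_deriv (h.ck ht) (k := 0) (by omega) hy
  rwa [Dk_zero] at this
theorem du (h : HY T α ηs us) {t y : ℝ} (ht : t ∈ Icc 0 T) (hy : y ∈ II) :
    HasDerivWithinAt (vel us t) (Dk 1 (vel us t) y) II y := by
  have := Dk_deriv (h.cu ht) (k := 0) (by omega) hy
  rwa [Dk_zero] at this
theorem de (h : HY T α ηs us) {t y : ℝ} (ht : t ∈ Icc 0 T) (hy : y ∈ II) :
    HasDerivWithinAt (fun y => ηs 0 y t) (kap ηs t y * Dk 1 (kap ηs t) y / 2) II y := by
  have := (((h.dk ht hy).pow 2).div_const 4).sub_const 1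
  refine (this.congr (fun z hz => by simpa using h.ke ht hz) (by simpa using h.ke ht hy)).congr_deriv ?_
  push_cast; ring

theorem e1 (h : HY T α ηs us) {t y : ℝ} (ht : t ∈ Icc 0 T) (hy : y ∈ II) :
    ηs 1 y t = -(kap ηs t y ^ 2 / 4 * Dk 1 (vel us t) y
      + kap ηs t y * Dk 1 (kap ηs t) y / 2 * vel us t y) := by
  have h1 := (h.hsol.1 y hy t ht).1
  have a1 : derivWithin (fun z => us 0 z t) (Icc 0 1) y = _ := (h.du ht hy).derivWithin (uI y hy)
  have a2 := ((h.de ht hy).mul (h.du ht hy)).derivWithin (uI y hy)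
  have a3 := h.ke ht hy
  simp only [vel] at *
  have a4 : derivWithin (fun z => ηs 0 z t * us 0 z t) (Icc 0 1) y = _ := a2
  rw [a1, a4] at h1
  rw [a3] at h1
  linarith
theorem e2 (h : HY T α ηs us) {t y : ℝ} (ht : t ∈ Icc 0 T) (hy : y ∈ II) :
    us 1 y t = -(kap ηs t y * Dk 1 (kap ηs t) y / 2 + vel us t y * Dk 1 (vel us t) y) := by
  have h1 := (h.hsol.1 y hy t ht).2
  have a1 : derivWithin (fun z => us 0 z t) (Icc 0 1) y = _ := (h.du ht hy).derivWithin (uI y hy)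
  have a2 := (h.de ht hy).derivWithin (uI y hy)
  simp only [vel] at *
  rw [a1, a2] at h1
  linarith
theorem dtu (h : HY T α ηs us) {t y : ℝ} (ht : t ∈ Icc 0 T) (hy : y ∈ II) :
    HasDerivWithinAt (fun s => vel us s y)
      (-(kap ηs t y * Dk 1 (kap ηs t) y / 2 + vel us t y * Dk 1 (vel us t) y)) (Icc 0 T) t := by
  rw [← h.e2 ht hy]
  exact h.hu.1 0 (by omega) y hy t ht
theorem dtk (h : HY T α ηs us) {t y : ℝ} (ht : t ∈ Icc 0 T) (hy : y ∈ II) :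
    HasDerivWithinAt (fun s => kap ηs s y)
      (-(kap ηs t y * Dk 1 (vel us t) y / 2 + vel us t y * Dk 1 (kap ηs t) y)) (Icc 0 T) t := by
  have h1 := h.hη.1 0 (by omega) y hy t ht
  have h2 := (((h1.const_add 1).sqrt (h.epos ht hy).ne').const_mul 2)
  refine h2.congr_deriv ?_
  rw [zero_add, h.e1 ht hy]
  have hk := h.kpos ht hy
  have : √(1 + ηs 0 y t) = kap ηs t y / 2 := by unfold kap; ring
  rw [this]
  field_simp
  ring
theorem ends (h : HY T α ηs us) {t y : ℝ} (ht : t ∈ Icc 0 T) (hy : y ∈ II)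
    (hz : ∀ s ∈ Icc 0 T, vel us s y = 0) : Dk 1 (kap ηs t) y = 0 := by
  have h1 := h.dtu ht hy
  have h2 : HasDerivWithinAt (fun s => vel us s y) 0 (Icc 0 T) t :=
    (hasDerivWithinAt_const t _ 0).congr (fun s hs => hz s hs) (hz t ht)
  have := (h.uD t ht).eq_deriv _ h1 h2
  rw [hz t ht] at this
  have hk := h.kpos ht hy
  have h3 : kap ηs t y * Dk 1 (kap ηs t) y = 0 := by linarith
  exact (mul_eq_zero.1 h3).resolve_left hk.ne'
theorem k0 (h : HY T α ηs us) {t : ℝ} (ht : t ∈ Icc 0 T) : Dk 1 (kap ηs t) 0 = 0 :=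
  h.ends ht (by simp) (fun _ hs => h.u0 hs)
theorem k1 (h : HY T α ηs us) {t : ℝ} (ht : t ∈ Icc 0 T) : Dk 1 (kap ηs t) 1 = 0 :=
  h.ends ht (by simp) (fun _ hs => h.u1 hs)

theorem ccu (h : HY T α ηs us) :
    ContinuousOn (fun p : ℝ × ℝ => vel us p.2 p.1) (II ×ˢ Icc 0 T) := h.hu.2.2 0 (by omega)
theorem cck (h : HY T α ηs us) :
    ContinuousOn (fun p : ℝ × ℝ => kap ηs p.2 p.1) (II ×ˢ Icc 0 T) := by
  have := h.hη.2.2 0 (by omega)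
  unfold kap
  exact continuousOn_const.mul ((continuousOn_const.add this).sqrt)

theorem rneg (h : HY T α ηs us) {t : ℝ} (ht : t ∈ Icc 0 T) (x : ℝ) :
    rr ηs us (-x) t = - ex (-1) (vel us t) x + ex 1 (kap ηs t) x := by
  unfold rr
  rw [ex_neg (by norm_num) (by simp [h.u0 ht]) (by simp [h.u1 ht]), ex_neg (by norm_num) (by simp) (by simp)]
  ring

theorem rt (h : HY T α ηs us) : RT T (3/4) (-1/4) (rr ηs us) (rrx ηs us) where
  hc := by
    unfold rr
    exact (ex_cont (g := fun y t => vel us t y) (by norm_num) isClosed_Icc h.ccu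
      (fun t ht => by simp [h.u0 ht]) (fun t ht => by simp [h.u1 ht])).add
      (ex_cont (g := fun y t => kap ηs t y) (by norm_num) isClosed_Icc h.cck
      (fun t ht => by simp) (fun t ht => by simp))
  per x t ht := by unfold rr; rw [ex_per, ex_per]
  dx x t ht := by
    have a := exD_odd (h.cu ht) (k := 0) (by omega) (by rw [Dk_zero]; exact h.u0 ht)
      (by rw [Dk_zero]; exact h.u1 ht) x
    have b := exD_even (h.ck ht) (k := 0) (by omega) (h.k0 ht) (h.k1 ht) x
    rw [Dk_zero] at a b
    exact a.add b
  dt x t ht := by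
    have hr := red_mem x
    rw [h.rneg ht]
    unfold rr rrx ex
    split_ifs with h0
    · have hy : red x ∈ II := ⟨h0, hr.2.le⟩
      exact ((h.dtu ht hy).add (h.dtk ht hy)).congr_deriv (by ring) |>.congr (fun s hs => by simp) (by simp)
    · have hy : - red x ∈ II := ⟨by linarith, by linarith⟩
      exact (((h.dtu ht hy).const_mul (-1)).add (h.dtk ht hy)).congr_deriv (by ring)
        |>.congr (fun s hs => by simp) (by simp)

theorem tdb1 (h : HY T α ηs us) : ∃ M, ∀ t ∈ Icc 0 T, DB 1 (fun x => rr ηs us x t) M :=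
  unif1 h.rt (by norm_num) (by rw [abs_le]; constructor <;> norm_num) (fun t ht => db1 (h.ck ht) (h.cu ht) (h.k0 ht) (h.k1 ht)
    (by rw [Dk_zero]; exact h.u0 ht) (by rw [Dk_zero]; exact h.u1 ht))

theorem tdb0 (h : HY T α ηs us) : ∃ M, ∀ t ∈ Icc 0 T, DB 0 (fun x => rr ηs us x t) M := by
  obtain ⟨M, -, hM⟩ := RS.bdd h.rt
  exact ⟨M, fun t ht => DB.of_bdd (fun x => hM x t ht)⟩

theorem up (h : HY T α ηs us) {n : ℕ} (hn : 2 ≤ n) (hEB : EmoB n) {ts : ℝ} (hts : ts ∈ Icc 0 T)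
    (hlow : ∃ M, ∀ t ∈ Icc 0 T, ∀ k, 1 ≤ k → k < n → DB k (fun x => rr ηs us x t) M)
    (hm : ∃ m, DB n (fun x => rr ηs us x ts) m) :
    ∃ M, ∀ t ∈ Icc 0 T, ∀ k, 1 ≤ k → k < n + 1 → DB k (fun x => rr ηs us x t) M := by
  obtain ⟨M, hM⟩ := hlow
  obtain ⟨m, hm⟩ := hm
  have hM0 : 0 ≤ M := (hM ts hts 1 le_rfl (by omega)).nonneg
  obtain ⟨M', hM'⟩ := unifn hn hEB h.rt (by norm_num) (by rw [abs_le]; constructor <;> norm_num) hM0 hts hM hm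
  refine ⟨max M M', fun t ht k h1 h2 => ?_⟩
  rcases Nat.lt_or_ge k n with h3 | h3
  · exact (hM t ht k h1 h3).mono (le_max_left _ _)
  · have : k = n := by omega
    subst this
    exact (hM' t ht).mono (le_max_right _ _)

theorem tdb3 (h : HY T α ηs us) :
    ∃ M, ∀ t ∈ Icc 0 T, ∀ k, 1 ≤ k → k < 4 → DB k (fun x => rr ηs us x t) M := by
  have ht : (0:ℝ) ∈ Icc 0 T := ⟨le_rfl, h.hT.le⟩
  have z0 : Dk 0 (vel us 0) 0 = 0 := by rw [Dk_zero]; exact h.u0 ht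
  have z1 : Dk 0 (vel us 0) 1 = 0 := by rw [Dk_zero]; exact h.u1 ht
  have h2 := h.up (n := 2) le_rfl emoB2 ht (by
    obtain ⟨M, hM⟩ := h.tdb1
    exact ⟨M, fun t ht k h1 h2 => by have : k = 1 := by omega
                                     subst this; exact hM t ht⟩)
    (db2 (h.ck ht) (h.cu ht) (h.k0 ht) (h.k1 ht) z0 z1)
  exact h.up (n := 3) (by omega) emoB3 ht h2
    (db3 (h.ck ht) (h.cu ht) (h.k0 ht) (h.k1 ht) z0 z1 h.hc20 h.hc21)
end HY

end

section
open Set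

theorem DB.d1 {f : ℝ → ℝ} {M : ℝ} (h : DB 1 f M) (x y : ℝ) : |f y - f x| ≤ M * |y - x| := by
  rcases lt_trichotomy x y with hxy | hxy | hxy
  · have := h.lip hxy
    rw [abs_div, div_le_iff₀ (abs_pos.2 (by linarith))] at this
    exact this
  · subst hxy; simp
  · have := h.lip hxy
    rw [abs_div, div_le_iff₀ (abs_pos.2 (by linarith))] at this
    rw [abs_sub_comm, abs_sub_comm y x]; exact this

theorem DB.d2 {f : ℝ → ℝ} {M : ℝ} (h : DB 2 f M) (c : ℝ) {x : ℝ} (hx : 0 < x) :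
    |f (c + x) - 2 * f c + f (c - x)| ≤ 2 * M * x ^ 2 := by
  have := h (fun i => c + ((i:ℝ) - 1) * x) (fun i _ => by push_cast; nlinarith)
  have e : dd (fun i : ℕ => c + ((i:ℝ) - 1) * x) (fun i : ℕ => f (c + ((i:ℝ) - 1) * x)) 2 0
      = (f (c + x) - 2 * f c + f (c - x)) / (2 * x ^ 2) := by
    simp only [dd]
    norm_num
    rw [show c + -x = c - x by ring]
    field_simp; ring_nf
  rw [e, abs_div, div_le_iff₀ (by positivity), abs_of_pos (show 0 < 2 * x^2 by positivity)] at this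
  linarith

theorem DB.d3 {f : ℝ → ℝ} {M : ℝ} (h : DB 3 f M) (c : ℝ) {x : ℝ} (hx : 0 < x) :
    |f (c + 2 * x) - 3 * f (c + x) + 3 * f c - f (c - x)| ≤ 6 * M * x ^ 3 := by
  have := h (fun i => c + ((i:ℝ) - 1) * x) (fun i _ => by push_cast; nlinarith)
  have e : dd (fun i : ℕ => c + ((i:ℝ) - 1) * x) (fun i : ℕ => f (c + ((i:ℝ) - 1) * x)) 3 0
      = (f (c + 2 * x) - 3 * f (c + x) + 3 * f c - f (c - x)) / (6 * x ^ 3) := by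
    simp only [dd]
    norm_num
    rw [show c + -x = c - x by ring]
    field_simp; ring_nf
  rw [e, abs_div, div_le_iff₀ (by positivity), abs_of_pos (show 0 < 6 * x^3 by positivity)] at this
  linarith

theorem taylor3 {f : ℝ → ℝ} (hf : ContDiffOn ℝ 4 f II) :
    ∃ m, 0 ≤ m ∧ ∀ x ∈ II, |f x - (f 0 + Dk 1 f 0 * x + Dk 2 f 0 / 2 * x^2 + Dk 3 f 0 / 6 * x ^ 3)| ≤ m * x^4 := by
  obtain ⟨M, hM0, hM⟩ := Dk_bdd hf (k := 4) le_rfl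
  refine ⟨M, hM0, fun x hx => ?_⟩
  have := taylor_mean_remainder_bound (n := 3) (f := f) (a := 0) (b := 1) (x := x) zero_le_one (by exact_mod_cast hf) hx hM
  rw [taylor_within_apply] at this
  simp only [Finset.sum_range_succ, Finset.sum_range_zero] at this
  have h0 : iteratedDerivWithin 0 f (Icc 0 1) 0 = f 0 := by simp
  rw [h0, Real.norm_eq_abs] at this
  have hx4 : 0 ≤ M * x^4 := mul_nonneg hM0 (by positivity)
  simp only [Nat.factorial, smul_eq_mul] at this
  push_cast at this
  have e : f x - (f 0 + Dk 1 f 0 * x + Dk 2 f 0 / 2 * x^2 + Dk 3 f 0 / 6 * x ^ 3) = f x -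
          (0 + (1:ℝ)⁻¹ * (x - 0) ^ 0 * f 0 + (1:ℝ)⁻¹ * (x - 0) ^ 1 * iteratedDerivWithin 1 f (Icc 0 1) 0 +
              2⁻¹ * (x - 0) ^ 2 * iteratedDerivWithin 2 f (Icc 0 1) 0 +
            6⁻¹ * (x - 0) ^ 3 * iteratedDerivWithin 3 f (Icc 0 1) 0) := by
    unfold Dk; norm_num; ring
  rw [e]
  refine this.trans ?_
  rw [div_le_iff₀ (by norm_num)]
  norm_num
  linarith

theorem Dk_refl {f : ℝ → ℝ} (hf : ContDiffOn ℝ 4 f II) :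
    ContDiffOn ℝ 4 (fun x => f (1 - x)) II ∧ ∀ k ≤ 4, ∀ y ∈ II, Dk k (fun x => f (1-x)) y = (-1)^k * Dk k f (1 - y) := by
  have hm : MapsTo (fun x : ℝ => 1 - x) II II := fun x hx => ⟨by linarith [hx.2], by linarith [hx.1]⟩
  have hg : ContDiffOn ℝ 4 (fun x => f (1 - x)) II := hf.comp (by fun_prop) hm
  refine ⟨hg, fun k => ?_⟩
  induction k with
  | zero => intro _ y hy; simp [Dk_zero]
  | succ k ih =>
    intro hk y hy
    have h1 := Dk_deriv hg (k := k) (by omega) hy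
    have h2 := Dk_deriv hf (k := k) (by omega) (hm hy)
    have h3 : HasDerivWithinAt (fun x : ℝ => 1 - x) (-1) II y := by
      simpa using (hasDerivWithinAt_id y II).const_sub 1
    have h4 := (h2.comp y h3 hm).const_mul ((-1)^k)
    have h5 := h4.congr (fun z hz => ih (by omega) z hz) (ih (by omega) y hy)
    rw [(uniqueDiffOn_Icc (by norm_num : (0:ℝ) < 1) y hy).eq_deriv _ h1 h5]
    ring

open MeasureTheory Filter in
theorem compat_ae {T C K : ℝ} (hT : 0 < T) {u q qx : ℝ → ℝ → ℝ} {l : ℝ → ℝ}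
    (hq : ∀ x, ∀ t ∈ Icc 0 T, HasDerivAt (fun y => q y t) (qx x t) x)
    (hqc : ∀ x, ContinuousOn (q x) (Icc 0 T)) (hqxc : ∀ x, ContinuousOn (qx x) (Icc 0 T))
    (hK : ∀ x, ∀ t ∈ Icc 0 T, |qx x t| ≤ K)
    (hu : ∀ x, ∀ t ∈ Icc 0 T, HasDerivWithinAt (u x) (-qx x t) (Icc 0 T) t)
    (hu0 : ∀ t ∈ Icc 0 T, u 0 t = 0)
    (hC : ∀ x, 0 < x → x ≤ 1 → ∀ t ∈ Icc 0 T, |u (2 * x) t - 2 * u x t| ≤ C * x^3)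
    (hD : ∀ x, 0 < x → x ≤ 1 → ∀ t ∈ Icc 0 T, |q (2 * x) t - 4 * q x t + 3 * q 0 t| ≤ C * x^3)
    (hl : ∀ t ∈ Icc 0 T, ∃ m, ∀ x, 0 < x → x ≤ 1 / 2 → |q (2 * x) t - 4 * q x t + 3 * q 0 t - l t * x^3| ≤ m * x^4) :
    ∀ᵐ t, t ∈ Ioo 0 T → l t = 0 := by
  have hC0 : 0 ≤ C := by have := (abs_nonneg _).trans (hC 1 (by norm_num) le_rfl 0 ⟨le_rfl, hT.le⟩); linarith
  set F : ℕ → ℝ → ℝ := fun n t => (q (2 * (1/((n:ℝ)+2))) t - 4 * q (1/((n:ℝ)+2)) t + 3 * q 0 t) / (1/((n:ℝ)+2))^3 with hF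
  have hn0 : ∀ n : ℕ, 0 < 1/((n:ℝ)+2) := fun n => by positivity
  have hn1 : ∀ n : ℕ, 1/((n:ℝ)+2) ≤ 1/2 := fun n => by
    apply one_div_le_one_div_of_le (by norm_num); have : (0:ℝ) ≤ n := by positivity
    linarith
  have hlim0 : Tendsto (fun n : ℕ => 1/((n:ℝ)+2)) atTop (nhds 0) := by
    have := tendsto_one_div_atTop_nhds_zero_nat (𝕜 := ℝ)
    have := this.comp (tendsto_add_atTop_nat 2)
    refine this.congr (fun n => by simp)
  have hFl : ∀ t ∈ Icc 0 T, Tendsto (fun n => F n t) atTop (nhds (l t)) := by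
    intro t ht
    obtain ⟨m, hm⟩ := hl t ht
    rw [tendsto_iff_norm_sub_tendsto_zero]
    have h2 : Tendsto (fun n : ℕ => m * (1/((n:ℝ)+2))) atTop (nhds 0) := by simpa using hlim0.const_mul m
    refine squeeze_zero (fun n => norm_nonneg _) (fun n => ?_) h2
    have hx := hn0 n
    have := hm _ hx (hn1 n)
    simp only [hF]
    generalize 1/((n:ℝ)+2) = x at *
    rw [Real.norm_eq_abs, div_sub' (by positivity), abs_div, abs_of_pos (show 0 < x^3 by positivity), div_le_iff₀ (by positivity)]
    calc _ ≤ m * x^4 := by rw [mul_comm (x^3)]; exact this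
      _ = _ := by ring
  have hFb : ∀ n, ∀ t ∈ Icc 0 T, ‖F n t‖ ≤ C := by
    intro n t ht
    have hx := hn0 n
    have := hD _ hx ((hn1 n).trans (by norm_num)) t ht
    simp only [hF]
    generalize 1/((n:ℝ)+2) = x at *
    rw [Real.norm_eq_abs, abs_div, abs_of_pos (show 0 < x^3 by positivity), div_le_iff₀ (by positivity)]
    exact this
  have hFc : ∀ n, ContinuousOn (F n) (Icc 0 T) := by
    intro n
    exact (((hqc _).sub (continuousOn_const.mul (hqc _))).add (continuousOn_const.mul (hqc _))).div_const _
  have sub : ∀ t ∈ Icc 0 T, uIcc 0 t ⊆ Icc 0 T := fun t ht => by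
    rw [uIcc_of_le ht.1]; exact Icc_subset_Icc_right ht.2
  have sub' : ∀ t ∈ Icc 0 T, uIoc 0 t ⊆ Icc 0 T := fun t ht => uIoc_subset_uIcc.trans (sub t ht)
  -- the integrals
  have hitg : ∀ t ∈ Icc 0 T, ∀ x, 0 < x → x ≤ 1 →
      |∫ s in (0:ℝ)..t, (q (2 * x) s - 4 * q x s + 3 * q 0 s)| ≤ 4 * C * x^4 := by
    intro t ht
    set Q : ℝ → ℝ := fun x => ∫ s in (0:ℝ)..t, q x s with hQ
    have ii : ∀ x, IntervalIntegrable (q x) volume 0 t := fun x => ((hqc x).mono (sub t ht)).intervalIntegrable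
    have iix : ∀ x, IntervalIntegrable (qx x) volume 0 t := fun x => ((hqxc x).mono (sub t ht)).intervalIntegrable
    have hQd : ∀ x, HasDerivAt Q (u x 0 - u x t) x := by
      intro x
      have h1 := (intervalIntegral.hasDerivAt_integral_of_dominated_loc_of_deriv_le (μ := volume)
        (F := q) (F' := qx) (x₀ := x) (s := univ) (a := 0) (b := t) (bound := fun _ => K) univ_mem
        (Eventually.of_forall fun y => (ii y).def'.aestronglyMeasurable) (ii x)
        (iix x).def'.aestronglyMeasurable
        (Eventually.of_forall fun s hs y _ => hK y s (sub' t ht hs)) (by simp)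
        (Eventually.of_forall fun s hs y _ => hq y s (sub' t ht hs))).2
      have h2 := intervalIntegral.integral_eq_sub_of_hasDeriv_right_of_le (f := u x) (f' := fun s => - qx x s) ht.1
        (fun s hs => ((hu x s ⟨hs.1, hs.2.trans ht.2⟩).continuousWithinAt).mono (Icc_subset_Icc_right ht.2))
        (fun s hs => by
          have hs' : s ∈ Icc 0 T := ⟨hs.1.le, hs.2.le.trans ht.2⟩
          exact ((hu x s hs').hasDerivAt (Icc_mem_nhds hs.1 (hs.2.trans_le ht.2))).hasDerivWithinAt)
        (iix x).neg
      rw [intervalIntegral.integral_neg] at h2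
      have h3 : ∫ s in (0:ℝ)..t, qx x s = u x 0 - u x t := by linarith
      rw [← h3]; exact h1
    intro x hx hx1
    have e : ∫ s in (0:ℝ)..t, (q (2 * x) s - 4 * q x s + 3 * q 0 s) = Q (2 * x) - 4 * Q x + 3 * Q 0 := by
      rw [intervalIntegral.integral_add, intervalIntegral.integral_sub, intervalIntegral.integral_const_mul,
        intervalIntegral.integral_const_mul]
      · exact ii _
      · exact (ii _).const_mul _
      · exact (ii _).sub ((ii _).const_mul _)
      · exact (ii _).const_mul _
    rw [e]
    set W : ℝ → ℝ := fun x => Q (2 * x) - 4 * Q x + 3 * Q 0 with hW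
    have hWd : ∀ y, HasDerivAt W (2 * (u (2*y) 0 - u (2*y) t) - 4 * (u y 0 - u y t)) y := by
      intro y
      have h1 : HasDerivAt (fun y => Q (2*y)) (2 * (u (2*y) 0 - u (2*y) t)) y := by
        have := (hQd (2*y)).comp y ((hasDerivAt_id y).const_mul 2)
        simp only [mul_one] at this
        rw [mul_comm]; exact this
      exact (h1.sub ((hQd y).const_mul 4)).add_const _
    have := (convex_Icc (0:ℝ) x).norm_image_sub_le_of_norm_hasDerivWithin_le (f := W) (C := 4 * C * x^3) (x := 0) (y := x)
      (fun y _ => (hWd y).hasDerivWithinAt) (fun y hy => by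
        rcases hy.1.eq_or_lt with h0 | h0
        · rw [← h0]; simp only [mul_zero, Real.norm_eq_abs]
          rw [hu0 0 ⟨le_rfl, hT.le⟩, hu0 t ht]; simp; positivity
        · have a := hC y h0 (hy.2.trans hx1) 0 ⟨le_rfl, hT.le⟩
          have b := hC y h0 (hy.2.trans hx1) t ht
          have c : C * y^3 ≤ C * x^3 := by
            have := hy.2
            gcongr
          rw [Real.norm_eq_abs]
          rw [abs_le] at *
          constructor <;> linarith) ⟨le_rfl, hx.le⟩ ⟨hx.le, le_rfl⟩
    have w0 : W 0 = 0 := by simp only [hW, mul_zero]; ring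
    rw [w0, sub_zero, sub_zero, Real.norm_eq_abs, Real.norm_eq_abs, abs_of_pos hx] at this
    calc _ ≤ _ := this
      _ = _ := by ring
  have lint : ∀ t ∈ Icc 0 T, IntervalIntegrable l volume 0 t := by
    intro t ht
    have hmeas : AEStronglyMeasurable l (volume.restrict (uIoc 0 t)) :=
      aestronglyMeasurable_of_tendsto_ae (atTop : Filter ℕ) (f := F)
        (fun n => (((hFc n).mono (sub t ht)).intervalIntegrable).def'.aestronglyMeasurable)
        ((ae_restrict_iff' measurableSet_uIoc).2 (Eventually.of_forall fun s hs => hFl s (sub' t ht hs)))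
    rw [intervalIntegrable_iff]
    refine IntegrableOn.of_bound (C := C) (by simp) hmeas ?_
    refine (ae_restrict_iff' measurableSet_uIoc).2 (Eventually.of_forall fun s hs => ?_)
    exact le_of_tendsto (hFl s (sub' t ht hs)).norm (Eventually.of_forall fun n => hFb n s (sub' t ht hs))
  have l0 : ∀ t ∈ Icc 0 T, ∫ s in (0:ℝ)..t, l s = 0 := by
    intro t ht
    have h1 := intervalIntegral.tendsto_integral_filter_of_dominated_convergence (μ := volume) (a := 0) (b := t)
      (l := (atTop : Filter ℕ)) (F := F) (f := l) (fun _ => C)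
      (Eventually.of_forall fun n => (((hFc n).mono (sub t ht)).intervalIntegrable).def'.aestronglyMeasurable)
      (Eventually.of_forall fun n => Eventually.of_forall fun s hs => hFb n s (sub' t ht hs)) (by simp)
      (Eventually.of_forall fun s hs => hFl s (sub' t ht hs))
    have h2 : Tendsto (fun n : ℕ => ∫ s in (0:ℝ)..t, F n s) atTop (nhds 0) := by
      have h3 : Tendsto (fun n : ℕ => 4 * C * (1/((n:ℝ)+2))) atTop (nhds 0) := by simpa using hlim0.const_mul (4*C)
      refine squeeze_zero_norm (fun n => ?_) h3
      have hx := hn0 n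
      have := hitg t ht _ hx ((hn1 n).trans (by norm_num))
      simp only [hF]
      generalize 1/((n:ℝ)+2) = x at *
      rw [intervalIntegral.integral_div, Real.norm_eq_abs, abs_div, abs_of_pos (show 0 < x^3 by positivity), div_le_iff₀ (by positivity)]
      calc _ ≤ _ := this
        _ = _ := by ring
    exact tendsto_nhds_unique h1 h2
  have := (lint T ⟨hT.le, le_rfl⟩).ae_hasDerivAt_integral
  filter_upwards [this] with t h ht
  rw [uIcc_of_le hT.le] at h
  have h1 := h ⟨ht.1.le, ht.2.le⟩ 0 ⟨le_rfl, hT.le⟩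
  have h2 : HasDerivAt (fun y => ∫ s in (0:ℝ)..y, l s) 0 t := by
    refine (hasDerivAt_const t 0).congr_of_eventuallyEq ?_
    filter_upwards [Ioo_mem_nhds ht.1 ht.2] with s hs
    exact l0 s ⟨hs.1.le, hs.2.le⟩
  exact h1.unique h2

end

section
open Set

def uu (us : ℕ → ℝ → ℝ → ℝ) (x t : ℝ) : ℝ := ex (-1) (vel us t) x
def kk (ηs : ℕ → ℝ → ℝ → ℝ) (x t : ℝ) : ℝ := ex 1 (kap ηs t) x

theorem abs_mul_le' {a b A B : ℝ} (ha : |a| ≤ A) (hb : |b| ≤ B) : |a * b| ≤ A * B := by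
  rw [abs_mul]; exact mul_le_mul ha hb (abs_nonneg _) ((abs_nonneg _).trans ha)

theorem cmp_d {M x K0 K1 K2 V1 V2 : ℝ} (hx : 0 < x) (hx1 : x ≤ 1) (hK0 : |K0| ≤ M) (h3 : |(K2 - K0) - 4 * (K1 - K0)| ≤ 6 * M * x^3)
    (hA : |K2 - K0| ≤ 4 * M * x^2) (hB : |K1 - K0| ≤ M * x^2) (hV : |V2 - 2 * V1| ≤ 6 * M * x^3) (hV1 : |V1| ≤ M)
    (hV2 : |V2| ≤ M) : |(K2^2/4-1+V2^2/2) - 4 * (K1^2/4-1+V1^2/2) + 3 * (K0^2/4-1)| ≤ (17 * M^2 + 6 * M) * x^3 := by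
  have hM : 0 ≤ M := (abs_nonneg _).trans hK0
  have p1 := abs_mul_le' hK0 h3
  have p2 := abs_mul_le' hA hA
  have p3 := abs_mul_le' hB hB
  have p4 : |(V2 - 2 * V1) * (V2 + 2 * V1)| ≤ 6 * M * x^3 * (3 * M) := by
    refine abs_mul_le' hV ?_
    rw [abs_le] at *; constructor <;> linarith
  have hx4 : M^2 * x^4 ≤ M^2 * x^3 := by
    have : x^4 ≤ x^3 := pow_le_pow_of_le_one hx.le hx1 (by norm_num)
    gcongr
  have : 0 ≤ M * x^3 := by positivity
  rw [abs_le] at *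
  constructor <;> nlinarith

theorem cmp_e {M m x k2 k3 K0 K1 K2 V1 V2 : ℝ} (hx : 0 < x) (hK0 : |K0| ≤ M)
    (t1 : |K1 - (K0 + k2 / 2 * x^2 + k3 / 6 * x^3)| ≤ m * x^4)
    (t2 : |K2 - (K0 + k2 / 2 * (2*x)^2 + k3 / 6 * (2*x)^3)| ≤ m * (2*x)^4)
    (hA : |K2 - K0| ≤ 4 * M * x^2) (hB : |K1 - K0| ≤ M * x^2) (hV : |V2 - 2 * V1| ≤ 6 * M * x^3) (hV1 : |V1| ≤ M * x)
    (hV2 : |V2| ≤ M * (2 * x)) (hx1 : x ≤ 1) :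
    |(K2^2/4-1+V2^2/2) - 4 * (K1^2/4-1+V1^2/2) + 3 * (K0^2/4-1) - (K0 * k3 / 3) * x^3| ≤ (10 * M * m + 17 * M^2) * x^4 := by
  have hM : 0 ≤ M := (abs_nonneg _).trans hK0
  have h3 : |(K2 - K0) - 4 * (K1 - K0) - 2/3 * k3 * x^3| ≤ 20 * m * x^4 := by
    rw [abs_le] at *; constructor <;> nlinarith
  have p1 := abs_mul_le' hK0 h3
  have p2 := abs_mul_le' hA hA
  have p3 := abs_mul_le' hB hB
  have p4 : |(V2 - 2 * V1) * (V2 + 2 * V1)| ≤ 6 * M * x^3 * (4 * M * x) := by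
    refine abs_mul_le' hV ?_
    rw [abs_le] at *; constructor <;> linarith
  rw [abs_le] at *
  constructor <;> nlinarith

theorem v2_zero {M m v1 v2 v3 : ℝ} {V : ℝ → ℝ} (hV : ∀ x, 0 < x → |V (2 * x) - 2 * V x| ≤ 6 * M * x^3)
    (ht : ∀ x ∈ II, |V x - (v1 * x + v2 / 2 * x^2 + v3 / 6 * x^3)| ≤ m * x^4) (hm : 0 ≤ m) : v2 = 0 := by
  by_contra hne
  have hM : 0 ≤ M := by have := (abs_nonneg _).trans (hV 1 (by norm_num)); linarith
  set D := 6 * M + 18 * m + |v3| + 1 with hD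
  have hD0 : 1 ≤ D := by have := abs_nonneg v3; linarith
  have key : ∀ x, 0 < x → x ≤ 1/2 → |v2| ≤ D * x := by
    intro x hx hx2
    have a := hV x hx
    have b := ht x ⟨hx.le, by linarith⟩
    have c := ht (2*x) ⟨by linarith, by linarith⟩
    have x4 : m * x^4 ≤ m * x^3 := by
      have : x^4 ≤ x^3 := pow_le_pow_of_le_one hx.le (by linarith) (by norm_num)
      gcongr
    have d : |v3 * x^3| ≤ |v3| * x^3 := by rw [abs_mul, abs_of_pos (show 0 < x^3 by positivity)]
    have hx3 : 0 < x^3 := by positivity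
    have : |v2 * x^2| ≤ D * x^3 := by
      rw [hD]
      rw [abs_le] at a b c d ⊢
      constructor <;> nlinarith
    rw [abs_mul, abs_of_pos (show 0 < x^2 by positivity)] at this
    have e : |v2| * x^2 ≤ (D * x) * x^2 := by nlinarith
    exact le_of_mul_le_mul_right e (by positivity)
  have hv := abs_pos.2 hne
  have h1 := key (min (1/2) (|v2| / (2 * D))) (lt_min (by norm_num) (by positivity)) (min_le_left _ _)
  have h2 : D * min (1/2) (|v2| / (2 * D)) ≤ D * (|v2| / (2 * D)) := by gcongr; exact min_le_right _ _
  have h3 : D * (|v2| / (2 * D)) = |v2| / 2 := by field_simp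
  linarith

namespace HY
variable {T α : ℝ} {ηs us : ℕ → ℝ → ℝ → ℝ}

theorem uu_neg (h : HY T α ηs us) {t : ℝ} (ht : t ∈ Icc 0 T) (x : ℝ) : uu us (-x) t = - uu us x t := by
  unfold uu; rw [ex_neg (by norm_num) (by simp [h.u0 ht]) (by simp [h.u1 ht])]; ring
theorem kk_neg (_ : HY T α ηs us) {t : ℝ} (_ : t ∈ Icc 0 T) (x : ℝ) : kk ηs (-x) t = kk ηs x t := by
  unfold kk; rw [ex_neg (by norm_num) (by simp) (by simp)]; ring
theorem uu_eq (h : HY T α ηs us) {t : ℝ} (ht : t ∈ Icc 0 T) :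
    (fun x => uu us x t) = fun x => (1/2) * rr ηs us x t + (-1/2) * rr ηs us (-x) t := by
  funext x; rw [h.rneg ht]; unfold uu rr; ring
theorem kk_eq (h : HY T α ηs us) {t : ℝ} (ht : t ∈ Icc 0 T) :
    (fun x => kk ηs x t) = fun x => (1/2) * rr ηs us x t + (1/2) * rr ηs us (-x) t := by
  funext x; rw [h.rneg ht]; unfold kk rr; ring
theorem duu (h : HY T α ηs us) {t n M} (ht : t ∈ Icc 0 T) (hr : DB n (fun x => rr ηs us x t) M) :
    DB n (fun x => uu us x t) M := by
  rw [h.uu_eq ht]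
  exact (hr.lin hr.refl (1/2) (-1/2)).mono (by rw [abs_of_pos, abs_of_neg] <;> norm_num; linarith)
theorem dkk (h : HY T α ηs us) {t n M} (ht : t ∈ Icc 0 T) (hr : DB n (fun x => rr ηs us x t) M) :
    DB n (fun x => kk ηs x t) M := by
  rw [h.kk_eq ht]
  exact (hr.lin hr.refl (1/2) (1/2)).mono (by rw [abs_of_pos] <;> norm_num; linarith)

theorem uu_per (x t : ℝ) : uu us (x + 2) t = uu us x t := ex_per _ _ _
theorem kk_per (x t : ℝ) : kk ηs (x + 2) t = kk ηs x t := ex_per _ _ _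

theorem tdb3' (h : HY T α ηs us) :
    ∃ M, ∀ t ∈ Icc 0 T, ∀ k, k < 4 → DB k (fun x => rr ηs us x t) M := by
  obtain ⟨M, hM⟩ := h.tdb3
  obtain ⟨K, hK⟩ := h.tdb0
  refine ⟨max M K, fun t ht k hk => ?_⟩
  rcases Nat.eq_zero_or_pos k with h0 | h0
  · subst h0; exact (hK t ht).mono (le_max_right _ _)
  · exact (hM t ht k h0 hk).mono (le_max_left _ _)

theorem us1z (h : HY T α ηs us) {t y : ℝ} (ht : t ∈ Icc 0 T) (hy : y ∈ II) (hz : vel us t y = 0) (hk : Dk 1 (kap ηs t) y = 0) : us 1 y t = 0 := by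
  rw [h.e2 ht hy, hz, hk]; ring

def qq (ηs us : ℕ → ℝ → ℝ → ℝ) (x t : ℝ) : ℝ := (kk ηs x t)^2/4 - 1 + (uu us x t)^2/2
def qqx (us : ℕ → ℝ → ℝ → ℝ) (x t : ℝ) : ℝ := - ex (-1) (fun y => us 1 y t) x

theorem kkd (h : HY T α ηs us) {t : ℝ} (ht : t ∈ Icc 0 T) (x : ℝ) :
    HasDerivAt (fun y => kk ηs y t) (ex (-1) (Dk 1 (kap ηs t)) x) x := by
  have b := exD_even (h.ck ht) (k := 0) (by omega) (h.k0 ht) (h.k1 ht) x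
  rw [Dk_zero] at b; exact b
theorem uud (h : HY T α ηs us) {t : ℝ} (ht : t ∈ Icc 0 T) (x : ℝ) :
    HasDerivAt (fun y => uu us y t) (ex 1 (Dk 1 (vel us t)) x) x := by
  have a := exD_odd (h.cu ht) (k := 0) (by omega) (by rw [Dk_zero]; exact h.u0 ht)
      (by rw [Dk_zero]; exact h.u1 ht) x
  rw [Dk_zero] at a; exact a

theorem qqd (h : HY T α ηs us) {t : ℝ} (ht : t ∈ Icc 0 T) (x : ℝ) :
    HasDerivAt (fun y => qq ηs us y t) (qqx us x t) x := by
  have := ((((h.kkd ht x).pow 2).div_const 4).sub_const 1).add (((h.uud ht x).pow 2).div_const 2)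
  refine this.congr_deriv ?_
  have hr := red_mem x
  unfold qqx kk uu ex
  split_ifs with h0
  · have e := h.e2 ht (y := red x) ⟨h0, hr.2.le⟩
    beta_reduce; rw [e]; push_cast; ring
  · have e := h.e2 ht (y := - red x) ⟨by linarith, by linarith⟩
    beta_reduce; rw [e]; push_cast; ring

theorem uut (h : HY T α ηs us) {t : ℝ} (ht : t ∈ Icc 0 T) (x : ℝ) :
    HasDerivWithinAt (fun s => uu us x s) (- qqx us x t) (Icc 0 T) t := by
  have hr := red_mem x
  unfold qqx uu ex
  split_ifs with h0
  · exact (h.hu.1 0 (by omega) _ ⟨h0, hr.2.le⟩ t ht).congr_deriv (by simp)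
  · exact ((h.hu.1 0 (by omega) (-red x) ⟨by linarith, by linarith⟩ t ht).const_mul (-1)).congr_deriv (by simp)

theorem qqxc (h : HY T α ηs us) (x : ℝ) : ContinuousOn (qqx us x) (Icc 0 T) := by
  have hr := red_mem x
  have c : ∀ y ∈ II, ContinuousOn (fun t => us 1 y t) (Icc 0 T) := fun y hy =>
    (h.hu.2.2 1 le_rfl).comp (f := fun t : ℝ => (y, t)) (by fun_prop) (fun t ht => ⟨hy, ht⟩)
  unfold qqx ex
  split_ifs with h0
  · exact (c _ ⟨h0, hr.2.le⟩).neg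
  · exact (continuousOn_const.mul (c (-red x) ⟨by linarith, by linarith⟩)).neg

theorem uuc (h : HY T α ηs us) (x : ℝ) : ContinuousOn (uu us x) (Icc 0 T) :=
  fun _ ht => (h.uut ht x).continuousWithinAt

theorem kkc (h : HY T α ηs us) (x : ℝ) : ContinuousOn (kk ηs x) (Icc 0 T) := by
  have hr := red_mem x
  have c : ∀ y ∈ II, ContinuousOn (fun t => kap ηs t y) (Icc 0 T) := fun y hy =>
    h.cck.comp (f := fun t : ℝ => (y, t)) (by fun_prop) (fun t ht => ⟨hy, ht⟩)
  unfold kk ex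
  split_ifs with h0
  · exact (c _ ⟨h0, hr.2.le⟩)
  · exact (continuousOn_const.mul (c (-red x) ⟨by linarith, by linarith⟩))

theorem qqb (h : HY T α ηs us) : ∃ K, ∀ x, ∀ t ∈ Icc 0 T, |qqx us x t| ≤ K := by
  obtain ⟨C, hC⟩ := ((isCompact_Icc (a := (0:ℝ)) (b := 1)).prod
    (isCompact_Icc (a := (0:ℝ)) (b := T))).exists_bound_of_continuousOn (h.hu.2.2 1 le_rfl)
  refine ⟨C, fun x t ht => ?_⟩
  unfold qqx
  rw [abs_neg]
  exact ex_bdd (by norm_num) (fun y hy => hC (y, t) ⟨hy, ht⟩) x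

theorem uodd (_ : HY T α ηs us) {c t M : ℝ} (huo : ∀ x, uu us (c - x) t = - uu us (c + x) t)
    (h3 : DB 3 (fun x => uu us x t) M) {x : ℝ} (hx : 0 < x) :
    |uu us (c + 2 * x) t - 2 * uu us (c + x) t| ≤ 6 * M * x^3 := by
  have := h3.d3 c hx
  beta_reduce at this
  have e : uu us c t = 0 := by have := huo 0; simp only [sub_zero, add_zero] at this; linarith
  rw [huo, e] at this
  refine le_trans (le_of_eq ?_) this
  congr 1; ring

theorem cm (h : HY T α ηs us) (c : ℝ) (hke : ∀ x, ∀ t ∈ Icc 0 T, kk ηs (c - x) t = kk ηs (c + x) t)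
    (huo : ∀ x, ∀ t ∈ Icc 0 T, uu us (c - x) t = - uu us (c + x) t) (k3 : ℝ → ℝ)
    (hk3 : ∀ t ∈ Icc 0 T, ∃ m k2, ∀ x ∈ II,
      |kk ηs (c + x) t - (kk ηs c t + k2 / 2 * x^2 + k3 t / 6 * x^3)| ≤ m * x^4) (hk0 : ∀ t ∈ Icc 0 T, kk ηs c t ≠ 0) :
    ∀ᵐ t, t ∈ Ioo 0 T → k3 t = 0 := by
  obtain ⟨M, hM⟩ := h.tdb3'
  obtain ⟨K, hK⟩ := h.qqb
  have u0 : ∀ t ∈ Icc 0 T, uu us c t = 0 := fun t ht => by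
    have := huo 0 t ht; simp only [sub_zero, add_zero] at this; linarith
  have b0 : ∀ t ∈ Icc 0 T, ∀ x, |kk ηs x t| ≤ M := fun t ht x => by
    have := h.dkk ht (hM t ht 0 (by omega)) (fun _ => x) (fun i hi => absurd hi (by omega))
    simpa [dd] using this
  have v0 : ∀ t ∈ Icc 0 T, ∀ x, |uu us x t| ≤ M := fun t ht x => by
    have := h.duu ht (hM t ht 0 (by omega)) (fun _ => x) (fun i hi => absurd hi (by omega))
    simpa [dd] using this
  have b2 : ∀ t ∈ Icc 0 T, ∀ x, 0 < x → |kk ηs (c + x) t - kk ηs c t| ≤ M * x^2 := fun t ht x hx => by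
    have := (h.dkk ht (hM t ht 2 (by omega))).d2 c hx
    beta_reduce at this
    rw [hke x t ht] at this
    have e : kk ηs (c + x) t - 2 * kk ηs c t + kk ηs (c + x) t = 2 * (kk ηs (c + x) t - kk ηs c t) := by ring
    rw [e, abs_mul, abs_two] at this
    linarith
  have v3 : ∀ t ∈ Icc 0 T, ∀ x, 0 < x → |uu us (c + 2 * x) t - 2 * uu us (c + x) t| ≤ 6 * M * x^3 := fun t ht x hx =>
    h.uodd (fun x => huo x t ht) (h.duu ht (hM t ht 3 (by omega))) hx
  have v1 : ∀ t ∈ Icc 0 T, ∀ x, 0 < x → |uu us (c + x) t| ≤ M * x := fun t ht x hx => by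
    have := (h.duu ht (hM t ht 1 (by omega))).d1 c (c + x)
    beta_reduce at this
    rw [u0 t ht, sub_zero, add_sub_cancel_left, abs_of_pos hx] at this
    exact this
  have b22 : ∀ t ∈ Icc 0 T, ∀ x, 0 < x → |kk ηs (c + 2 * x) t - kk ηs c t| ≤ 4 * M * x^2 := fun t ht x hx => by
    refine (b2 t ht (2*x) (by linarith)).trans (le_of_eq (by ring))
  have main := compat_ae (C := 17 * M^2 + 6 * M) (K := K) h.hT (u := fun x t => uu us (c + x) t) (q := fun x t => qq ηs us (c + x) t)
    (qx := fun x t => qqx us (c + x) t) (l := fun t => kk ηs c t * k3 t / 3)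
    (fun x t ht => (h.qqd ht (c + x)).comp_const_add c x)
    (fun x => by
      unfold qq
      exact ((((h.kkc (c + x)).pow 2).div_const 4).sub continuousOn_const).add (((h.uuc (c+x)).pow 2).div_const 2))
    (fun x => h.qqxc (c + x)) (fun x t ht => hK _ t ht) (fun x t ht => h.uut ht (c + x))
    (fun t ht => by simpa using u0 t ht)
    (fun x hx hx1 t ht => by
      refine (v3 t ht x hx).trans ?_
      have := sq_nonneg M
      have : 0 < x^3 := by positivity
      nlinarith)
    (fun x hx hx1 t ht => by
      have h3 := (h.dkk ht (hM t ht 3 (by omega))).d3 c hx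
      beta_reduce at h3
      rw [hke x t ht] at h3
      have := cmp_d hx hx1 (b0 t ht c) (K1 := kk ηs (c + x) t) (K2 := kk ηs (c + 2 * x) t) (V1 := uu us (c + x) t)
        (V2 := uu us (c + 2 * x) t) (le_trans (le_of_eq (by congr 1; ring)) h3) (b22 t ht x hx) (b2 t ht x hx) (v3 t ht x hx)
        (v0 t ht _) (v0 t ht _)
      refine le_trans (le_of_eq ?_) this
      congr 1; unfold qq; rw [add_zero, u0 t ht]; ring)
    (fun t ht => by
      obtain ⟨m, k2, hm⟩ := hk3 t ht
      refine ⟨10 * M * m + 17 * M^2, fun x hx hx2 => ?_⟩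
      have := cmp_e hx (b0 t ht c) (hm x ⟨hx.le, by linarith⟩) (hm (2*x) ⟨by linarith, by linarith⟩)
        (V1 := uu us (c + x) t)
        (V2 := uu us (c + 2 * x) t) (b22 t ht x hx) (b2 t ht x hx) (v3 t ht x hx)
        (v1 t ht x hx) (v1 t ht (2*x) (by linarith)) (by linarith)
      refine le_trans (le_of_eq ?_) this
      congr 1; unfold qq; rw [add_zero, u0 t ht]; ring)
  filter_upwards [main] with t h1 ht
  have ht' : t ∈ Icc 0 T := ⟨ht.1.le, ht.2.le⟩
  have := h1 ht
  have h2 : kk ηs c t * k3 t = 0 := by linarith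
  exact (mul_eq_zero.1 h2).resolve_left (hk0 t ht')

open MeasureTheory in
theorem tstar (h : HY T α ηs us) : ∃ t ∈ Icc 0 T, Dk 2 (vel us t) 0 = 0 ∧ Dk 2 (vel us t) 1 = 0 ∧
    Dk 3 (kap ηs t) 0 = 0 ∧ Dk 3 (kap ηs t) 1 = 0 := by
  have i0 : (0:ℝ) ∈ II := by simp
  have i1 : (1:ℝ) ∈ II := by simp
  have hm : MapsTo (fun x : ℝ => 1 - x) II II := fun x hx => ⟨by linarith [hx.2], by linarith [hx.1]⟩
  have ke1 : ∀ x, ∀ t ∈ Icc 0 T, kk ηs (1 - x) t = kk ηs (1 + x) t := fun x t ht => by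
    rw [← h.kk_neg ht, ← kk_per]; congr 1; ring
  have uo1 : ∀ x, ∀ t ∈ Icc 0 T, uu us (1 - x) t = - uu us (1 + x) t := fun x t ht => by
    rw [← neg_neg (uu us (1 - x) t), ← h.uu_neg ht, ← uu_per]; congr 2; ring
  have kI : ∀ t, ∀ x ∈ II, kk ηs x t = kap ηs t x := fun t x hx => ex_mem (by simp) hx
  have uI : ∀ t ∈ Icc 0 T, ∀ x ∈ II, uu us x t = vel us t x := fun t ht x hx => ex_mem (by simp [h.u1 ht]) hx
  have A := h.cm 0 (fun x t ht => by rw [zero_sub, zero_add, h.kk_neg ht])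
    (fun x t ht => by rw [zero_sub, zero_add, h.uu_neg ht]) (fun t => Dk 3 (kap ηs t) 0)
    (fun t ht => by
      obtain ⟨m, -, hm⟩ := taylor3 (h.ck ht)
      refine ⟨m, Dk 2 (kap ηs t) 0, fun x hx => ?_⟩
      have := hm x hx
      rw [h.k0 ht] at this
      rw [zero_add, kI t x hx, kI t 0 i0]
      refine le_trans (le_of_eq ?_) this
      congr 1; ring)
    (fun t ht => by rw [kI t 0 i0]; exact (h.kpos ht i0).ne')
  have B := h.cm 1 ke1 uo1 (fun t => Dk 3 (fun x => kap ηs t (1 - x)) 0)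
    (fun t ht => by
      obtain ⟨hg, hD⟩ := Dk_refl (h.ck ht)
      obtain ⟨m, -, hm'⟩ := taylor3 hg
      refine ⟨m, Dk 2 (fun x => kap ηs t (1 - x)) 0, fun x hx => ?_⟩
      have := hm' x hx
      rw [hD 1 (by omega) 0 i0, sub_zero, h.k1 ht] at this
      rw [← ke1 x t ht, kI t _ (hm hx), kI t 1 i1]
      refine le_trans (le_of_eq ?_) this
      simp only [sub_zero]
      congr 1; ring)
    (fun t ht => by rw [kI t 1 i1]; exact (h.kpos ht i1).ne')
  obtain ⟨t, ht, a, b⟩ : ∃ t ∈ Ioo 0 T, Dk 3 (kap ηs t) 0 = 0 ∧ Dk 3 (fun x => kap ηs t (1 - x)) 0 = 0 := by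
    by_contra hcon
    push Not at hcon
    have : ∀ᵐ t, t ∉ Ioo 0 T := by
      filter_upwards [A, B] with t h1 h2 ht
      exact hcon t ht (h1 ht) (h2 ht)
    have h3 : volume (Ioo 0 T) = 0 := by
      rw [← nonpos_iff_eq_zero]
      have := measure_eq_zero_iff_ae_notMem.2 this
      exact this.le
    rw [Real.volume_Ioo] at h3
    simp at h3
    linarith [h.hT]
  have ht' : t ∈ Icc 0 T := ⟨ht.1.le, ht.2.le⟩
  obtain ⟨M, hM⟩ := h.tdb3'
  have h3 := h.duu ht' (hM t ht' 3 (by omega))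
  refine ⟨t, ht', ?_, ?_, a, ?_⟩
  · obtain ⟨m, hm0, hm⟩ := taylor3 (h.cu ht')
    refine v2_zero (V := fun x => uu us x t) (M := M) (v1 := Dk 1 (vel us t) 0) (v3 := Dk 3 (vel us t) 0) (fun x hx => ?_) (fun x hx => ?_) hm0
    · have := h.uodd (c := 0) (fun x => by rw [zero_sub, zero_add, h.uu_neg ht']) h3 hx
      simpa using this
    · have := hm x hx
      rw [h.u0 ht', zero_add] at this
      rw [uI t ht' x hx]; exact this
  · obtain ⟨hg, hD⟩ := Dk_refl (h.cu ht')
    obtain ⟨m, hm0, hm'⟩ := taylor3 hg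
    have := hD 2 (by omega) 0 i0
    rw [sub_zero] at this
    have e : Dk 2 (vel us t) 1 = Dk 2 (fun x => vel us t (1 - x)) 0 := by rw [this]; ring
    rw [e]
    refine v2_zero (V := fun x => uu us (1 - x) t) (M := M) (v1 := Dk 1 (fun x => vel us t (1 - x)) 0) (v3 := Dk 3 (fun x => vel us t (1 - x)) 0) (fun x hx => ?_) (fun x hx => ?_) hm0
    · have := h.uodd (c := 1) (fun x => uo1 x t ht') h3 hx
      rw [uo1 _ t ht', uo1 _ t ht']
      rw [show - uu us (1 + 2 * x) t - 2 * -uu us (1 + x) t = -(uu us (1 + 2 * x) t - 2 * uu us (1 + x) t) by ring, abs_neg]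
      exact this
    · have := hm' x hx
      simp only [sub_zero] at this
      rw [h.u1 ht', zero_add] at this
      rw [uI t ht' _ (hm hx)]; exact this
  · obtain ⟨hg, hD⟩ := Dk_refl (h.ck ht')
    have := hD 3 (by omega) 0 i0
    rw [b, sub_zero] at this
    linarith

theorem tdb4 (h : HY T α ηs us) :
    ∃ M, ∀ t ∈ Icc 0 T, ∀ k, k ≤ 4 → DB k (fun x => rr ηs us x t) M := by
  obtain ⟨t, ht, a, b, c, d⟩ := h.tstar
  obtain ⟨M, hM⟩ := h.up (n := 4) (by omega) emoB4 ht h.tdb3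
    (db4 (h.ck ht) (h.cu ht) (h.k0 ht) (h.k1 ht) (by rw [Dk_zero]; exact h.u0 ht) (by rw [Dk_zero]; exact h.u1 ht) a b c d)
  obtain ⟨K, hK⟩ := h.tdb0
  refine ⟨max M K, fun t ht k hk => ?_⟩
  rcases Nat.eq_zero_or_pos k with h0 | h0
  · subst h0; exact (hK t ht).mono (le_max_right _ _)
  · exact (hM t ht k h0 (by omega)).mono (le_max_left _ _)
end HY

end

section
open Set

theorem deriv_bd_right {g : ℝ → ℝ} {g' C δ : ℝ} (hg : HasDerivAt g g' 0) (h0 : g 0 = 0) (hδ : 0 < δ)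
    (hb : ∀ e, 0 < e → e < δ → |g e| ≤ C * e) : |g'| ≤ C := by
  have h1 := (hg.hasDerivWithinAt (s := Ioi 0))
  rw [hasDerivWithinAt_iff_tendsto_slope' (by simp)] at h1
  refine le_of_tendsto h1.norm ?_
  filter_upwards [Ioo_mem_nhdsGT hδ] with e he
  rw [slope_def_field, h0, sub_zero, sub_zero, Real.norm_eq_abs, abs_div, abs_of_pos he.1, div_le_iff₀ he.1]
  exact hb e he.1 he.2

def pnod (x h e : ℝ) : ℕ → ℝ
  | 0 => x - h
  | 1 => x
  | 2 => x + e
  | 3 => x + h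
  | _ => x + 2 * h

theorem dlem {f f1 : ℝ → ℝ} {M : ℝ} (h4 : DB 4 f M) {x h : ℝ} (hh : 0 < h) (hd : HasDerivAt f (f1 x) x) :
    |f1 x - (-2 * f (x - h) - 3 * f x + 6 * f (x + h) - f (x + 2 * h)) / (6 * h)| ≤ 4 * M * h^3 := by
  set c1 := (-2 * f (x - h) - 3 * f x + 6 * f (x + h) - f (x + 2 * h)) / (6 * h) with hc1
  set c2 := (f (x - h) - 2 * f x + f (x + h)) / (2 * h^2) with hc2
  set c3 := (- f (x - h) + 3 * f x - 3 * f (x + h) + f (x + 2 * h)) / (6 * h^3) with hc3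
  have hM := h4.nonneg
  set g : ℝ → ℝ := fun e => f (x + e) - (f x + c1 * e + c2 * e^2 + c3 * e^3) with hg
  have hgd : HasDerivAt g (f1 x - c1) 0 := by
    have a : HasDerivAt (fun e => f (x + e)) (f1 x) 0 := by
      have : HasDerivAt f (f1 x) (x + 0) := by simpa using hd
      exact this.comp_const_add x 0
    have b : HasDerivAt (fun e : ℝ => f x + c1 * e + c2 * e^2 + c3 * e^3) c1 0 := by
      have := ((((hasDerivAt_id (0:ℝ)).const_mul c1).const_add (f x)).add ((hasDerivAt_pow 2 (0:ℝ)).const_mul c2)).add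
        ((hasDerivAt_pow 3 (0:ℝ)).const_mul c3)
      exact this.congr_deriv (by simp)
    exact a.sub b
  refine deriv_bd_right hgd (by simp [hg]) hh (fun e he heh => ?_)
  have hb := h4 (pnod x h e) (by
    intro i hi
    interval_cases i <;> simp only [pnod] <;> linarith)
  have id : g e = dd (pnod x h e) (fun i => f (pnod x h e i)) 4 0 * ((e + h) * e * (e - h) * (e - 2 * h)) := by
    simp only [dd, pnod, hg, hc1, hc2, hc3, zero_add]
    have n1 : e + h ≠ 0 := by positivity
    have n2 : h - e ≠ 0 := by linarith
    have n3 : 2 * h - e ≠ 0 := by linarith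
    rw [show x - (x - h) = h by ring, show x + e - x = e by ring, show x + h - (x + e) = h - e by ring,
      show x + 2 * h - (x + h) = h by ring, show x + e - (x - h) = e + h by ring, show x + h - x = h by ring,
      show x + 2 * h - (x + e) = 2 * h - e by ring, show x + h - (x - h) = 2 * h by ring,
      show x + 2 * h - x = 2 * h by ring, show x + 2 * h - (x - h) = 3 * h by ring]
    generalize f (x + e) = F
    generalize f (x - h) = A
    generalize f x = B
    generalize f (x + h) = C
    generalize f (x + 2 * h) = D
    field_simp
    ring
  rw [id, abs_mul]
  have : |(e + h) * e * (e - h) * (e - 2 * h)| ≤ 4 * h^3 * e := by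
    rw [abs_mul, abs_mul, abs_mul, abs_of_pos (by linarith : 0 < e + h), abs_of_pos he,
      abs_of_neg (by linarith : e - h < 0), abs_of_neg (by linarith : e - 2 * h < 0)]
    calc (e + h) * e * -(e - h) * -(e - 2 * h) ≤ (2 * h) * e * h * (2 * h) := by gcongr <;> first | linarith | skip
      _ = _ := by ring
  calc _ ≤ M * (4 * h^3 * e) := mul_le_mul hb this (abs_nonneg _) hM
    _ = _ := by ring

theorem DB.d4 {f : ℝ → ℝ} {M : ℝ} (h : DB 4 f M) (c : ℝ) {x : ℝ} (hx : 0 < x) :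
    |f (c + 2 * x) - 4 * f (c + x) + 6 * f c - 4 * f (c - x) + f (c - 2 * x)| ≤ 24 * M * x ^ 4 := by
  have := h (fun i => c + ((i:ℝ) - 2) * x) (fun i _ => by push_cast; nlinarith)
  have e : dd (fun i : ℕ => c + ((i:ℝ) - 2) * x) (fun i : ℕ => f (c + ((i:ℝ) - 2) * x)) 4 0
      = (f (c + 2 * x) - 4 * f (c + x) + 6 * f c - 4 * f (c - x) + f (c - 2 * x)) / (24 * x ^ 4) := by
    simp only [dd]
    norm_num
    rw [show c + -x = c - x by ring, show c + -(2 * x) = c - 2 * x by ring]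
    field_simp; ring_nf
  rw [e, abs_div, div_le_iff₀ (by positivity), abs_of_pos (show 0 < 24 * x^4 by positivity)] at this
  linarith

/-- cubic jet of `f` (with derivative `f1`) at `x` on scale `h`. -/
def JetAt (f f1 : ℝ → ℝ) (x h M : ℝ) : Prop :=
  ∃ c0 c1 c2 c3 : ℝ, (|c0| ≤ M ∧ |c1| ≤ M ∧ |c2| ≤ M ∧ |c3| ≤ M) ∧
    ∀ j ∈ ({-2, -1, 0, 1, 2} : Finset ℝ),
      |f (x + j * h) - (c0 + c1 * (j * h) + c2 * (j * h)^2 + c3 * (j * h)^3)| ≤ M * h^4 ∧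
      |f1 (x + j * h) - (c1 + 2 * c2 * (j * h) + 3 * c3 * (j * h)^2)| ≤ M * h^3

theorem jet_num {M h : ℝ} (hh : 0 < h) {A : ℤ → ℝ} {B : ℤ → ℝ} {c0 c1 c2 c3 : ℝ}
    (hM : 0 ≤ M) (e0 : ∀ j ∈ Icc (-1:ℤ) 2, A j = c0 + c1 * (j * h) + c2 * (j * h)^2 + c3 * (j * h)^3)
    (d4 : ∀ j : ℤ, |A (j+2) - 4 * A (j+1) + 6 * A j - 4 * A (j-1) + A (j-2)| ≤ 24 * M * h^4)
    (hB : ∀ j : ℤ, |B j - (-2 * A (j-1) - 3 * A j + 6 * A (j+1) - A (j+2)) / (6*h)| ≤ 4 * M * h^3) :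
    ∀ j ∈ Icc (-2:ℤ) 2, |A j - (c0 + c1 * (j * h) + c2 * (j * h)^2 + c3 * (j * h)^3)| ≤ 300 * M * h^4 ∧
      |B j - (c1 + 2 * c2 * (j * h) + 3 * c3 * (j * h)^2)| ≤ 300 * M * h^3 := by
  set P : ℤ → ℝ := fun j => c0 + c1 * (j * h) + c2 * (j * h)^2 + c3 * (j * h)^3 with hP
  have hMh : 0 ≤ M * h^4 := by positivity
  have m1 := e0 (-1) (by simp)
  have m2 := e0 0 (by simp)
  have m3 := e0 1 (by simp)
  have m4 := e0 2 (by simp)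
  have q1 := d4 1
  have q2 := d4 2
  have q3 := d4 0
  have q4 := d4 (-1)
  norm_num at m1 m2 m3 m4 q1 q2 q3 q4
  have E : ∀ j ∈ Icc (-3:ℤ) 4, |A j - P j| ≤ 120 * M * h^4 := by
    have r3 : |A 3 - P 3| ≤ 24 * M * h^4 := by
      simp only [hP]; push_cast
      refine le_trans (le_of_eq ?_) q1
      congr 1; rw [m1, m2, m3, m4]; ring
    have r2 : |A (-2) - P (-2)| ≤ 24 * M * h^4 := by
      simp only [hP]; push_cast
      refine le_trans (le_of_eq ?_) q3
      congr 1; rw [m1, m2, m3, m4]; ring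
    have r4 : |A 4 - P 4| ≤ 120 * M * h^4 := by
      have : A 4 - P 4 = (A 4 - 4 * A 3 + 6 * A 2 - 4 * A 1 + A 0) + 4 * (A 3 - P 3) := by
        simp only [hP]; push_cast; rw [m2, m3, m4]; ring
      rw [this]; rw [abs_le] at *; constructor <;> linarith
    have r5 : |A (-3) - P (-3)| ≤ 120 * M * h^4 := by
      have : A (-3) - P (-3) = (A 1 - 4 * A 0 + 6 * A (-1) - 4 * A (-2) + A (-3)) + 4 * (A (-2) - P (-2)) := by
        simp only [hP]; push_cast; rw [m1, m2, m3]; ring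
      rw [this]; rw [abs_le] at *; constructor <;> linarith
    intro j hj
    have hj1 := hj.1
    have hj2 := hj.2
    by_cases hjm : j ∈ Icc (-1:ℤ) 2
    · rw [e0 j hjm]; simp only [hP, sub_self, abs_zero]; linarith
    · have : j = -3 ∨ j = -2 ∨ j = 3 ∨ j = 4 := by
        simp only [mem_Icc, not_and_or, not_le] at hjm; omega
      rcases this with rfl | rfl | rfl | rfl
      · exact r5
      · linarith
      · linarith
      · exact r4
  intro j hj
  have hj1 := hj.1
  have hj2 := hj.2
  refine ⟨(E j ⟨by omega, by omega⟩).trans (by nlinarith), ?_⟩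
  have a1 := E (j-1) ⟨by omega, by omega⟩
  have a2 := E j ⟨by omega, by omega⟩
  have a3 := E (j+1) ⟨by omega, by omega⟩
  have a4 := E (j+2) ⟨by omega, by omega⟩
  have b := hB j
  have ex : (c1 + 2 * c2 * (j * h) + 3 * c3 * (j * h)^2) = (-2 * P (j-1) - 3 * P j + 6 * P (j+1) - P (j+2)) / (6*h) := by
    simp only [hP]; push_cast; field_simp; ring
  rw [ex]
  have : |(-2 * A (j-1) - 3 * A j + 6 * A (j+1) - A (j+2)) / (6*h) - (-2 * P (j-1) - 3 * P j + 6 * P (j+1) - P (j+2)) / (6*h)|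
      ≤ 240 * M * h^3 := by
    rw [← sub_div, abs_div, abs_of_pos (by positivity : 0 < 6 * h), div_le_iff₀ (by positivity)]
    have : 240 * M * h^3 * (6 * h) = 12 * (120 * M * h^4) := by ring
    rw [this]
    rw [abs_le] at *
    constructor <;> linarith
  have hh3 : 0 ≤ M * h^3 := by positivity
  rw [abs_le] at *
  constructor <;> linarith

theorem jet_of_DB {f f1 : ℝ → ℝ} {M : ℝ} (hDB : ∀ k ≤ 4, DB k f M) (hd : ∀ x, HasDerivAt f (f1 x) x)
    {h : ℝ} (hh : 0 < h) (hh1 : h ≤ 1) (x : ℝ) : JetAt f f1 x h (300 * M) := by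
  have hM := (hDB 0 (by omega)).nonneg
  have b0 : |f x| ≤ M := by
    have := hDB 0 (by omega) (fun _ => x) (fun i hi => absurd hi (by omega))
    simpa [dd] using this
  have b1 := (hDB 1 (by omega)).d1 (x - h) x
  have b2 := (hDB 2 (by omega)).d2 x hh
  have b3 := (hDB 3 (by omega)).d3 x hh
  set d1 := (f x - f (x - h)) / h with hd1
  set d2 := (f (x + h) - 2 * f x + f (x - h)) / (2 * h^2) with hd2
  set d3 := (f (x + 2 * h) - 3 * f (x + h) + 3 * f x - f (x - h)) / (6 * h^3) with hd3
  have a1 : |d1| ≤ M := by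
    rw [hd1, abs_div, abs_of_pos hh, div_le_iff₀ hh]
    rw [show x - (x - h) = h by ring, abs_of_pos hh] at b1
    exact b1
  have a2 : |d2| ≤ M := by
    rw [hd2, abs_div, abs_of_pos (by positivity : 0 < 2 * h^2), div_le_iff₀ (by positivity)]; linarith
  have a3 : |d3| ≤ M := by
    rw [hd3, abs_div, abs_of_pos (by positivity : 0 < 6 * h^3), div_le_iff₀ (by positivity)]; linarith
  have key := jet_num (M := M) (A := fun j => f (x + j * h)) (B := fun j => f1 (x + j * h)) (c0 := f x)
    (c1 := d1 + h * d2 - h^2 * d3) (c2 := d2) (c3 := d3) hh hM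
    (fun j hj => by
      have hj1 := hj.1
      have hj2 := hj.2
      interval_cases j
      · push_cast; rw [show x + -1 * h = x - h by ring, hd1, hd2, hd3]; field_simp; ring
      · push_cast; rw [show x + 0 * h = x by ring]; ring
      · push_cast; rw [show x + 1 * h = x + h by ring, hd1, hd2, hd3]; field_simp; ring
      · push_cast; rw [hd1, hd2, hd3]; field_simp; ring)
    (fun j => by
      have := (hDB 4 le_rfl).d4 (x + j * h) hh
      push_cast
      refine le_trans (le_of_eq ?_) this
      ring_nf)
    (fun j => by
      have := dlem (hDB 4 le_rfl) hh (hd (x + j * h))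
      push_cast
      refine le_trans (le_of_eq ?_) this
      ring_nf)
  refine ⟨f x, d1 + h * d2 - h^2 * d3, d2, d3, ⟨by linarith, ?_, by linarith, by linarith⟩, ?_⟩
  · have p1 := abs_mul_le' (a := h) (A := 1) (by rw [abs_of_pos hh]; exact hh1) a2
    have p2 := abs_mul_le' (a := h^2) (A := 1) (by rw [abs_of_pos (by positivity)]; nlinarith) a3
    rw [abs_le] at *
    constructor <;> linarith
  · intro j hj
    simp only [Finset.mem_insert, Finset.mem_singleton] at hj
    rcases hj with rfl | rfl | rfl | rfl | rfl
    · simpa using key (-2) (by simp)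
    · simpa using key (-1) (by simp)
    · simpa using key 0 (by simp)
    · simpa using key 1 (by simp)
    · simpa using key 2 (by simp)

end

section
open Set

def del2 (f : ℤ → ℝ) (i : ℤ) : ℝ := f (i+1) - 2 * f i + f (i-1)
def cf (f : ℤ → ℝ) (i : ℤ) : ℝ := f i - del2 f i / 12
def Mm (f : ℤ → ℝ) (i : ℤ) : ℝ := (f (i-1) + 4 * f i + f (i+1)) / 6
def N1 (h : ℝ) (a b : ℤ → ℝ) (i : ℤ) : ℝ :=
  ((2 * a i * b i + a i * b (i+1) + a (i+1) * b i + 2 * a (i+1) * b (i+1))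
   - (2 * a (i-1) * b (i-1) + a (i-1) * b i + a i * b (i-1) + 2 * a i * b i)) / (6 * h)

structure JS (F F1 : ℤ → ℝ) (h M : ℝ) (i : ℤ) (c0 c1 c2 c3 : ℝ) : Prop where
  b0 : |c0| ≤ M
  b1 : |c1| ≤ M
  b2 : |c2| ≤ M
  b3 : |c3| ≤ M
  f : ∀ j : ℤ, |j| ≤ 2 → |F (i+j) - (c0 + c1*(j*h) + c2*(j*h)^2 + c3*(j*h)^3)| ≤ M * h^4
  g : ∀ j : ℤ, |j| ≤ 2 → |F1 (i+j) - (c1 + 2*c2*(j*h) + 3*c3*(j*h)^2)| ≤ M * h^3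

theorem JetAt.js {f f1 : ℝ → ℝ} {h M : ℝ} {i : ℤ} (H : JetAt f f1 (i*h) h M) :
    ∃ c0 c1 c2 c3, JS (fun j => f (j*h)) (fun j => f1 (j*h)) h M i c0 c1 c2 c3 := by
  obtain ⟨c0, c1, c2, c3, ⟨b0, b1, b2, b3⟩, H⟩ := H
  have hm : ∀ j : ℤ, |j| ≤ 2 → (j:ℝ) ∈ ({-2,-1,0,1,2}:Finset ℝ) := by
    intro j hj
    obtain ⟨h1, h2⟩ := abs_le.1 hj
    interval_cases j <;> simp
  refine ⟨c0, c1, c2, c3, b0, b1, b2, b3, fun j hj => ?_, fun j hj => ?_⟩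
  · have := (H j (hm j hj)).1
    simpa [add_mul] using this
  · have := (H j (hm j hj)).2
    simpa [add_mul] using this

theorem abs_pow_le' {s r : ℝ} (n : ℕ) (h : |s| ≤ r) : |s^n| ≤ r^n := by
  rw [abs_pow]; exact pow_le_pow_left₀ (abs_nonneg _) h n

theorem poly_bd {c0 c1 c2 c3 M s : ℝ} (b0 : |c0| ≤ M) (b1 : |c1| ≤ M) (b2 : |c2| ≤ M) (b3 : |c3| ≤ M)
    (hs : |s| ≤ 2) : |c0 + c1*s + c2*s^2 + c3*s^3| ≤ 15 * M ∧ |c1 + 2*c2*s + 3*c3*s^2| ≤ 17 * M := by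
  have e1 := abs_mul_le' b1 hs
  have e2 := abs_mul_le' b2 (abs_pow_le' 2 hs)
  have e3 := abs_mul_le' b3 (abs_pow_le' 3 hs)
  have e4 := abs_mul_le' b2 hs
  have e5 := abs_mul_le' b3 (abs_pow_le' 2 hs)
  constructor <;> rw [abs_le] at * <;> constructor <;> linarith

theorem prod_err {x y p q a b X Y : ℝ} (hx : |x - p| ≤ a) (hy : |y - q| ≤ b) (hp : |p| ≤ X)
    (hY : |y| ≤ Y) : |x*y - p*q| ≤ a * Y + X * b := by
  rw [show x*y - p*q = (x-p)*y + p*(y-q) by ring]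
  exact (abs_add_le _ _).trans (add_le_add (abs_mul_le' hx hY) (abs_mul_le' hp hy))

theorem JS.nn {F F1 : ℤ → ℝ} {h M : ℝ} {i : ℤ} {c0 c1 c2 c3 : ℝ} (H : JS F F1 h M i c0 c1 c2 c3) : 0 ≤ M :=
  (abs_nonneg _).trans H.b0

theorem jsh {h : ℝ} (h0 : 0 ≤ h) {j : ℤ} (hj : |j| ≤ 2) : |(j:ℝ)*h| ≤ 2*h := by
  rw [abs_mul, abs_of_nonneg h0]
  have : |(j:ℝ)| ≤ 2 := by exact_mod_cast hj
  gcongr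

set_option maxHeartbeats 1000000 in
theorem JS.mul {F F1 G G1 : ℤ → ℝ} {h M : ℝ} {i : ℤ} {c0 c1 c2 c3 d0 d1 d2 d3 : ℝ} (h0 : 0 ≤ h) (h1 : h ≤ 1)
    (H : JS F F1 h M i c0 c1 c2 c3) (K : JS G G1 h M i d0 d1 d2 d3) :
    JS (fun j => F j * G j) (fun j => F1 j * G j + F j * G1 j) h (1000*M^2) i
      (c0*d0) (c0*d1+c1*d0) (c0*d2+c1*d1+c2*d0) (c0*d3+c1*d2+c2*d1+c3*d0) := by
  have hM := H.nn
  have m00 := abs_mul_le' H.b0 K.b0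
  have m01 := abs_mul_le' H.b0 K.b1
  have m02 := abs_mul_le' H.b0 K.b2
  have m03 := abs_mul_le' H.b0 K.b3
  have m10 := abs_mul_le' H.b1 K.b0
  have m11 := abs_mul_le' H.b1 K.b1
  have m12 := abs_mul_le' H.b1 K.b2
  have m13 := abs_mul_le' H.b1 K.b3
  have m20 := abs_mul_le' H.b2 K.b0
  have m21 := abs_mul_le' H.b2 K.b1
  have m22 := abs_mul_le' H.b2 K.b2
  have m23 := abs_mul_le' H.b2 K.b3
  have m30 := abs_mul_le' H.b3 K.b0
  have m31 := abs_mul_le' H.b3 K.b1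
  have m32 := abs_mul_le' H.b3 K.b2
  have m33 := abs_mul_le' H.b3 K.b3
  have hMM : 0 ≤ M * M := by positivity
  have hM2 : M^2 = M * M := by ring
  have h4 : h^4 ≤ h^3 := pow_le_pow_of_le_one h0 h1 (by norm_num)
  have h41 : h^4 ≤ 1 := pow_le_one₀ h0 h1
  have h31 : h^3 ≤ 1 := pow_le_one₀ h0 h1
  refine ⟨?_, ?_, ?_, ?_, fun j hj => ?_, fun j hj => ?_⟩
  · rw [abs_le] at *; constructor <;> linarith
  · rw [abs_le] at *; constructor <;> linarith
  · rw [abs_le] at *; constructor <;> linarith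
  · rw [abs_le] at *; constructor <;> linarith
  all_goals
    have hs := jsh h0 hj
    have hs2 : |(j:ℝ)*h| ≤ 2 := hs.trans (by linarith)
    obtain ⟨pc, pc1⟩ := poly_bd H.b0 H.b1 H.b2 H.b3 hs2
    obtain ⟨pd, pd1⟩ := poly_bd K.b0 K.b1 K.b2 K.b3 hs2
    have fH := H.f j hj
    have gH := H.g j hj
    have fK := K.f j hj
    have gK := K.g j hj
    have bG : |G (i+j)| ≤ 16 * M := by
      have : M * h^4 ≤ M := mul_le_of_le_one_right hM h41
      rw [abs_le] at *; constructor <;> linarith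
  · have e := prod_err fH fK pc bG
    set s := (j:ℝ)*h
    have r4 := abs_mul_le' (a := c1*d3+c2*d2+c3*d1) (A := 3*(M*M)) (by
      rw [abs_le] at *; constructor <;> linarith) (abs_pow_le' 4 hs)
    have r5 := abs_mul_le' (a := (c2*d3+c3*d2)) (A := 2*(M*M)) (by
      rw [abs_le] at *; constructor <;> linarith) (abs_pow_le' 5 hs)
    have r6 := abs_mul_le' m33 (abs_pow_le' 6 hs)
    have q5 : h^5 ≤ h^4 := pow_le_pow_of_le_one h0 h1 (by norm_num)
    have q6 : h^6 ≤ h^4 := pow_le_pow_of_le_one h0 h1 (by norm_num)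
    have q5' := mul_le_mul_of_nonneg_left q5 hMM
    have q6' := mul_le_mul_of_nonneg_left q6 hMM
    have q4' : 0 ≤ M*M*h^4 := by positivity
    rw [abs_le] at *
    constructor <;> linarith
  · have bF : |F1 (i+j)| ≤ 18 * M := by
      have : M * h^3 ≤ M := mul_le_of_le_one_right hM h31
      rw [abs_le] at *; constructor <;> linarith
    have e := prod_err gH fK pc1 bG
    have bG1 : |G1 (i+j)| ≤ 18 * M := by
      have : M * h^3 ≤ M := mul_le_of_le_one_right hM h31
      rw [abs_le] at *; constructor <;> linarith
    have e' := prod_err fH gK pc bG1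
    set s := (j:ℝ)*h
    have r4 := abs_mul_le' (a := c1*d3+c2*d2+c3*d1) (A := 3*(M*M)) (by
      rw [abs_le] at *; constructor <;> linarith) (abs_pow_le' 3 hs)
    have r5 := abs_mul_le' (a := (c2*d3+c3*d2)) (A := 2*(M*M)) (by
      rw [abs_le] at *; constructor <;> linarith) (abs_pow_le' 4 hs)
    have r6 := abs_mul_le' m33 (abs_pow_le' 5 hs)
    have q4' := mul_le_mul_of_nonneg_left h4 hMM
    have q5' := mul_le_mul_of_nonneg_left (pow_le_pow_of_le_one h0 h1 (by norm_num) : h^5 ≤ h^3) hMM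
    have q3' : 0 ≤ M*M*h^3 := by positivity
    rw [abs_le] at *
    constructor <;> linarith

theorem JS.cf {F F1 : ℤ → ℝ} {h M : ℝ} {i : ℤ} {c0 c1 c2 c3 : ℝ}
    (H : JS F F1 h M i c0 c1 c2 c3) {j : ℤ} (hj : |j| ≤ 1) :
    |cf F (i+j) - (c0 - c2*h^2/6 + (c1 - c3*h^2/2)*(j*h) + c2*(j*h)^2 + c3*(j*h)^3)| ≤ 2*(M*h^4) := by
  obtain ⟨l, u⟩ := abs_le.1 hj
  have e0 := H.f j (by rw [abs_le]; omega)
  have e1 := H.f (j+1) (by rw [abs_le]; omega)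
  have e2 := H.f (j-1) (by rw [abs_le]; omega)
  rw [← add_assoc] at e1
  rw [← add_sub_assoc] at e2
  push_cast at *
  simp only [_root_.cf, del2]
  rw [abs_le] at *
  constructor <;> linarith

theorem N1_bd {M h e : ℝ} (h0 : 0 < h) {a b A B : ℤ → ℝ} {i : ℤ} (he : 0 ≤ e) (hM : 0 ≤ M)
    (ha : ∀ j : ℤ, |j| ≤ 1 → |a (i+j) - A j| ≤ e) (hb : ∀ j : ℤ, |j| ≤ 1 → |b (i+j) - B j| ≤ e)
    (hA : ∀ j : ℤ, |j| ≤ 1 → |A j| ≤ M) (hB : ∀ j : ℤ, |j| ≤ 1 → |b (i+j)| ≤ M) :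
    |N1 h a b i - N1 h A B 0| ≤ 4 * (M * e) / h := by
  have P : ∀ j k : ℤ, |j| ≤ 1 → |k| ≤ 1 → |a (i+j) * b (i+k) - A j * B k| ≤ 2 * (M*e) := fun j k hj hk =>
    (prod_err (ha j hj) (hb k hk) (hA j hj) (hB k hk)).trans (by linarith)
  have p00 := P 0 0 (by simp) (by simp)
  have p01 := P 0 1 (by simp) (by simp)
  have p10 := P 1 0 (by simp) (by simp)
  have p11 := P 1 1 (by simp) (by simp)
  have n01 := P 0 (-1) (by simp) (by simp)
  have n10 := P (-1) 0 (by simp) (by simp)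
  have n11 := P (-1) (-1) (by simp) (by simp)
  simp only [add_zero, ← sub_eq_add_neg] at *
  unfold N1
  rw [← sub_div, abs_div, abs_of_pos (by positivity : 0 < 6 * h), div_le_div_iff₀ (by positivity) h0]
  have : |2 * a i * b i + a i * b (i + 1) + a (i + 1) * b i + 2 * a (i + 1) * b (i + 1) -
          (2 * a (i - 1) * b (i - 1) + a (i - 1) * b i + a i * b (i - 1) + 2 * a i * b i) -
        (2 * A 0 * B 0 + A 0 * B (0 + 1) + A (0 + 1) * B 0 + 2 * A (0 + 1) * B (0 + 1) -
          (2 * A (0 - 1) * B (0 - 1) + A (0 - 1) * B 0 + A 0 * B (0 - 1) + 2 * A 0 * B 0))| ≤ 24 * (M * e) := by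
    simp only [zero_add, zero_sub]
    rw [abs_le] at *
    have : 0 ≤ M * e := by positivity
    constructor <;> linarith
  calc _ ≤ 24 * (M * e) * h := by gcongr
    _ = _ := by ring

theorem T_bd {F F1 G G1 : ℤ → ℝ} {h M : ℝ} {i : ℤ} {c0 c1 c2 c3 d0 d1 d2 d3 : ℝ} (h0 : 0 < h) (h1 : h ≤ 1)
    (H : JS F F1 h M i c0 c1 c2 c3) (K : JS G G1 h M i d0 d1 d2 d3) :
    |N1 h (cf F) (cf G) i - Mm (cf (fun j => F1 j * G j + F j * G1 j)) i| ≤ 3000 * M^2 * h^3 := by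
  have hM := H.nn
  have L := H.mul h0.le h1 K
  have h21 : h^2 ≤ 1 := pow_le_one₀ h0.le h1
  have h41 : h^4 ≤ 1 := pow_le_one₀ h0.le h1
  have hb : ∀ {c0 c1 c2 c3 : ℝ}, |c0| ≤ M → |c1| ≤ M → |c2| ≤ M → |c3| ≤ M → ∀ j : ℤ, |j| ≤ 1 →
     |c0 - c2*h^2/6 + (c1 - c3*h^2/2)*(j*h) + c2*(j*h)^2 + c3*(j*h)^3| ≤ 17 * M := by
    intro c0 c1 c2 c3 b0 b1 b2 b3 j hj
    have hs : |(j:ℝ)*h| ≤ 2 := (jsh h0.le (by omega)).trans (by linarith)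
    obtain ⟨pc, pc1⟩ := poly_bd b0 b1 b2 b3 hs
    have e1 := abs_mul_le' b2 (a := c2) (b := h^2) (B := 1) (by rwa [abs_of_nonneg (by positivity)])
    have e2 := abs_mul_le' (a := c3) (b := h^2) (B := 1) b3 (by rwa [abs_of_nonneg (by positivity)])
    have e3 := abs_mul_le' e2 hs
    rw [abs_le] at *
    constructor <;> linarith
  have hbG : ∀ j : ℤ, |j| ≤ 1 → |cf G (i+j)| ≤ 19 * M := by
    intro j hj
    have e := K.cf hj
    have := hb K.b0 K.b1 K.b2 K.b3 j hj
    have : M * h^4 ≤ M := mul_le_of_le_one_right hM h41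
    rw [abs_le] at *
    constructor <;> linarith
  have A := N1_bd (M := 19*M) (e := 2*(M*h^4)) h0 (a := cf F) (b := cf G)
    (A := fun j => c0 - c2*h^2/6 + (c1 - c3*h^2/2)*(j*h) + c2*(j*h)^2 + c3*(j*h)^3)
    (B := fun j => d0 - d2*h^2/6 + (d1 - d3*h^2/2)*(j*h) + d2*(j*h)^2 + d3*(j*h)^3) (i := i)
    (by positivity) (by positivity) (fun j hj => H.cf hj) (fun j hj => K.cf hj)
    (fun j hj => (hb H.b0 H.b1 H.b2 H.b3 j hj).trans (by linarith)) hbG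
  have E : N1 h (fun j => c0 - c2*h^2/6 + (c1 - c3*h^2/2)*(j*h) + c2*(j*h)^2 + c3*(j*h)^3)
     (fun j => d0 - d2*h^2/6 + (d1 - d3*h^2/2)*(j*h) + d2*(j*h)^2 + d3*(j*h)^3) 0
     = (c0*d1+c1*d0) + (c0*d3+c1*d2+c2*d1+c3*d0)*h^2/2 + h^4/4*(c2*d3+c3*d2) := by
    unfold N1
    push_cast
    field_simp
    ring
  rw [E] at A
  have g0 := L.g 0 (by simp)
  have g1 := L.g 1 (by simp)
  have g2 := L.g 2 (by simp)
  have g3 := L.g (-1) (by simp)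
  have g4 := L.g (-2) (by simp)
  set V := fun j => F1 j * G j + F j * G1 j
  have hV : ∀ j, V j = F1 j * G j + F j * G1 j := fun j => rfl
  simp only [← hV] at g0 g1 g2 g3 g4
  have m23 := abs_mul_le' H.b2 K.b3
  have m32 := abs_mul_le' H.b3 K.b2
  have r := abs_mul_le' (a := h^4) (A := h^3) (by
    rw [abs_of_nonneg (by positivity)]; exact pow_le_pow_of_le_one h0.le h1 (by norm_num))
    (b := c2*d3+c3*d2) (B := 2*(M*M)) (by rw [abs_le] at *; constructor <;> linarith)
  have A' : 4 * (19 * M * (2 * (M * h ^ 4))) / h = 152 * (M^2*h^3) := by field_simp; ring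
  rw [A'] at A
  have q3' : 0 ≤ M^2*h^3 := by positivity
  simp only [Mm, _root_.cf, del2] at *
  rw [show i - 1 + 1 = i by ring, show i - 1 - 1 = i + -2 by ring, show i + 1 + 1 = i + 2 by ring,
    show i + 1 - 1 = i by ring, show i - 1 = i + -1 by ring] at *
  push_cast at *
  simp only [add_zero] at *
  rw [abs_le] at *
  constructor <;> linarith

end

section
open Set

def Per (n : ℕ) (f : ℤ → ℝ) : Prop := ∀ i : ℤ, f (i + n) = f i
def SS (n : ℕ) (f : ℤ → ℝ) : ℝ := ∑ i ∈ Finset.range n, f i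

theorem Per.e {n : ℕ} {f : ℤ → ℝ} (h : Per n f) {i j : ℤ} (e : i = j + n) : f i = f j := by rw [e, h]

theorem SS_tel {n : ℕ} {G : ℤ → ℝ} (h : Per n G) : SS n (fun i => G (i+1) - G i) = 0 := by
  have := Finset.sum_range_sub (fun k : ℕ => G k) n
  unfold SS
  push_cast at this
  rw [this, h.e (show (n:ℤ) = 0 + n by ring)]; ring

theorem SS_le {n : ℕ} {P Q : ℤ → ℝ} (h : ∀ i, P i ≤ Q i) : SS n P ≤ SS n Q :=
  Finset.sum_le_sum fun _ _ => h _

theorem SS_add (n : ℕ) (P Q : ℤ → ℝ) : SS n (fun i => P i + Q i) = SS n P + SS n Q := Finset.sum_add_distrib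
theorem SS_sub (n : ℕ) (P Q : ℤ → ℝ) : SS n (fun i => P i - Q i) = SS n P - SS n Q := Finset.sum_sub_distrib ..
theorem SS_mul (n : ℕ) (c : ℝ) (P : ℤ → ℝ) : SS n (fun i => c * P i) = c * SS n P := by
  unfold SS; rw [Finset.mul_sum]
theorem SS_nonneg {n : ℕ} {P : ℤ → ℝ} (h : ∀ i, 0 ≤ P i) : 0 ≤ SS n P := Finset.sum_nonneg fun _ _ => h _

theorem SS_up {n : ℕ} {G : ℤ → ℝ} (h : Per n G) : SS n (fun i => G (i+1)) = SS n G := by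
  have := SS_tel h
  rw [SS_sub] at this; linarith

theorem Per.dn {n : ℕ} {G : ℤ → ℝ} (h : Per n G) : Per n (fun i => G (i-1)) := fun i => h.e (by ring)
theorem Per.up {n : ℕ} {G : ℤ → ℝ} (h : Per n G) : Per n (fun i => G (i+1)) := fun i => h.e (by ring)
theorem SS_dn {n : ℕ} {G : ℤ → ℝ} (h : Per n G) : SS n (fun i => G (i-1)) = SS n G := by
  have := SS_up h.dn
  simp only [add_sub_cancel_right] at this
  exact this.symm

theorem Per.mul {n : ℕ} {f g : ℤ → ℝ} (h : Per n f) (k : Per n g) : Per n (fun i => f i * g i) := fun i => by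
  simp only [h i, k i]
theorem Per.sq {n : ℕ} {f : ℤ → ℝ} (h : Per n f) : Per n (fun i => f i ^ 2) := fun i => by
  simp only [h i]
theorem Per.add {n : ℕ} {f g : ℤ → ℝ} (h : Per n f) (k : Per n g) : Per n (fun i => f i + g i) := fun i => by
  simp only [h i, k i]
theorem Per.sub {n : ℕ} {f g : ℤ → ℝ} (h : Per n f) (k : Per n g) : Per n (fun i => f i - g i) := fun i => by
  simp only [h i, k i]
theorem Per.cmul {n : ℕ} {f : ℤ → ℝ} (c : ℝ) (h : Per n f) : Per n (fun i => c * f i) := fun i => by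
  simp only [h i]
theorem Per.Mm {n : ℕ} {f : ℤ → ℝ} (h : Per n f) : Per n (Mm f) := fun i => by
  unfold _root_.Mm
  rw [h.e (show i + n - 1 = (i-1) + n by ring), h.e (show i + n + 1 = (i+1) + n by ring), h i]
theorem Per.N1 {n : ℕ} {f g : ℤ → ℝ} (k : ℝ) (h : Per n f) (h' : Per n g) : Per n (N1 k f g) := fun i => by
  unfold _root_.N1
  rw [h.e (show i + n - 1 = (i-1) + n by ring), h.e (show i + n + 1 = (i+1) + n by ring), h i,
   h'.e (show i + n - 1 = (i-1) + n by ring), h'.e (show i + n + 1 = (i+1) + n by ring), h' i]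

/-- three-point domination: P ≤ weighted neighbours -/
theorem SS_nb {n : ℕ} {P G f : ℤ → ℝ} {c : ℝ} (hG : Per n G) (hf : Per n f)
    (h : ∀ i, P i ≤ (G (i+1) - G i) + c * (f (i-1) + f i + f (i+1))) : SS n P ≤ 3 * c * SS n f := by
  refine (SS_le h).trans (le_of_eq ?_)
  rw [SS_add, SS_tel hG, SS_mul, SS_add, SS_add, SS_up hf, SS_dn hf]; ring

theorem SS_eq {n : ℕ} {P Q G : ℤ → ℝ} (hG : Per n G)
    (h : ∀ i, P i = Q i + (G (i+1) - G i)) : SS n P = SS n Q := by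
  rw [show P = fun i => Q i + (G (i+1) - G i) from funext h, SS_add, SS_tel hG, add_zero]

theorem M_symm {n : ℕ} {f g : ℤ → ℝ} (hf : Per n f) (hg : Per n g) :
    SS n (fun i => f i * Mm g i) = SS n (fun i => g i * Mm f i) := by
  apply SS_eq (G := fun i => (f (i-1) * g i - g (i-1) * f i)/6)
  · exact fun i => by
      simp only
      rw [hf i, hg i, hf.e (show i + n - 1 = (i-1) + n by ring), hg.e (show i + n - 1 = (i-1) + n by ring)]
  · intro i
    simp only [Mm, add_sub_cancel_right]; ring

theorem M_pos {n : ℕ} {f : ℤ → ℝ} (hf : Per n f) :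
    SS n (fun i => f i ^2) ≤ 3 * SS n (fun i => f i * Mm f i) := by
  have hs := hf.sq
  have : SS n (fun i => -(f i * Mm f i) + (7/12) * f i^2) ≤ 3 * (1/12) * SS n (fun i => f i^2) := by
    apply SS_nb (G := fun _ => 0) (fun _ => rfl) hs
    intro i
    simp only [Mm]
    nlinarith [sq_nonneg (f i + f (i-1)), sq_nonneg (f i + f (i+1))]
  rw [SS_add, SS_mul] at this
  have e : SS n (fun i => -(f i * Mm f i)) = - SS n (fun i => f i * Mm f i) := by
    simp [SS]
  rw [e] at this
  linarith

theorem M_inv {n : ℕ} {f : ℤ → ℝ} (hf : Per n f) :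
    SS n (fun i => f i ^2) ≤ 9 * SS n (fun i => Mm f i ^2) := by
  have h1 := M_pos hf
  have : SS n (fun i => f i * Mm f i) ≤ SS n (fun i => (1/6) * f i^2 + (3/2) * Mm f i^2) := by
    apply SS_le; intro i
    nlinarith [sq_nonneg (f i - 3 * Mm f i)]
  rw [SS_add, SS_mul, SS_mul] at this
  linarith

theorem M_pos_w {n : ℕ} {a f : ℤ → ℝ} {α K h : ℝ} (ha : Per n a) (hf : Per n f) (hα : ∀ i, α ≤ a i) (hα0 : 0 ≤ α)
    (hd : ∀ i, |a (i+1) - a i| ≤ K * h) (hK : K * h ≤ α) :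
    α * SS n (fun i => f i ^2) ≤ 6 * SS n (fun i => a i * (f i * Mm f i)) := by
  have : SS n (fun i => -(6 * (a i * (f i * Mm f i))) + α * f i^2) ≤ 3 * 0 * SS n (fun i => f i^2) := by
    apply SS_nb (G := fun i => (a i + α) / 2 * f i^2 - (a (i-1) + α) / 2 * f (i-1)^2 ) _ hf.sq
    · intro i
      have h1 := hd i
      have h2 := hd (i-1)
      simp only [sub_add_cancel] at h2
      have h3 := hα i
      have h4 := hα (i+1)
      have h5 := hα (i-1)
      simp only [Mm, add_sub_cancel_right]
      rw [abs_le] at *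
      have e1 : 0 ≤ a i * (f i + f (i-1))^2 := mul_nonneg (by linarith) (sq_nonneg _)
      have e2 : 0 ≤ a i * (f i + f (i+1))^2 := mul_nonneg (by linarith) (sq_nonneg _)
      have e4 : 0 ≤ (a i - α) * f i^2 := mul_nonneg (by linarith) (sq_nonneg _)
      have e5 : 0 ≤ (α - (a i - a (i-1))) * f (i-1)^2 := mul_nonneg (by linarith) (sq_nonneg _)
      have e6 : 0 ≤ (α - (a i - a (i+1))) * f (i+1)^2 := mul_nonneg (by linarith) (sq_nonneg _)
      nlinarith
    · exact fun i => by
        simp only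
        rw [hf i, ha i, hf.e (show i + n - 1 = (i-1) + n by ring), ha.e (show i + n - 1 = (i-1) + n by ring)]
  have e : SS n (fun i => -(6 * (a i * (f i * Mm f i)))) = - (6 * SS n (fun i => a i * (f i * Mm f i))) := by
    rw [← SS_mul]; simp [SS]
  rw [SS_add, e, SS_mul] at this
  linarith

end

section
open Set

theorem ab_le {x y c C X Y : ℝ} (hc : |c| ≤ C) (hx : x^2 ≤ X) (hy : y^2 ≤ Y) : c * (x * y) ≤ C * (X + Y) / 2 := by
  have h1 : |x*y| ≤ (X+Y)/2 := by
    rw [abs_le]; constructor <;> nlinarith [sq_nonneg (x-y), sq_nonneg (x+y)]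
  have := abs_mul_le' hc h1
  linarith [le_abs_self (c*(x*y))]

theorem T3_pt {h K : ℝ} (h0 : 0 < h) {v w x : ℤ → ℝ} (hv : ∀ i, |v i| ≤ K) (hw : ∀ i, |w i| ≤ K)
    (dv : ∀ i, |v (i+1) - v i| ≤ K * h) (dw : ∀ i, |w (i+1) - w i| ≤ K * h) (i : ℤ) :
    -(v i * (x i * N1 h w x i)) ≤
      ((fun i => -(v i * x i * x (i-1) * (2 * w (i-1) + w i)/(6*h))) (i+1)
        - (fun i => -(v i * x i * x (i-1) * (2 * w (i-1) + w i)/(6*h))) i)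
      + K^2 * (x (i-1) ^2 + x i^2 + x (i+1)^2) := by
  have K0 : 0 ≤ K := (abs_nonneg _).trans (hv 0)
  have e1 : |(v (i+1) - v i) * (2 * w (i+1) + w i)| ≤ (K*h) * (3 * K) := abs_mul_le' (dv i) (by
    have := hw i
    have := hw (i+1)
    rw [abs_le] at *; constructor <;> linarith)
  have e2 : |v (i+1) * (w (i+1) - w i)| ≤ K * (K*h) := abs_mul_le' (hv _) (dw i)
  have d1 := dw i
  have d2 := dw (i-1)
  rw [sub_add_cancel] at d2
  have e3 : |v i * (w (i+1) - w (i-1))| ≤ K * (2*(K*h)) := abs_mul_le' (hv _) (by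
    rw [abs_le] at *; constructor <;> linarith)
  have t1 := ab_le (x := x i) (y := x (i+1)) (c := ((v (i+1) - v i) * (2 * w (i+1) + w i)) - v (i+1) * (w (i+1) - w i)) (C := 4 * K^2 * h)
    (by rw [abs_le] at *; constructor <;> linarith) le_rfl le_rfl
  have t2 := ab_le (x := x i) (y := x i) (c := - (v i * (w (i+1) - w (i-1)))) (C := 2 * K^2 * h)
    (by rw [abs_le] at *; constructor <;> linarith) le_rfl le_rfl
  rw [← mul_le_mul_iff_of_pos_left (show 0 < 6*h by positivity)]
  have : 0 ≤ K^2 * h * x i^2 := by positivity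
  have : 0 ≤ K^2 * h * x (i+1)^2 := by positivity
  have : 0 ≤ K^2 * h * x (i-1)^2 := by positivity
  simp only [N1, add_sub_cancel_right]
  field_simp
  linarith

theorem T3 {n : ℕ} {h K : ℝ} (h0 : 0 < h) {v w x : ℤ → ℝ} (pv : Per n v) (pw : Per n w) (px : Per n x)
    (hv : ∀ i, |v i| ≤ K) (hw : ∀ i, |w i| ≤ K)
    (dv : ∀ i, |v (i+1) - v i| ≤ K * h) (dw : ∀ i, |w (i+1) - w i| ≤ K * h) :
    SS n (fun i => -(v i * (x i * N1 h w x i))) ≤ 3 * K^2 * SS n (fun i => x i^2) := by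
  refine SS_nb (G := fun i => -(v i * x i * x (i-1) * (2 * w (i-1) + w i)/(6*h))) ?_ px.sq (T3_pt (x := x) h0 hv hw dv dw)
  intro i
  simp only [pv i, px i, pw i, px.e (show i + n - 1 = (i-1) + n by ring), pw.e (show i + n - 1 = (i-1) + n by ring)]

theorem L1 {n : ℕ} {h K : ℝ} (h0 : 0 < h) {a x y : ℤ → ℝ} (pa : Per n a) (px : Per n x) (py : Per n y)
    (da : ∀ i, |a (i+1) - a i| ≤ K * h) :
    SS n (fun i => -(y i * N1 h a x i + a i * (x i * N1 h y (fun _ => 1) i))) ≤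
      3 * K * SS n (fun i => x i^2 + y i^2) := by
  refine SS_nb (G := fun i => (3 * a i * x i * y (i-1) + 3 * a (i-1) * x (i-1) * y i) * (-1/(6*h))) ?_ (px.sq.add py.sq) ?_
  · intro i
    simp only [pa i, px i, py i, px.e (show i + n - 1 = (i-1) + n by ring), py.e (show i + n - 1 = (i-1) + n by ring),
      pa.e (show i + n - 1 = (i-1) + n by ring)]
  · intro i
    have d1 := da i
    have d2 := da (i-1)
    rw [sub_add_cancel] at d2
    have K0 : 0 ≤ K*h := (abs_nonneg _).trans (da 0)
    have t1 := ab_le (x := y i) (y := x (i+1)) d1 le_rfl le_rfl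
    have t2 := ab_le (x := y i) (y := x (i-1)) d2 le_rfl le_rfl
    have t3 := ab_le (x := y i) (y := x i) (c := -(a (i+1) - a (i-1))) (C := 2*(K*h)) (by
      rw [abs_le] at *; constructor <;> linarith) le_rfl le_rfl
    rw [← mul_le_mul_iff_of_pos_left (show 0 < 6*h by positivity)]
    have p1 : 0 ≤ K * h * x i^2 := by positivity
    have p2 : 0 ≤ K * h * x (i+1)^2 := by positivity
    have p3 : 0 ≤ K * h * x (i-1)^2 := by positivity
    have p4 : 0 ≤ K * h * y i^2 := by positivity
    have p5 : 0 ≤ K * h * y (i+1)^2 := by positivity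
    have p6 : 0 ≤ K * h * y (i-1)^2 := by positivity
    simp only [N1, add_sub_cancel_right]
    field_simp
    linarith

theorem N1_sq {h W : ℝ} (h0 : 0 < h) {w x : ℤ → ℝ} (hw : ∀ i, |w i| ≤ W) (i : ℤ) :
    (h * N1 h w x i)^2 ≤ W^2 * 2 * (x (i-1)^2 + x i^2 + x (i+1)^2) := by
  have e : h * N1 h w x i = (x (i+1) * (2 * w (i+1) + w i) + x (i-1) * (-(2 * w (i-1) + w i)) + x i * (w (i+1) - w (i-1))) / 6 := by
    unfold N1; field_simp; ring
  have a1 := hw i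
  have a2 := hw (i+1)
  have a3 := hw (i-1)
  have W0 : 0 ≤ W := (abs_nonneg _).trans a1
  have b1 : |2 * w (i+1) + w i| ≤ 3 * W := by rw [abs_le] at *; constructor <;> linarith
  have b2 : |-(2 * w (i-1) + w i)| ≤ 3 * W := by rw [abs_le] at *; constructor <;> linarith
  have b3 : |w (i+1) - w (i-1)| ≤ 3 * W := by rw [abs_le] at *; constructor <;> linarith
  have c1 := sq_le_sq' (abs_le.1 b1).1 (abs_le.1 b1).2
  have c2 := sq_le_sq' (abs_le.1 b2).1 (abs_le.1 b2).2
  have c3 := sq_le_sq' (abs_le.1 b3).1 (abs_le.1 b3).2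
  rw [e]
  set A := 2 * w (i+1) + w i
  set B := -(2 * w (i-1) + w i)
  set D := w (i+1) - w (i-1)
  have d1 := mul_le_mul_of_nonneg_left c1 (sq_nonneg (x (i+1)))
  have d2 := mul_le_mul_of_nonneg_left c2 (sq_nonneg (x (i-1)))
  have d3 := mul_le_mul_of_nonneg_left c3 (sq_nonneg (x i))
  have p1 : 0 ≤ W^2 * x i^2 := by positivity
  have p2 : 0 ≤ W^2 * x (i+1)^2 := by positivity
  have p3 : 0 ≤ W^2 * x (i-1)^2 := by positivity
  nlinarith [sq_nonneg (x (i+1) * A - x (i-1) * B), sq_nonneg (x (i+1) * A - x i * D), sq_nonneg (x (i-1) * B - x i * D)]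

theorem N1_sqS {n : ℕ} {h W : ℝ} (h0 : 0 < h) {w x : ℤ → ℝ} (px : Per n x) (hw : ∀ i, |w i| ≤ W) :
    SS n (fun i => (h * N1 h w x i)^2) ≤ 6 * W^2 * SS n (fun i => x i^2) := by
  refine (SS_nb (G := fun _ => 0) (f := fun i => x i^2) (c := W^2 * 2) (fun _ => rfl) px.sq fun i => ?_).trans (le_of_eq (by ring))
  have := N1_sq (x := x) h0 hw i
  linarith

/-- commutator term -/
theorem comm_bd {n : ℕ} {h K : ℝ} (h0 : 0 < h) {a x q : ℤ → ℝ} (pa : Per n a) (px : Per n x) (pq : Per n q)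
    (da : ∀ i, |a (i+1) - a i| ≤ K * h) :
    SS n (fun i => a i * (q i * Mm x i)) - SS n (fun i => a i * (x i * Mm q i)) ≤
      SS n (fun i => (h * q i)^2) + K^2 * SS n (fun i => x i^2) := by
  have e := M_symm pq (pa.mul px)
  have e2 : SS n (fun i => a i * (x i * Mm q i)) = SS n (fun i => (q i * Mm (fun j => a j * x j) i)) := by
    rw [e]; simp only [mul_assoc]
  rw [e2, ← SS_sub]
  have K0 : 0 ≤ K*h := (abs_nonneg _).trans (da 0)
  have := SS_nb (n := n) (P := fun i => a i * (q i * Mm x i) - q i * Mm (fun j => a j * x j) i - (h * q i)^2)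
    (G := fun _ => 0) (f := fun i => x i^2) (c := K^2/3) (fun _ => rfl) px.sq (fun i => by
      have d1 := da i
      have d2 := da (i-1)
      rw [sub_add_cancel] at d2
      have t1 := ab_le (x := h * q i) (y := K * x (i+1)) (c := -(a (i+1) - a i)/(K*h)) (C := 1) (by
        rw [abs_div, abs_neg, abs_of_nonneg K0]; exact div_le_one_of_le₀ d1 K0) le_rfl le_rfl
      have t2 := ab_le (x := h * q i) (y := K * x (i-1)) (c := (a i - a (i-1))/(K*h)) (C := 1) (by
        rw [abs_div, abs_of_nonneg K0]; exact div_le_one_of_le₀ d2 K0) le_rfl le_rfl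
      have p1 : 0 ≤ K^2 * x i^2 := by positivity
      have p2 : 0 ≤ K^2 * x (i+1)^2 := by positivity
      have p3 : 0 ≤ K^2 * x (i-1)^2 := by positivity
      have p4 : 0 ≤ h^2 * q i^2 := by positivity
      have r1 : -(a (i+1) - a i)/(K*h) * (h * q i * (K * x (i+1))) = -(a (i+1) - a i) * (q i * x (i+1)) := by
        by_cases hK : K = 0
        · subst hK
          have : a (i+1) - a i = 0 := by simpa using d1
          rw [this]; simp
        · field_simp
      have r2 : (a i - a (i-1))/(K*h) * (h * q i * (K * x (i-1))) = (a i - a (i-1)) * (q i * x (i-1)) := by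
        by_cases hK : K = 0
        · subst hK
          have : a i - a (i-1) = 0 := by simpa using d2
          rw [this]; simp
        · field_simp
      rw [r1] at t1
      rw [r2] at t2
      simp only [Mm]
      linarith)
  rw [SS_sub] at this
  linarith

theorem N1_symm (h : ℝ) (a b : ℤ → ℝ) (i : ℤ) : N1 h a b i = N1 h b a i := by
  unfold N1; ring

theorem energy {n : ℕ} {h K : ℝ} (h0 : 0 < h) (h1 : h ≤ 1) (K1 : 1 ≤ K) {a b U ad x y p q R1 R2 : ℤ → ℝ}
    (pa : Per n a) (pb : Per n b) (pU : Per n U) (px : Per n x) (py : Per n y) (pq : Per n q)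
    (ha : ∀ i, |a i| ≤ K) (hb : ∀ i, |b i| ≤ K) (hU : ∀ i, |U i| ≤ K) (had : ∀ i, |ad i| ≤ K)
    (da : ∀ i, |a (i+1) - a i| ≤ K * h) (db : ∀ i, |b (i+1) - b i| ≤ K * h)
    (dU : ∀ i, |U (i+1) - U i| ≤ K * h)
    (ep : ∀ i, Mm p i = -N1 h a x i - N1 h y U i - R1 i)
    (eq : ∀ i, Mm q i = -N1 h y (fun _ => 1) i - 1/2 * N1 h (fun i => b i + U i) x i - R2 i) :
    SS n (fun i => y i * Mm p i) + 1/2 * SS n (fun i => ad i * (x i * Mm x i))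
      + 1/2 * SS n (fun i => a i * (q i * Mm x i)) + 1/2 * SS n (fun i => a i * (x i * Mm q i)) ≤
      100 * K^2 * (SS n (fun i => y i^2) + SS n (fun i => x i^2) + SS n (fun i => R1 i^2) + SS n (fun i => R2 i^2)) := by
  have K0 : 0 ≤ K := by linarith
  have pbU : Per n (fun i => b i + U i) := pb.add pU
  have hbU : ∀ i, |b i + U i| ≤ 2 * K := fun i => by
    have := hb i
    have := hU i
    rw [abs_le] at *; constructor <;> linarith
  have dbU : ∀ i, |b (i+1) + U (i+1) - (b i + U i)| ≤ 2 * K * h := fun i => by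
    have := db i
    have := dU i
    rw [abs_le] at *; constructor <;> linarith
  have Kh : 0 ≤ K * h := by positivity
  have A1 := L1 h0 pa px py da
  have A2 := T3 (v := fun _ => 1) h0 (fun _ => rfl) pU py (fun _ => by rwa [abs_one]) hU (fun _ => by simpa using Kh) dU
  have A3 := T3 (K := 2*K) (v := a) h0 pa pbU px (fun i => (ha i).trans (by linarith)) hbU
    (fun i => (da i).trans (by linarith)) dbU
  have A4 : SS n (fun i => -(y i * R1 i) - a i * (x i * R2 i)) ≤ 1/2 * SS n (fun i => y i^2) + 1/2 * SS n (fun i => R1 i^2)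
     + K/2 * SS n (fun i => x i^2) + K/2 * SS n (fun i => R2 i^2) := by
    rw [← SS_mul, ← SS_mul, ← SS_mul, ← SS_mul, ← SS_add, ← SS_add, ← SS_add]
    refine SS_le fun i => ?_
    have := ab_le (x := x i) (y := R2 i) (c := -a i) (C := K) (by rw [abs_neg]; exact ha i) le_rfl le_rfl
    nlinarith [sq_nonneg (y i + R1 i)]
  have E : SS n (fun i => y i * Mm p i) + SS n (fun i => a i * (x i * Mm q i)) =
     SS n (fun i => -(y i * N1 h a x i + a i * (x i * N1 h y (fun _ => 1) i))) +
     SS n (fun i => -(1 * (y i * N1 h U y i))) + 1/2 * SS n (fun i => -(a i * (x i * N1 h (fun i => b i + U i) x i)))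
     + SS n (fun i => -(y i * R1 i) - a i * (x i * R2 i)) := by
    rw [← SS_mul, ← SS_add, ← SS_add, ← SS_add, ← SS_add]
    congr 1
    funext i
    rw [ep, eq, N1_symm h U y]; ring
  have A5 : SS n (fun i => ad i * (x i * Mm x i)) ≤ 3 * K * SS n (fun i => x i^2) := by
    refine SS_nb (G := fun _ => 0) (fun _ => rfl) px.sq fun i => ?_
    have := ab_le (x := x i) (y := x i) (had i) le_rfl le_rfl
    have := ab_le (x := x i) (y := x (i+1)) (had i) le_rfl le_rfl
    have := ab_le (x := x i) (y := x (i-1)) (had i) le_rfl le_rfl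
    have p1 : 0 ≤ K * x i^2 := by positivity
    have p2 : 0 ≤ K * x (i+1)^2 := by positivity
    have p3 : 0 ≤ K * x (i-1)^2 := by positivity
    simp only [Mm]
    linarith
  have A6 := comm_bd h0 pa px pq da
  have A7 := M_inv (pq.cmul h)
  have B1 := N1_sqS (w := fun _ => 1) (W := 1) h0 py (fun _ => by simp)
  have B2 := N1_sqS (w := fun i => b i + U i) h0 px hbU
  have A8 : SS n (fun i => Mm (fun j => h * q j) i^2) ≤ 3 * SS n (fun i => (h * N1 h (fun _ => 1) y i)^2)
      + 3/4 * SS n (fun i => (h * N1 h (fun i => b i + U i) x i)^2) + 3 * SS n (fun i => R2 i^2) := by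
    rw [← SS_mul, ← SS_mul, ← SS_mul, ← SS_add, ← SS_add]
    refine SS_le fun i => ?_
    have e : Mm (fun j => h * q j) i = -(h * N1 h (fun _ => 1) y i) - 1/2 * (h * N1 h (fun i => b i + U i) x i) - h * R2 i := by
      have := eq i
      rw [N1_symm h y] at this
      calc _ = h * Mm q i := by unfold Mm; ring
        _ = _ := by rw [this]; ring
    rw [e]
    have hR : (h * R2 i)^2 ≤ R2 i^2 := by
      rw [mul_pow]; exact mul_le_of_le_one_left (sq_nonneg _) (pow_le_one₀ h0.le h1)
    set A := h * N1 h (fun _ => 1) y i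
    set B := h * N1 h (fun i => b i + U i) x i
    nlinarith [sq_nonneg (A - 1/2*B), sq_nonneg (A - h * R2 i), sq_nonneg (1/2 * B - h * R2 i)]
  have KK : K ≤ K^2 := by nlinarith
  have K2 : 1 ≤ K^2 := by nlinarith
  have Y0 : 0 ≤ SS n (fun i => y i^2) := SS_nonneg fun i => sq_nonneg _
  have X0 : 0 ≤ SS n (fun i => x i^2) := SS_nonneg fun i => sq_nonneg _
  have R10 : 0 ≤ SS n (fun i => R1 i^2) := SS_nonneg fun i => sq_nonneg _
  have R20 : 0 ≤ SS n (fun i => R2 i^2) := SS_nonneg fun i => sq_nonneg _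
  rw [SS_add] at A1
  set Y := SS n (fun i => y i^2)
  set X := SS n (fun i => x i^2)
  set r1 := SS n (fun i => R1 i^2)
  set r2 := SS n (fun i => R2 i^2)
  have k1 := mul_le_mul_of_nonneg_right KK X0
  have k2 := mul_le_mul_of_nonneg_right KK Y0
  have k3 := mul_le_mul_of_nonneg_right KK R20
  have m1 := mul_le_mul_of_nonneg_right K2 X0
  have m2 := mul_le_mul_of_nonneg_right K2 Y0
  have m3 := mul_le_mul_of_nonneg_right K2 R20
  have m4 := mul_le_mul_of_nonneg_right K2 R10
  linarith

end

section
open Set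

theorem SS_single {n : ℕ} (hn : 0 < n) {f : ℤ → ℝ} (pf : Per n f) (h0 : ∀ i, 0 ≤ f i) (i : ℤ) : f i ≤ SS n f := by
  have hp : Function.Periodic f (n:ℤ) := pf
  have h1 : f (i % n) = f i := by
    rw [Int.emod_def]
    have := hp.sub_zsmul_eq (x := i) (i / n)
    simpa [mul_comm] using this
  have a1 := Int.emod_nonneg i (show (n:ℤ) ≠ 0 by omega)
  have a2 := Int.emod_lt_of_pos i (show 0 < (n:ℤ) by omega)
  rw [← h1]
  have h2 : ((i % n).toNat : ℤ) = i % n := Int.toNat_of_nonneg a1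
  have := Finset.single_le_sum (s := Finset.range n) (f := fun k : ℕ => f k) (fun k _ => h0 k)
    (a := (i % n).toNat) (by rw [Finset.mem_range]; omega)
  simp only [h2] at this
  exact this

theorem SS_const {n : ℕ} {f : ℤ → ℝ} {c : ℝ} (h : ∀ i, f i ≤ c) : SS n f ≤ n * c := by
  refine (SS_le h).trans (le_of_eq ?_)
  simp [SS]

theorem aMx_le {n : ℕ} {K : ℝ} {ad x : ℤ → ℝ} (px : Per n x) (had : ∀ i, |ad i| ≤ K) :
    SS n (fun i => ad i * (x i * Mm x i)) ≤ 3 * K * SS n (fun i => x i^2) := by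
  have K0 : 0 ≤ K := (abs_nonneg _).trans (had 0)
  refine SS_nb (G := fun _ => 0) (fun _ => rfl) px.sq fun i => ?_
  have := ab_le (x := x i) (y := x i) (had i) le_rfl le_rfl
  have := ab_le (x := x i) (y := x (i+1)) (had i) le_rfl le_rfl
  have := ab_le (x := x i) (y := x (i-1)) (had i) le_rfl le_rfl
  have p1 : 0 ≤ K * x i^2 := by positivity
  have p2 : 0 ≤ K * x (i+1)^2 := by positivity
  have p3 : 0 ≤ K * x (i-1)^2 := by positivity
  simp only [Mm]
  linarith

theorem SS_hasDeriv {n : ℕ} {f f' : ℝ → ℤ → ℝ} {s : Set ℝ} {t : ℝ}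
    (h : ∀ i, HasDerivWithinAt (fun τ => f τ i) (f' t i) s t) :
    HasDerivWithinAt (fun τ => SS n (f τ)) (SS n (f' t)) s t :=
  HasDerivWithinAt.fun_sum (fun i _ => h i)

theorem Mm_hasDeriv {f f' : ℝ → ℤ → ℝ} {s : Set ℝ} {t : ℝ}
    (h : ∀ i, HasDerivWithinAt (fun τ => f τ i) (f' t i) s t) (i : ℤ) :
    HasDerivWithinAt (fun τ => Mm (f τ) i) (Mm (f' t) i) s t := by
  unfold Mm
  exact (((h _).add ((h _).const_mul 4)).add (h _)).div_const 6

theorem E_hasDeriv {n : ℕ} {a x y ad p q : ℝ → ℤ → ℝ} {s : Set ℝ} {t : ℝ}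
    (pp : Per n (p t)) (py : Per n (y t))
    (hx : ∀ i, HasDerivWithinAt (fun τ => x τ i) (q t i) s t)
    (hy : ∀ i, HasDerivWithinAt (fun τ => y τ i) (p t i) s t)
    (ha : ∀ i, HasDerivWithinAt (fun τ => a τ i) (ad t i) s t) :
    HasDerivWithinAt (fun τ => 1/2 * (SS n (fun i => y τ i * Mm (y τ) i) + SS n (fun i => a τ i * (x τ i * Mm (x τ) i))))
     (SS n (fun i => y t i * Mm (p t) i) + 1/2 * SS n (fun i => ad t i * (x t i * Mm (x t) i))
      + 1/2 * SS n (fun i => a t i * (q t i * Mm (x t) i)) + 1/2 * SS n (fun i => a t i * (x t i * Mm (q t) i))) s t := by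
  have h1 := SS_hasDeriv (n := n) (f := fun τ i => y τ i * Mm (y τ) i) (f' := fun τ i => p τ i * Mm (y τ) i + y τ i * Mm (p τ) i)
    (s := s) (t := t) (fun i => (hy i).mul (Mm_hasDeriv hy i))
  have h2 := SS_hasDeriv (n := n) (f := fun τ i => a τ i * (x τ i * Mm (x τ) i))
    (f' := fun τ i => ad τ i * (x τ i * Mm (x τ) i) + a τ i * (q τ i * Mm (x τ) i + x τ i * Mm (q τ) i))
    (s := s) (t := t) (fun i => (ha i).mul ((hx i).mul (Mm_hasDeriv hx i)))
  refine ((h1.add h2).const_mul (1/2)).congr_deriv ?_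
  simp only [SS_add, mul_add, M_symm pp py]
  ring

structure Dat (T K α h : ℝ) (n : ℕ) (a b ad bd Γ U Γd Ud : ℝ → ℤ → ℝ) : Prop where
  pa : ∀ t ∈ Icc 0 T, Per n (a t)
  pb : ∀ t ∈ Icc 0 T, Per n (b t)
  pad : ∀ t ∈ Icc 0 T, Per n (ad t)
  pbd : ∀ t ∈ Icc 0 T, Per n (bd t)
  pG : ∀ t ∈ Icc 0 T, Per n (Γ t)
  pU : ∀ t ∈ Icc 0 T, Per n (U t)
  pGd : ∀ t ∈ Icc 0 T, Per n (Γd t)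
  pUd : ∀ t ∈ Icc 0 T, Per n (Ud t)
  da : ∀ t ∈ Icc 0 T, ∀ i, HasDerivWithinAt (fun τ => a τ i) (ad t i) (Icc 0 T) t
  db : ∀ t ∈ Icc 0 T, ∀ i, HasDerivWithinAt (fun τ => b τ i) (bd t i) (Icc 0 T) t
  dG : ∀ t ∈ Icc 0 T, ∀ i, HasDerivWithinAt (fun τ => Γ τ i) (Γd t i) (Icc 0 T) t
  dU : ∀ t ∈ Icc 0 T, ∀ i, HasDerivWithinAt (fun τ => U τ i) (Ud t i) (Icc 0 T) t
  ba : ∀ t ∈ Icc 0 T, ∀ i, |a t i| ≤ K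
  bb : ∀ t ∈ Icc 0 T, ∀ i, |b t i| ≤ K
  bad : ∀ t ∈ Icc 0 T, ∀ i, |ad t i| ≤ K
  ga : ∀ t ∈ Icc 0 T, ∀ i, |a t (i+1) - a t i| ≤ K * h
  gb : ∀ t ∈ Icc 0 T, ∀ i, |b t (i+1) - b t i| ≤ K * h
  low : ∀ t ∈ Icc 0 T, ∀ i, α ≤ a t i
  r1 : ∀ t ∈ Icc 0 T, ∀ i, |Mm (ad t) i + N1 h (a t) (b t) i| ≤ K * h^3
  r2 : ∀ t ∈ Icc 0 T, ∀ i, |Mm (bd t) i + N1 h (a t) (fun _ => 1) i + 1/2 * N1 h (b t) (b t) i| ≤ K * h^3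
  g1 : ∀ t ∈ Icc 0 T, ∀ i, Mm (Γd t) i + N1 h (Γ t) (U t) i = 0
  g2 : ∀ t ∈ Icc 0 T, ∀ i, Mm (Ud t) i + N1 h (Γ t) (fun _ => 1) i + 1/2 * N1 h (U t) (U t) i = 0
  i1 : ∀ i, |Mm (fun j => Γ 0 j - a 0 j) i| ≤ K * h^3
  i2 : ∀ i, |Mm (fun j => U 0 j - b 0 j) i| ≤ K * h^3

theorem sq_le_of_abs {x y : ℝ} (h : |x| ≤ y) : x^2 ≤ y^2 := sq_le_sq' (abs_le.1 h).1 (abs_le.1 h).2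

theorem boot {T K α : ℝ} (hT : 0 < T) (K1 : 1 ≤ K) (hα : 0 < α) :
    ∃ C h0 : ℝ, 0 < h0 ∧ ∀ n : ℕ, ∀ h : ℝ, 0 < h → h ≤ h0 → h * n = 2 → ∀ a b ad bd Γ U Γd Ud,
      Dat T K α h n a b ad bd Γ U Γd Ud → ∀ t ∈ Icc 0 T, ∀ i, |Γ t i - a t i| ≤ C * h^2 ∧ |U t i - b t i| ≤ C * h^2 := by
  set β := min (1/6) (α/12) with hβ
  have β0 : 0 < β := by rw [hβ]; positivity
  set D := 54 * K^3 + 4 * K^2 + 1 with hD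
  have D0 : 0 < D := by positivity
  set Λ := 100 * (K+1)^2 * (1/β + 1) + 1 with hΛ
  have Λ0 : 0 < Λ := by positivity
  set Q := D * Real.exp (Λ*T) / β with hQ
  have Q0 : 0 < Q := by positivity
  have K0 : 0 ≤ K := by linarith
  refine ⟨Real.sqrt Q, min 1 (min (α/K) (1/(4*Q))), by positivity, ?_⟩
  intro n h h0 hh hn a b ad bd Γ U Γd Ud d
  have h1 : h ≤ 1 := hh.trans (min_le_left _ _)
  have hα' : K * h ≤ α := by
    have := (hh.trans (min_le_right _ _)).trans (min_le_left _ _)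
    rw [le_div_iff₀ (by linarith)] at this; linarith
  have hQ' : Q * h ≤ 1/4 := by
    have := (hh.trans (min_le_right _ _)).trans (min_le_right _ _)
    rw [le_div_iff₀ (by positivity)] at this; linarith
  have n0 : 0 < n := by
    rcases Nat.eq_zero_or_pos n with h | h
    · subst h; simp at hn
    · exact h
  set y : ℝ → ℤ → ℝ := fun t i => Γ t i - a t i with hy
  set x : ℝ → ℤ → ℝ := fun t i => U t i - b t i with hx
  set p : ℝ → ℤ → ℝ := fun t i => Γd t i - ad t i with hp
  set q : ℝ → ℤ → ℝ := fun t i => Ud t i - bd t i with hq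
  have py : ∀ t ∈ Icc 0 T, Per n (y t) := fun t ht => (d.pG t ht).sub (d.pa t ht)
  have px : ∀ t ∈ Icc 0 T, Per n (x t) := fun t ht => (d.pU t ht).sub (d.pb t ht)
  have pp : ∀ t ∈ Icc 0 T, Per n (p t) := fun t ht => (d.pGd t ht).sub (d.pad t ht)
  have pq : ∀ t ∈ Icc 0 T, Per n (q t) := fun t ht => (d.pUd t ht).sub (d.pbd t ht)
  set E : ℝ → ℝ := fun τ => 1/2 * (SS n (fun i => y τ i * Mm (y τ) i) + SS n (fun i => a τ i * (x τ i * Mm (x τ) i))) with hE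
  have hEd : ∀ t ∈ Icc 0 T, HasDerivWithinAt E (SS n (fun i => y t i * Mm (p t) i) + 1/2 * SS n (fun i => ad t i * (x t i * Mm (x t) i))
      + 1/2 * SS n (fun i => a t i * (q t i * Mm (x t) i)) + 1/2 * SS n (fun i => a t i * (x t i * Mm (q t) i))) (Icc 0 T) t :=
    fun t ht => E_hasDeriv (pp t ht) (py t ht) (fun i => (d.dU t ht i).sub (d.db t ht i))
      (fun i => (d.dG t ht i).sub (d.da t ht i)) (d.da t ht)
  have hlowE : ∀ t ∈ Icc 0 T, β * (SS n (fun i => y t i^2) + SS n (fun i => x t i^2)) ≤ E t := by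
    intro t ht
    have e1 := M_pos (py t ht)
    have e2 := M_pos_w (d.pa t ht) (px t ht) (d.low t ht) hα.le (d.ga t ht) hα'
    have b1 : β ≤ 1/6 := min_le_left _ _
    have b2 : β ≤ α/12 := min_le_right _ _
    have Y0 : 0 ≤ SS n (fun i => y t i^2) := SS_nonneg fun i => sq_nonneg _
    have X0 : 0 ≤ SS n (fun i => x t i^2) := SS_nonneg fun i => sq_nonneg _
    have := mul_le_mul_of_nonneg_right b1 Y0
    have := mul_le_mul_of_nonneg_right b2 X0
    simp only [hE]
    linarith
  have hnh : (n:ℝ) * h^6 = 2 * h^5 := by rw [← hn]; ring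
  have m0 : (0:ℝ) ∈ Icc 0 T := ⟨le_rfl, hT.le⟩
  have hrow : ∀ f : ℤ → ℝ, (∀ i, |f i| ≤ K * h^3) → SS n (fun i => f i^2) ≤ 2 * K^2 * h^5 := by
    intro f hf
    refine (SS_const fun i => sq_le_of_abs (hf i)).trans (le_of_eq ?_)
    linear_combination K^2 * hnh
  have hE0 : E 0 ≤ D * h^5 := by
    have e1 := aMx_le (ad := fun _ => 1) (K := 1) (py 0 m0) (fun _ => by simp)
    have e2 := aMx_le (px 0 m0) (d.ba 0 m0)
    have f1 := (M_inv (py 0 m0)).trans (mul_le_mul_of_nonneg_left (hrow _ d.i1) (by norm_num))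
    have f2 := (M_inv (px 0 m0)).trans (mul_le_mul_of_nonneg_left (hrow _ d.i2) (by norm_num))
    simp only [one_mul] at e1
    simp only [hE, hD]
    have f2' := mul_le_mul_of_nonneg_left f2 K0
    have q1 : K^2*h^5 ≤ K^3*h^5 := by
      gcongr
      norm_num
    have q2 : 0 ≤ K^2 * h^5 := by positivity
    have q3 : 0 ≤ h^5 := by positivity
    linarith
  have hsmall : ∀ t ∈ Icc 0 T, E t ≤ D * h^5 * Real.exp (Λ * t) → ∀ i, y t i^2 ≤ Q * h^5 ∧ x t i^2 ≤ Q * h^5 := by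
    intro t ht hEt i
    have l := hlowE t ht
    have Y0 : 0 ≤ SS n (fun i => y t i^2) := SS_nonneg fun i => sq_nonneg _
    have X0 : 0 ≤ SS n (fun i => x t i^2) := SS_nonneg fun i => sq_nonneg _
    have ex : Real.exp (Λ * t) ≤ Real.exp (Λ*T) := Real.exp_le_exp.2 (by have := ht.2; gcongr)
    have : SS n (fun i => y t i^2) + SS n (fun i => x t i^2) ≤ Q * h^5 := by
      rw [hQ, div_mul_eq_mul_div, le_div_iff₀ β0]
      have : D * h^5 * Real.exp (Λ * t) ≤ D * h^5 * Real.exp (Λ * T) := by gcongr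
      linarith
    have s1 := SS_single n0 (py t ht).sq (fun i => sq_nonneg _) i
    have s2 := SS_single n0 (px t ht).sq (fun i => sq_nonneg _) i
    constructor <;> linarith
  have main : ∀ t ∈ Icc 0 T, E t ≤ D * h^5 * Real.exp (Λ * t) := by
    refine image_le_of_deriv_right_lt_deriv_boundary' (B' := fun t => D * h^5 * (Real.exp (Λ*t) * (Λ*1)))
      (fun t ht => (hEd t ht).continuousWithinAt)
      (fun t ht => (hEd t (Ico_subset_Icc_self ht)).mono_of_mem_nhdsWithin (Icc_mem_nhdsGE_of_mem ht)) ?_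
      (by fun_prop) (fun t ht => ?_) ?_
    · simpa using hE0
    · exact ((((hasDerivAt_id t).const_mul Λ).exp).const_mul _).hasDerivWithinAt
    · intro t ht' hEB
      have ht := Ico_subset_Icc_self ht'
      have sm := hsmall t ht hEB.le
      have hx2 : ∀ i, |x t i| ≤ h/2 := by
        intro i
        apply abs_le_of_sq_le_sq _ (by positivity)
        refine (sm i).2.trans ?_
        have : h^4 ≤ h^2 := pow_le_pow_of_le_one h0.le h1 (by norm_num)
        have := mul_le_mul_of_nonneg_right hQ' (show 0 ≤ h^4 by positivity)
        linarith
      have hUe : ∀ i, U t i = b t i + x t i := fun i => by simp [hx]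
      have en := energy (K := K+1) (n := n) (a := a t) (b := b t) (U := U t) (ad := ad t) (x := x t) (y := y t) (p := p t) (q := q t)
        (R1 := fun i => Mm (ad t) i + N1 h (a t) (b t) i)
        (R2 := fun i => Mm (bd t) i + N1 h (a t) (fun _ => 1) i + 1/2 * N1 h (b t) (b t) i)
        h0 h1 (by linarith) (d.pa t ht) (d.pb t ht) (d.pU t ht) (px t ht) (py t ht) (pq t ht)
        (fun i => (d.ba t ht i).trans (by linarith)) (fun i => (d.bb t ht i).trans (by linarith))
        (fun i => by
          have := d.bb t ht i
          have := hx2 i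
          rw [hUe]
          rw [abs_le] at *
          constructor <;> linarith) (fun i => (d.bad t ht i).trans (by linarith))
        (fun i => (d.ga t ht i).trans (by nlinarith)) (fun i => (d.gb t ht i).trans (by nlinarith))
        (fun i => by
          have := d.gb t ht i
          have := hx2 i
          have := hx2 (i+1)
          rw [hUe, hUe]
          rw [abs_le] at *
          constructor <;> linarith)
        (fun i => by
          have := d.g1 t ht i
          simp only [hp, hy, hx, Mm, N1] at *
          linear_combination this)
        (fun i => by
          have := d.g2 t ht i
          simp only [hq, hy, hx, Mm, N1] at *
          linear_combination this)
      have s1 := hrow _ (d.r1 t ht)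
      have s2 := hrow _ (d.r2 t ht)
      refine en.trans_lt ?_
      have l := hlowE t ht
      rw [hEB] at l
      set B := D * h^5 * Real.exp (Λ * t) with hB
      have B0 : 0 < B := by positivity
      have l' : SS n (fun i => y t i^2) + SS n (fun i => x t i^2) ≤ 1/β * B := by
        rw [one_div, inv_mul_eq_div, le_div_iff₀ β0]; linarith
      have e1 : 1 ≤ Real.exp (Λ * t) := Real.one_le_exp (by have := ht.1; positivity)
      have l2 : 4 * K^2 * h^5 ≤ B := by
        have : D * h^5 ≤ B := le_mul_of_one_le_right (by positivity) e1
        have : 4 * K^2 * h^5 ≤ D * h^5 := by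
          gcongr
          have : 0 ≤ K^3 := by positivity
          rw [hD]; linarith
        linarith
      calc _ ≤ 100 * (K+1)^2 * (1/β * B + B) := by
            apply mul_le_mul_of_nonneg_left _ (by positivity)
            linarith
        _ < Λ * B := by rw [hΛ]; nlinarith
        _ = _ := by rw [hB]; ring
  intro t ht i
  have sm := hsmall t ht (main t ht) i
  have h5 : Q * h^5 ≤ (Real.sqrt Q * h^2)^2 := by
    rw [mul_pow, Real.sq_sqrt Q0.le, ← pow_mul]
    have : h^5 ≤ h^4 := pow_le_pow_of_le_one h0.le h1 (by norm_num)
    gcongr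
  exact ⟨abs_le_of_sq_le_sq (sm.1.trans h5) (by positivity), abs_le_of_sq_le_sq (sm.2.trans h5) (by positivity)⟩

end

section
open Set

def QA (f : ℝ → ℝ) (K : ℝ) : Prop := ∀ c h : ℝ, 0 < h → h ≤ 1 → ∃ q0 q1 q2 : ℝ, |q0| ≤ K ∧ |q1| ≤ K ∧ |q2| ≤ K ∧
  ∀ s, |s| ≤ h → |f (c+s) - (q0 + q1*s + q2*s^2)| ≤ K * h^3

theorem qa_pos {f : ℝ → ℝ} {M : ℝ} (h3 : DB 3 f M) {c h s : ℝ} (hs : 0 < s) (hsh : s < h) :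
    |f (c+s) - (f c + (f (c+h) - f (c-h))/(2*h)*s + (f (c+h) - 2*f c + f (c-h))/(2*h^2)*s^2)| ≤ M * h^3 := by
  have hh : 0 < h := hs.trans hsh
  set p : ℕ → ℝ := fun i => match i with | 0 => c - h | 1 => c | 2 => c + s | _ => c + h with hp
  have := h3 p (by
    intro i hi
    interval_cases i <;> simp [hp] <;> linarith)
  have e : dd p (fun i => f (p i)) 3 0 * ((s+h)*s*(s-h)) =
      f (c+s) - (f c + (f (c+h) - f (c-h))/(2*h)*s + (f (c+h) - 2*f c + f (c-h))/(2*h^2)*s^2) := by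
    have q0 : p 0 = c - h := rfl
    have q1 : p 1 = c := rfl
    have q2 : p 2 = c + s := rfl
    have q3 : p 3 = c + h := rfl
    have n1 : h - s ≠ 0 := by linarith
    have n2 : s + h ≠ 0 := by linarith
    simp only [dd]
    norm_num [q0, q1, q2, q3]
    field_simp
    ring
  rw [← e]
  have r : |(s+h)*s*(s-h)| ≤ h^3 := by
    rw [abs_mul, abs_of_pos (by positivity : 0 < (s+h)*s), abs_of_neg (by linarith : s - h < 0)]
    nlinarith [mul_pos hs hh, mul_pos hs (sub_pos.2 hsh), pow_pos hs 3, pow_pos hh 3, mul_pos (mul_pos hs hh) hh]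
  exact abs_mul_le' this r

theorem qa_of_DB {f : ℝ → ℝ} {M : ℝ} (h0 : DB 0 f M) (h1 : DB 1 f M) (h2 : DB 2 f M) (h3 : DB 3 f M) : QA f M := by
  intro c h hh _
  have b0 : |f c| ≤ M := by
    have := h0 (fun _ => c) (fun i hi => absurd hi (by omega))
    simpa [dd] using this
  have M0 := h0.nonneg
  have hM3 : 0 ≤ M * h^3 := by positivity
  refine ⟨f c, (f (c+h) - f (c-h))/(2*h), (f (c+h) - 2*f c + f (c-h))/(2*h^2), b0, ?_, ?_, ?_⟩
  · have := h1.d1 (c-h) (c+h)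
    rw [show c + h - (c - h) = 2 * h by ring, abs_of_pos (by positivity : 0 < 2 * h)] at this
    rw [abs_div, abs_of_pos (by positivity : 0 < 2 * h), div_le_iff₀ (by positivity)]; exact this
  · have := h2.d2 c hh
    rw [abs_div, abs_of_pos (by positivity : 0 < 2 * h^2), div_le_iff₀ (by positivity)]; linarith
  · intro s hs
    have hs' := abs_le.1 hs
    rcases lt_trichotomy s 0 with hs0 | hs0 | hs0
    · rcases hs'.1.eq_or_lt with e | e
      · rw [← e]
        rw [show c + -h = c - h by ring]
        refine le_trans (le_of_eq ?_) hM3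
        rw [abs_eq_zero]; field_simp; ring
      · have := qa_pos h3.refl (c := -c) (h := h) (s := -s) (by linarith) (by linarith)
        refine le_trans (le_of_eq ?_) this
        rw [show -(-c + -s) = c + s by ring, show -(-c) = c by ring, show -(-c + h) = c - h by ring, show -(-c-h) = c + h by ring]
        congr 1; ring
    · subst hs0; simpa using hM3
    · rcases hs'.2.eq_or_lt with e | e
      · rw [e]
        refine le_trans (le_of_eq ?_) hM3
        rw [abs_eq_zero]; field_simp; ring
      · exact qa_pos h3 hs0 e

theorem QA.sq4 {f : ℝ → ℝ} {M : ℝ} (H : QA f M) (M1 : 1 ≤ M) : QA (fun x => f x ^ 2 / 4) (10 * M^2) := by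
  intro c h hh h1
  obtain ⟨q0, q1, q2, b0, b1, b2, H⟩ := H c h hh h1
  have m00 := abs_mul_le' b0 b0
  have m01 := abs_mul_le' b0 b1
  have m02 := abs_mul_le' b0 b2
  have m11 := abs_mul_le' b1 b1
  have m12 := abs_mul_le' b1 b2
  have m22 := abs_mul_le' b2 b2
  have MM : 0 ≤ M * M := by positivity
  refine ⟨q0*q0/4, q0*q1/2, q0*q2/2+q1*q1/4, ?_, ?_, ?_, ?_⟩
  · rw [abs_le] at *; constructor <;> linarith
  · rw [abs_le] at *; constructor <;> linarith
  · rw [abs_le] at *; constructor <;> linarith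
  intro s hs
  have hs2 : |s| ≤ 1 := hs.trans h1
  have e := H s hs
  have t1 := abs_mul_le' b1 hs2
  have t2 := abs_mul_le' b2 (abs_pow_le' 2 hs2)
  have bq : |q0 + q1*s + q2*s^2| ≤ 3 * M := by rw [abs_le] at *; constructor <;> linarith
  have h31 : h^3 ≤ 1 := pow_le_one₀ hh.le h1
  have hMh : M * h^3 ≤ M := mul_le_of_le_one_right (by linarith) h31
  have bf : |f (c+s)| ≤ 4 * M := by rw [abs_le] at *; constructor <;> linarith
  have P := prod_err e e bq bf
  have r3 := abs_mul_le' m12 (abs_pow_le' 3 hs)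
  have r4 := abs_mul_le' m22 (abs_pow_le' 4 hs)
  have q4 : M*M*h^4 ≤ M*M*h^3 := mul_le_mul_of_nonneg_left (pow_le_pow_of_le_one hh.le h1 (by norm_num)) MM
  have q3 : 0 ≤ M*M*h^3 := by positivity
  rw [abs_le] at *
  constructor <;> linarith

theorem QA.mono {f : ℝ → ℝ} {M K : ℝ} (H : QA f M) (hK : M ≤ K) : QA f K := by
  intro c h hh h1
  obtain ⟨q0, q1, q2, b0, b1, b2, H⟩ := H c h hh h1
  exact ⟨q0, q1, q2, b0.trans hK, b1.trans hK, b2.trans hK, fun s hs => (H s hs).trans (by gcongr)⟩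

theorem JS.mono {F F1 : ℤ → ℝ} {h M K : ℝ} {i : ℤ} {c0 c1 c2 c3 : ℝ} (h0 : 0 ≤ h)
    (H : JS F F1 h M i c0 c1 c2 c3) (hK : M ≤ K) : JS F F1 h K i c0 c1 c2 c3 :=
  ⟨H.b0.trans hK, H.b1.trans hK, H.b2.trans hK, H.b3.trans hK, fun j hj => (H.f j hj).trans (by gcongr),
   fun j hj => (H.g j hj).trans (by gcongr)⟩

theorem JS.smul {F F1 G G1 : ℤ → ℝ} {h M r : ℝ} {i : ℤ} {c0 c1 c2 c3 : ℝ}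
    (H : JS F F1 h M i c0 c1 c2 c3) (hr : |r| ≤ 1) (hG : ∀ j, G j = r * F j) (hG1 : ∀ j, G1 j = r * F1 j) :
    JS G G1 h M i (r*c0) (r*c1) (r*c2) (r*c3) := by
  have X : ∀ x y, |x| ≤ y → |r * x| ≤ y := fun x y hx => (abs_mul_le' hr hx).trans (by rw [one_mul])
  refine ⟨X _ _ H.b0, X _ _ H.b1, X _ _ H.b2, X _ _ H.b3, fun j hj => ?_, fun j hj => ?_⟩
  · have := X _ _ (H.f j hj)
    rw [hG]; refine le_trans (le_of_eq ?_) this; congr 1; ring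
  · have := X _ _ (H.g j hj)
    rw [hG1]; refine le_trans (le_of_eq ?_) this; congr 1; ring

structure Pk (T K α : ℝ) (w v w1 v1 : ℝ → ℝ → ℝ) : Prop where
  K1 : 1 ≤ K
  pw : ∀ x t, w (x+2) t = w x t
  pv : ∀ x t, v (x+2) t = v x t
  pw1 : ∀ x t, w1 (x+2) t = w1 x t
  pv1 : ∀ x t, v1 (x+2) t = v1 x t
  nw : ∀ t ∈ Icc 0 T, ∀ x, w (-x) t = w x t
  nv : ∀ t ∈ Icc 0 T, ∀ x, v (-x) t = - v x t
  jw : ∀ t ∈ Icc 0 T, ∀ h, 0 < h → h ≤ 1 → ∀ i, ∃ c0 c1 c2 c3, JS (fun j => w (j*h) t) (fun j => w1 (j*h) t) h K i c0 c1 c2 c3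
  jv : ∀ t ∈ Icc 0 T, ∀ h, 0 < h → h ≤ 1 → ∀ i, ∃ c0 c1 c2 c3, JS (fun j => v (j*h) t) (fun j => v1 (j*h) t) h K i c0 c1 c2 c3
  tw : ∀ t ∈ Icc 0 T, ∀ x, HasDerivWithinAt (fun s => w x s) (-(w1 x t * v x t + w x t * v1 x t)) (Icc 0 T) t
  tv : ∀ t ∈ Icc 0 T, ∀ x, HasDerivWithinAt (fun s => v x s) (-(w1 x t + v x t * v1 x t)) (Icc 0 T) t
  low : ∀ t ∈ Icc 0 T, ∀ x, α ≤ w x t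
  bw : ∀ t ∈ Icc 0 T, ∀ x, |w x t| ≤ K
  bv : ∀ t ∈ Icc 0 T, ∀ x, |v x t| ≤ K
  bw1 : ∀ t ∈ Icc 0 T, ∀ x, |w1 x t| ≤ K
  bv1 : ∀ t ∈ Icc 0 T, ∀ x, |v1 x t| ≤ K
  lw : ∀ t ∈ Icc 0 T, ∀ x y, |w y t - w x t| ≤ K * |y - x|
  lv : ∀ t ∈ Icc 0 T, ∀ x y, |v y t - v x t| ≤ K * |y - x|
  qw : ∀ t ∈ Icc 0 T, QA (fun x => w x t) K
  qv : ∀ t ∈ Icc 0 T, QA (fun x => v x t) K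

theorem deriv_le_lip {f : ℝ → ℝ} {f' x M : ℝ} (hd : HasDerivAt f f' x) (hl : ∀ x y, |f y - f x| ≤ M * |y - x|) (M0 : 0 ≤ M) :
    |f'| ≤ M := by
  have := hd.le_of_lip' M0 (Filter.Eventually.of_forall fun y => by simpa [Real.norm_eq_abs] using hl x y)
  simpa using this

theorem HY.pk {T α : ℝ} {ηs us : ℕ → ℝ → ℝ → ℝ} (H : HY T α ηs us) :
    ∃ K, ∃ w v w1 v1, Pk T K α w v w1 v1 ∧ ∀ t ∈ Icc 0 T, ∀ y ∈ Icc (0:ℝ) 1, w y t = 1 + ηs 0 y t ∧ v y t = us 0 y t := by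
  obtain ⟨M0, hM0⟩ := H.tdb4
  set M := max 1 M0 with hM'
  have M1 : 1 ≤ M := le_max_left _ _
  have hM : ∀ t ∈ Icc 0 T, ∀ k, k ≤ 4 → DB k (fun x => rr ηs us x t) M := fun t ht k hk => (hM0 t ht k hk).mono (le_max_right _ _)
  have hMM : M ≤ M^2 := by nlinarith
  set K := 1000 * (300*M)^2 with hK
  have hKM : 10 * M^2 ≤ K := by rw [hK]; nlinarith
  have hK2 : 2 * M ≤ K := by linarith
  have bu : ∀ t ∈ Icc 0 T, ∀ x, |uu us x t| ≤ M := fun t ht x => by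
    have := H.duu ht (hM t ht 0 (by omega)) (fun _ => x) (fun i hi => absurd hi (by omega))
    simpa [dd] using this
  have bk : ∀ t ∈ Icc 0 T, ∀ x, |kk ηs x t| ≤ M := fun t ht x => by
    have := H.dkk ht (hM t ht 0 (by omega)) (fun _ => x) (fun i hi => absurd hi (by omega))
    simpa [dd] using this
  have lu : ∀ t ∈ Icc 0 T, ∀ x y, |uu us y t - uu us x t| ≤ M * |y - x| := fun t ht x y =>
    (H.duu ht (hM t ht 1 (by omega))).d1 x y
  have lk : ∀ t ∈ Icc 0 T, ∀ x y, |kk ηs y t - kk ηs x t| ≤ M * |y - x| := fun t ht x y =>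
    (H.dkk ht (hM t ht 1 (by omega))).d1 x y
  have bu1 : ∀ t ∈ Icc 0 T, ∀ x, |ex 1 (Dk 1 (vel us t)) x| ≤ M := fun t ht x =>
    deriv_le_lip (H.uud ht x) (lu t ht) (by linarith)
  have bk1 : ∀ t ∈ Icc 0 T, ∀ x, |ex (-1) (Dk 1 (kap ηs t)) x| ≤ M := fun t ht x =>
    deriv_le_lip (H.kkd ht x) (lk t ht) (by linarith)
  refine ⟨K, fun x t => (kk ηs x t)^2/4, uu us, fun x t => kk ηs x t * ex (-1) (Dk 1 (kap ηs t)) x / 2,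
    fun x t => ex 1 (Dk 1 (vel us t)) x, ⟨by linarith, fun x t => by simp only [HY.kk_per], fun x t => HY.uu_per x t,
      fun x t => by simp only [HY.kk_per, ex_per], fun x t => ex_per _ _ _, fun t ht x => by simp only [H.kk_neg ht],
      fun t ht x => H.uu_neg ht x, ?_, ?_, ?_, ?_, ?_, ?_, ?_, ?_, ?_, ?_, ?_, ?_, ?_⟩, ?_⟩
  · intro t ht h h0 h1 i
    obtain ⟨c0, c1, c2, c3, J⟩ := (jet_of_DB (fun k hk => H.dkk ht (hM t ht k hk)) (H.kkd ht) h0 h1 (i*h)).js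
    exact ⟨_, _, _, _, (J.mul h0.le h1 J).smul (r := 1/4) (by norm_num [abs_of_pos]) (fun j => by ring) (fun j => by ring)⟩
  · intro t ht h h0 h1 i
    obtain ⟨c0, c1, c2, c3, J⟩ := (jet_of_DB (fun k hk => H.duu ht (hM t ht k hk)) (H.uud ht) h0 h1 (i*h)).js
    exact ⟨_, _, _, _, J.mono h0.le (by rw [hK]; nlinarith)⟩
  · intro t ht x
    have hr := red_mem x
    unfold kk uu ex
    split_ifs with h0
    · refine ((((H.dtk ht (y := red x) ⟨h0, hr.2.le⟩).pow 2).div_const 4)).congr_deriv ?_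
      push_cast; ring
    · refine (((((H.dtk ht (y := -red x) ⟨by linarith, by linarith⟩).const_mul 1).pow 2).div_const 4)).congr_deriv ?_
      push_cast; ring
  · intro t ht x
    have hr := red_mem x
    unfold kk uu ex
    split_ifs with h0
    · exact (H.dtu ht (y := red x) ⟨h0, hr.2.le⟩)
    · refine ((H.dtu ht (y := -red x) ⟨by linarith, by linarith⟩).const_mul (-1)).congr_deriv ?_
      ring
  · intro t ht x
    have hr := red_mem x
    have : ∀ y ∈ II, α ≤ kap ηs t y^2/4 := fun y hy => by
      have := H.ke ht hy
      have := H.hlow y hy t ht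
      linarith
    unfold kk ex
    split_ifs with h0
    · exact this _ ⟨h0, hr.2.le⟩
    · have := this (-red x) ⟨by linarith, by linarith⟩
      linarith
  · intro t ht x
    have := sq_le_of_abs (bk t ht x)
    rw [abs_of_nonneg (by positivity)]
    linarith
  · intro t ht x
    exact (bu t ht x).trans (by linarith)
  · intro t ht x
    have := abs_mul_le' (bk t ht x) (bk1 t ht x)
    rw [abs_div, abs_of_pos (by norm_num : (0:ℝ) < 2)]
    nlinarith
  · intro t ht x
    exact (bu1 t ht x).trans (by linarith)
  · intro t ht x y
    have e : kk ηs y t^2/4 - kk ηs x t^2/4 = (kk ηs y t + kk ηs x t)/4 * (kk ηs y t - kk ηs x t) := by ring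
    rw [e]
    have b1 := bk t ht x
    have b2 := bk t ht y
    have := abs_mul_le' (a := (kk ηs y t + kk ηs x t)/4) (A := M) (by rw [abs_le] at *; constructor <;> linarith) (lk t ht x y)
    refine this.trans ?_
    have : M * M ≤ K := by nlinarith
    rw [← mul_assoc]; gcongr
  · intro t ht x y
    refine (lu t ht x y).trans ?_
    gcongr; linarith
  · intro t ht
    have Q := (qa_of_DB (H.dkk ht (hM t ht 0 (by omega))) (H.dkk ht (hM t ht 1 (by omega))) (H.dkk ht (hM t ht 2 (by omega))) (H.dkk ht (hM t ht 3 (by omega)))).sq4 M1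
    exact Q.mono hKM
  · intro t ht
    exact (qa_of_DB (H.duu ht (hM t ht 0 (by omega))) (H.duu ht (hM t ht 1 (by omega))) (H.duu ht (hM t ht 2 (by omega))) (H.duu ht (hM t ht 3 (by omega)))).mono (by linarith)
  · intro t ht y hy
    constructor
    · have := H.ke ht hy
      have e : kk ηs y t = kap ηs t y := ex_mem (by simp) hy
      simp only [e]; linarith
    · exact ex_mem (by rw [H.u1 ht]; simp) hy

end

section
open Set

structure Cmp (T K α h : ℝ) (n : ℕ) (a b ad bd : ℝ → ℤ → ℝ) : Prop where
  pa : ∀ t ∈ Icc 0 T, Per n (a t)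
  pb : ∀ t ∈ Icc 0 T, Per n (b t)
  pad : ∀ t ∈ Icc 0 T, Per n (ad t)
  pbd : ∀ t ∈ Icc 0 T, Per n (bd t)
  da : ∀ t ∈ Icc 0 T, ∀ i, HasDerivWithinAt (fun τ => a τ i) (ad t i) (Icc 0 T) t
  db : ∀ t ∈ Icc 0 T, ∀ i, HasDerivWithinAt (fun τ => b τ i) (bd t i) (Icc 0 T) t
  ba : ∀ t ∈ Icc 0 T, ∀ i, |a t i| ≤ K
  bb : ∀ t ∈ Icc 0 T, ∀ i, |b t i| ≤ K
  bad : ∀ t ∈ Icc 0 T, ∀ i, |ad t i| ≤ K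
  ga : ∀ t ∈ Icc 0 T, ∀ i, |a t (i+1) - a t i| ≤ K * h
  gb : ∀ t ∈ Icc 0 T, ∀ i, |b t (i+1) - b t i| ≤ K * h
  low : ∀ t ∈ Icc 0 T, ∀ i, α ≤ a t i
  r1 : ∀ t ∈ Icc 0 T, ∀ i, |Mm (ad t) i + N1 h (a t) (b t) i| ≤ K * h^3
  r2 : ∀ t ∈ Icc 0 T, ∀ i, |Mm (bd t) i + N1 h (a t) (fun _ => 1) i + 1/2 * N1 h (b t) (b t) i| ≤ K * h^3

structure Gal (T h : ℝ) (n : ℕ) (Γ U Γd Ud : ℝ → ℤ → ℝ) : Prop where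
  pG : ∀ t ∈ Icc 0 T, Per n (Γ t)
  pU : ∀ t ∈ Icc 0 T, Per n (U t)
  pGd : ∀ t ∈ Icc 0 T, Per n (Γd t)
  pUd : ∀ t ∈ Icc 0 T, Per n (Ud t)
  dG : ∀ t ∈ Icc 0 T, ∀ i, HasDerivWithinAt (fun τ => Γ τ i) (Γd t i) (Icc 0 T) t
  dU : ∀ t ∈ Icc 0 T, ∀ i, HasDerivWithinAt (fun τ => U τ i) (Ud t i) (Icc 0 T) t
  g1 : ∀ t ∈ Icc 0 T, ∀ i, Mm (Γd t) i + N1 h (Γ t) (U t) i = 0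
  g2 : ∀ t ∈ Icc 0 T, ∀ i, Mm (Ud t) i + N1 h (Γ t) (fun _ => 1) i + 1/2 * N1 h (U t) (U t) i = 0

theorem cf_bd {f : ℤ → ℝ} {K : ℝ} (h : ∀ i, |f i| ≤ K) (i : ℤ) : |cf f i| ≤ 2 * K := by
  have h1 := h i
  have h2 := h (i+1)
  have h3 := h (i-1)
  unfold cf del2
  rw [abs_le] at *; constructor <;> linarith

theorem cf_dif {f : ℤ → ℝ} {K : ℝ} (h : ∀ i, |f (i+1) - f i| ≤ K) (i : ℤ) : |cf f (i+1) - cf f i| ≤ 2 * K := by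
  have h1 := h i
  have h2 := h (i+1)
  have h3 := h (i-1)
  unfold cf del2
  rw [show i - 1 + 1 = i by ring] at h3
  rw [show i + 1 - 1 = i by ring]
  rw [abs_le] at *; constructor <;> linarith

theorem cf_near {f : ℤ → ℝ} {K : ℝ} (h : ∀ i, |f (i+1) - f i| ≤ K) (i : ℤ) : |cf f i - f i| ≤ K := by
  have h1 := h i
  have h3 := h (i-1)
  unfold cf del2
  rw [show i - 1 + 1 = i by ring] at h3
  rw [abs_le] at *; constructor <;> linarith

theorem cf_per {n : ℕ} {f : ℤ → ℝ} (h : Per n f) : Per n (cf f) := fun i => by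
  unfold cf del2
  rw [h i, h.e (show i + n + 1 = i + 1 + n by ring), h.e (show i + n - 1 = i - 1 + n by ring)]

theorem cf_deriv {f f' : ℝ → ℤ → ℝ} {s : Set ℝ} {t : ℝ} (h : ∀ i, HasDerivWithinAt (fun τ => f τ i) (f' t i) s t) (i : ℤ) :
    HasDerivWithinAt (fun τ => cf (f τ) i) (cf (f' t) i) s t := by
  unfold cf del2
  refine ((h i).sub (((((h (i+1)).sub ((h i).const_mul 2)).add (h (i-1)))).div_const 12)).congr_deriv ?_
  ring

theorem Mm_cf_neg (f : ℤ → ℝ) (i : ℤ) : Mm (cf (fun j => -f j)) i = - Mm (cf f) i := by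
  unfold Mm cf del2; ring

theorem js_one {h K : ℝ} (h0 : 0 ≤ h) (K1 : 1 ≤ K) (i : ℤ) : JS (fun _ => 1) (fun _ => 0) h K i 1 0 0 0 := by
  refine ⟨by simpa using K1, by simp; linarith, by simp; linarith, by simp; linarith, fun j _ => ?_, fun j _ => ?_⟩
  · simp; positivity
  · simp; positivity

theorem per_nodes {f : ℝ → ℝ} (hf : ∀ x, f (x+2) = f x) {h : ℝ} {n : ℕ} (hn : h * n = 2) : Per n (fun j : ℤ => f (j*h)) := fun i => by
  show f _ = f _
  rw [← hf (i*h), ← hn]; push_cast; ring_nf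

theorem Pk.cmp {T K α : ℝ} {w v w1 v1 : ℝ → ℝ → ℝ} (P : Pk T K α w v w1 v1) (hα : 0 < α) {h : ℝ} {n : ℕ} (h0 : 0 < h) (h1 : h ≤ 1)
    (hs : K * h ≤ α/2) (hn : h * n = 2) :
    Cmp T (5000*K^2) (α/2) h n (fun t => cf (fun j => w (j*h) t)) (fun t => cf (fun j => v (j*h) t))
     (fun t => cf (fun j => -(w1 (j*h) t * v (j*h) t + w (j*h) t * v1 (j*h) t))) (fun t => cf (fun j => -(w1 (j*h) t + v (j*h) t * v1 (j*h) t))) := by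
  have K1 := P.K1
  have KK : K ≤ K^2 := by nlinarith
  have gw : ∀ t ∈ Icc 0 T, ∀ i : ℤ, |w ((i+1:ℤ)*h) t - w (i*h) t| ≤ K * h := fun t ht i => by
    have := P.lw t ht (i*h) ((i+1:ℤ)*h)
    rwa [show ((i+1:ℤ):ℝ)*h - i*h = h by push_cast; ring, abs_of_pos h0] at this
  have gv : ∀ t ∈ Icc 0 T, ∀ i : ℤ, |v ((i+1:ℤ)*h) t - v (i*h) t| ≤ K * h := fun t ht i => by
    have := P.lv t ht (i*h) ((i+1:ℤ)*h)
    rwa [show ((i+1:ℤ):ℝ)*h - i*h = h by push_cast; ring, abs_of_pos h0] at this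
  refine ⟨?_, ?_, ?_, ?_, ?_, ?_, ?_, ?_, ?_, ?_, ?_, ?_, ?_, ?_⟩
  · exact fun t ht => cf_per (per_nodes (f := fun x => w x t) (fun x => P.pw x t) hn)
  · exact fun t ht => cf_per (per_nodes (f := fun x => v x t) (fun x => P.pv x t) hn)
  · exact fun t ht => cf_per (per_nodes (f := fun x => -(w1 x t * v x t + w x t * v1 x t)) (fun x => by simp only [P.pw, P.pv, P.pw1, P.pv1]) hn)
  · exact fun t ht => cf_per (per_nodes (f := fun x => -(w1 x t + v x t * v1 x t)) (fun x => by simp only [P.pv, P.pw1, P.pv1]) hn)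
  · exact fun t ht i => cf_deriv (f := fun t j => w (j*h) t) (f' := fun t j => -(w1 (j*h) t * v (j*h) t + w (j*h) t * v1 (j*h) t)) (fun i => P.tw t ht _) i
  · exact fun t ht i => cf_deriv (f := fun t j => v (j*h) t) (f' := fun t j => -(w1 (j*h) t + v (j*h) t * v1 (j*h) t)) (fun i => P.tv t ht _) i
  · exact fun t ht i => (cf_bd (fun j => P.bw t ht _) i).trans (by nlinarith)
  · exact fun t ht i => (cf_bd (fun j => P.bv t ht _) i).trans (by nlinarith)
  · intro t ht i
    refine (cf_bd (K := 2*K^2) (fun j => ?_) i).trans (by nlinarith)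
    have e1 := abs_mul_le' (P.bw1 t ht (j*h)) (P.bv t ht (j*h))
    have e2 := abs_mul_le' (P.bw t ht (j*h)) (P.bv1 t ht (j*h))
    rw [abs_le] at *; constructor <;> linarith
  · intro t ht i
    refine (cf_dif (gw t ht) i).trans ?_
    have : K * h ≤ K^2*h := by gcongr
    nlinarith [mul_pos (show 0 < K by linarith) h0]
  · intro t ht i
    refine (cf_dif (gv t ht) i).trans ?_
    have : K * h ≤ K^2*h := by gcongr
    nlinarith [mul_pos (show 0 < K by linarith) h0]
  · intro t ht i
    have := cf_near (f := fun j : ℤ => w (j*h) t) (gw t ht) i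
    have e := P.low t ht (i*h)
    rw [abs_le] at this; linarith
  · intro t ht i
    obtain ⟨c0, c1, c2, c3, J⟩ := P.jw t ht h h0 h1 i
    obtain ⟨d0, d1, d2, d3, L⟩ := P.jv t ht h h0 h1 i
    have := T_bd h0 h1 J L
    simp only [Mm_cf_neg] at *
    have p : 0 ≤ K^2*h^3 := by positivity
    rw [abs_le] at *; constructor <;> linarith
  · intro t ht i
    obtain ⟨c0, c1, c2, c3, J⟩ := P.jw t ht h h0 h1 i
    obtain ⟨d0, d1, d2, d3, L⟩ := P.jv t ht h h0 h1 i
    have e1 := T_bd h0 h1 J (js_one h0.le K1 i)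
    have e2 := T_bd h0 h1 L L
    have c1 : cf (fun _ => (1:ℝ)) = fun _ => 1 := by funext i; unfold cf del2; ring
    rw [c1] at e1
    have p : 0 ≤ K^2*h^3 := by positivity
    have s : Mm (cf (fun j => -(w1 (j*h) t + v (j*h) t * v1 (j*h) t))) i =
      -(Mm (cf fun j => w1 (j*h) t * 1 + w (j*h) t * 0) i + 1/2 * Mm (cf fun j => v1 (j*h) t * v (j*h) t + v (j*h) t * v1 (j*h) t) i) := by
      unfold Mm cf del2; ring
    simp only [s]
    rw [abs_le] at *; constructor <;> linarith

theorem mk_dat {T K α h : ℝ} {n : ℕ} {a b ad bd Γ U Γd Ud : ℝ → ℤ → ℝ} (c : Cmp T K α h n a b ad bd) (g : Gal T h n Γ U Γd Ud)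
    (i1 : ∀ i, |Mm (fun j => Γ 0 j - a 0 j) i| ≤ K * h^3) (i2 : ∀ i, |Mm (fun j => U 0 j - b 0 j) i| ≤ K * h^3) :
    Dat T K α h n a b ad bd Γ U Γd Ud :=
  ⟨c.pa, c.pb, c.pad, c.pbd, g.pG, g.pU, g.pGd, g.pUd, c.da, c.db, g.dG, g.dU, c.ba, c.bb, c.bad, c.ga, c.gb, c.low, c.r1, c.r2, g.g1, g.g2, i1, i2⟩

end

section
open Set MeasureTheory

abbrev Ms (N : ℕ) : ℕ → ℝ := fun i => (i:ℝ)/N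

def hat (N i : ℕ) (y : ℝ) : ℝ := max 0 (1 - |y*N - i|)

theorem Ms_iff {N : ℕ} (hN : 0 < N) {j : ℕ} {y : ℝ} : y ∈ Icc ((j:ℝ)/N) (((j+1:ℕ):ℝ)/N) ↔ (j:ℝ) ≤ y*N ∧ y*N ≤ j+1 := by
  have : (0:ℝ) < N := by exact_mod_cast hN
  rw [mem_Icc, div_le_iff₀ this, le_div_iff₀ this]; push_cast; rfl

theorem Ms_iff' {N : ℕ} (hN : 0 < N) {j : ℕ} {y : ℝ} : y ∈ Ioo ((j:ℝ)/N) (((j+1:ℕ):ℝ)/N) ↔ (j:ℝ) < y*N ∧ y*N < j+1 := by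
  have : (0:ℝ) < N := by exact_mod_cast hN
  rw [mem_Ioo, div_lt_iff₀ this, lt_div_iff₀ this]; push_cast; rfl

theorem hat_eq {N i j : ℕ} {y : ℝ} (h1 : (j:ℝ) ≤ y*N) (h2 : y*N ≤ j+1) :
    hat N i y = (if j = i then 1 - (y*N - j) else 0) + (if j + 1 = i then y*N - j else 0) := by
  unfold hat
  by_cases a : j = i
  · subst a
    rw [if_pos rfl, if_neg (by omega), abs_of_nonneg (by linarith), max_eq_right (by linarith)]; ring
  · rw [if_neg a]
    by_cases b : j + 1 = i
    · subst b
      rw [if_pos rfl]; push_cast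
      rw [abs_of_nonpos (by linarith), max_eq_right (by linarith)]; ring
    · rw [if_neg b]
      rcases lt_or_gt_of_ne a with c | c
      · have : (j:ℝ) + 2 ≤ i := by exact_mod_cast (show j + 2 ≤ i by omega)
        rw [abs_of_nonpos (by linarith), max_eq_left (by linarith)]; ring
      · have : (i:ℝ) + 1 ≤ j := by exact_mod_cast (show i + 1 ≤ j by omega)
        rw [abs_of_nonneg (by linarith), max_eq_left (by linarith)]; ring

theorem hat_cont (N i : ℕ) : Continuous (hat N i) := by unfold hat; fun_prop

theorem hat_mem {N : ℕ} (hN : 0 < N) (i : ℕ) : hat N i ∈ Sh N 2 0 (Ms N) := by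
  refine ⟨?_, fun j _ => ?_⟩
  · rw [Nat.cast_zero, contDiffOn_zero]; exact (hat_cont N i).continuousOn
  refine ⟨Polynomial.C ((if j = i then -(N:ℝ) else 0) + (if j + 1 = i then (N:ℝ) else 0)) * Polynomial.X +
    Polynomial.C ((if j = i then 1 + (j:ℝ) else 0) + (if j + 1 = i then -(j:ℝ) else 0)), Polynomial.natDegree_linear_le, fun y hy => ?_⟩
  obtain ⟨h1, h2⟩ := (Ms_iff hN).1 hy
  rw [hat_eq h1 h2]
  simp only [Polynomial.eval_add, Polynomial.eval_mul, Polynomial.eval_C, Polynomial.eval_X]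
  split_ifs <;> ring

theorem hat_mem0 {N i : ℕ} (hN : 0 < N) (h0 : 0 < i) (h1 : i < N) : hat N i ∈ Sh0 N 2 0 (Ms N) := by
  have a : (1:ℝ) ≤ i := by exact_mod_cast h0
  have b : (i:ℝ) + 1 ≤ N := by exact_mod_cast h1
  refine ⟨hat_mem hN i, ?_, ?_⟩
  · unfold hat; rw [abs_of_nonpos (by linarith), max_eq_left (by linarith)]
  · unfold hat; rw [abs_of_nonneg (by linarith), max_eq_left (by linarith)]

def IR (N : ℕ) (g : ℝ → ℝ) (j : ℕ) : ℝ := ∫ y in ((j:ℝ)/N)..(((j+1:ℕ):ℝ)/N), g y * (1 - (y*N - j))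
def IL (N : ℕ) (g : ℝ → ℝ) (j : ℕ) : ℝ := ∫ y in ((j:ℝ)/N)..(((j+1:ℕ):ℝ)/N), g y * (y*N - j)

def PI (N : ℕ) (g : ℝ → ℝ) : Prop := ∀ j < N, IntervalIntegrable g volume ((j:ℝ)/N) (((j+1:ℕ):ℝ)/N)

theorem Ms_le {N : ℕ} (j : ℕ) : (j:ℝ)/N ≤ ((j+1:ℕ):ℝ)/N := by gcongr; simp

theorem ip_hat {N i : ℕ} (hN : 0 < N) {g : ℝ → ℝ} (hg : PI N g) :
    ip g (hat N i) = ∑ j ∈ Finset.range N, ((if j = i then IR N g j else 0) + (if j + 1 = i then IL N g j else 0)) := by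
  have hN' : (N:ℝ) ≠ 0 := by positivity
  have := intervalIntegral.sum_integral_adjacent_intervals (f := fun y => g y * hat N i y) (μ := volume) (a := Ms N) (n := N)
    (fun k hk => (hg k hk).mul_continuousOn (hat_cont N i).continuousOn)
  unfold ip
  rw [show (∫ y in (0:ℝ)..1, g y * hat N i y) = ∫ y in (Ms N 0)..(Ms N N), g y * hat N i y by simp [Ms, hN'], ← this]
  refine Finset.sum_congr rfl fun j _ => ?_
  have e : (∫ y in (Ms N j)..(Ms N (j+1)), g y * hat N i y) = ∫ y in (Ms N j)..(Ms N (j+1)), g y * ((if j = i then 1 - (y*N - j) else 0) + (if j + 1 = i then y*N - j else 0)) := by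
    refine intervalIntegral.integral_congr fun y hy => ?_
    rw [uIcc_of_le (Ms_le j)] at hy
    obtain ⟨h1, h2⟩ := (Ms_iff hN).1 hy
    simp only [hat_eq h1 h2]
  rw [e]
  by_cases a : j = i
  · subst a; rw [IR]; simp [Ms]
  · by_cases b : j + 1 = i
    · simp [b, a, IL]
    · simp [a, b]

theorem ip_hat0 {N : ℕ} (hN : 0 < N) {g : ℝ → ℝ} (hg : PI N g) : ip g (hat N 0) = IR N g 0 := by
  rw [ip_hat hN hg]; simp [hN]
theorem ip_hatN {N k : ℕ} (hN : k + 1 = N) {g : ℝ → ℝ} (hg : PI N g) : ip g (hat N (k+1)) = IL N g k := by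
  rw [ip_hat (by omega) hg, Finset.sum_add_distrib]
  subst hN
  simp
theorem ip_hatm {N k : ℕ} (hN : k + 1 < N) {g : ℝ → ℝ} (hg : PI N g) : ip g (hat N (k+1)) = IR N g (k+1) + IL N g k := by
  rw [ip_hat (by omega) hg, Finset.sum_add_distrib]
  simp [hN]
  intro h; omega

theorem I_quad {N : ℕ} (hN : 0 < N) (j : ℕ) (p q r : ℝ) :
    IR N (fun y => p + q*(y*N-j) + r*(y*N-j)^2) j = (p/2+q/6+r/12)/N ∧
    IL N (fun y => p + q*(y*N-j) + r*(y*N-j)^2) j = (p/2+q/3+r/4)/N := by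
  have hN' : (N:ℝ) ≠ 0 := by positivity
  have hz : ∀ y : ℝ, HasDerivAt (fun y : ℝ => y*N-j) N y := fun y => by
    simpa using ((hasDerivAt_id y).mul_const (N:ℝ)).sub_const (j:ℝ)
  constructor
  · unfold IR
    rw [intervalIntegral.integral_eq_sub_of_hasDerivAt (f := fun y => (p*(y*N-j) + (q-p)/2*(y*N-j)^2 + (r-q)/3*(y*N-j)^3 - r/4*(y*N-j)^4)/N)]
    · have : (j:ℝ)/N*N = j := by field_simp
      have h2 : ((j+1:ℕ):ℝ)/N*N = j+1 := by push_cast; field_simp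
      simp only [this, h2]; ring
    · intro y _
      refine ((((((hz y).const_mul p).add (((hz y).pow 2).const_mul ((q-p)/2))).add (((hz y).pow 3).const_mul ((r-q)/3))).sub (((hz y).pow 4).const_mul (r/4))).div_const (N:ℝ)).congr_deriv ?_
      field_simp; push_cast; ring
    · exact Continuous.intervalIntegrable (by fun_prop) _ _
  · unfold IL
    rw [intervalIntegral.integral_eq_sub_of_hasDerivAt (f := fun y => (p/2*(y*N-j)^2 + q/3*(y*N-j)^3 + r/4*(y*N-j)^4)/N)]
    · have : (j:ℝ)/N*N = j := by field_simp
      have h2 : ((j+1:ℕ):ℝ)/N*N = j+1 := by push_cast; field_simp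
      simp only [this, h2]; ring
    · intro y _
      refine ((((((hz y).pow 2).const_mul (p/2)).add (((hz y).pow 3).const_mul (q/3))).add (((hz y).pow 4).const_mul (r/4))).div_const (N:ℝ)).congr_deriv ?_
      field_simp; push_cast; ring
    · exact Continuous.intervalIntegrable (by fun_prop) _ _

/-- elementwise linear function -/
def EL (N : ℕ) (g : ℝ → ℝ) (p q : ℕ → ℝ) : Prop := ∀ j < N, ∀ y ∈ Ioo ((j:ℝ)/N) (((j+1:ℕ):ℝ)/N), g y = p j + q j * (y*N-j)

theorem EL.pi {N : ℕ} {g : ℝ → ℝ} {p q : ℕ → ℝ} (h : EL N g p q) : PI N g := fun j hj => by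
  have : IntervalIntegrable (fun y:ℝ => p j + q j * (y*N-j)) volume ((j:ℝ)/N) (((j+1:ℕ):ℝ)/N) :=
    Continuous.intervalIntegrable (by fun_prop) _ _
  refine this.congr_uIoo fun y hy => ?_
  rw [uIoo_of_le (Ms_le j)] at hy
  exact (h j hj y hy).symm

theorem EL.ir {N : ℕ} {g : ℝ → ℝ} {p q : ℕ → ℝ} (h : EL N g p q) {j : ℕ} (hj : j < N) :
    IR N g j = (p j/2+q j/6)/N ∧ IL N g j = (p j/2+q j/3)/N := by
  obtain ⟨a, b⟩ := I_quad (show 0 < N by omega) j (p j) (q j) 0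
  constructor
  · rw [show p j/2+q j/6 = p j/2+q j/6+0/12 by ring, ← a]
    refine intervalIntegral.integral_congr_Ioo_of_le (Ms_le j) fun y hy => ?_
    simp only [h j hj y hy]; ring
  · rw [show p j/2+q j/3 = p j/2+q j/3+0/4 by ring, ← b]
    refine intervalIntegral.integral_congr_Ioo_of_le (Ms_le j) fun y hy => ?_
    simp only [h j hj y hy]; ring

theorem I_err {N : ℕ} (hN : 0 < N) {g : ℝ → ℝ} {j : ℕ} {p q r ε : ℝ}
    (hi : IntervalIntegrable g volume ((j:ℝ)/N) (((j+1:ℕ):ℝ)/N))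
    (h : ∀ y ∈ Icc ((j:ℝ)/N) (((j+1:ℕ):ℝ)/N), |g y - (p + q*(y*N-j) + r*(y*N-j)^2)| ≤ ε) :
    |IR N g j - (p/2+q/6+r/12)/N| ≤ ε/N ∧ |IL N g j - (p/2+q/3+r/4)/N| ≤ ε/N := by
  have hN' : (0:ℝ) < N := by positivity
  obtain ⟨a, b⟩ := I_quad hN j p q r
  have l : |((j+1:ℕ):ℝ)/N - (j:ℝ)/N| = 1/N := by
    rw [abs_of_nonneg (by linarith [Ms_le (N := N) j])]; push_cast; ring
  rw [← a, ← b]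
  have ε0 : 0 ≤ ε := (abs_nonneg _).trans (h _ (left_mem_Icc.2 (Ms_le j)))
  constructor
  · unfold IR
    rw [← intervalIntegral.integral_sub (hi.mul_continuousOn (by fun_prop)) (Continuous.intervalIntegrable (by fun_prop) _ _)]
    rw [← Real.norm_eq_abs]
    refine (intervalIntegral.norm_integral_le_of_norm_le_const (C := ε) fun y hy => ?_).trans (le_of_eq (by rw [l]; ring))
    rw [uIoc_of_le (Ms_le j)] at hy
    have hy' := Ioc_subset_Icc_self hy
    obtain ⟨h1, h2⟩ := (Ms_iff hN).1 hy'
    rw [← sub_mul, Real.norm_eq_abs]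
    have := abs_mul_le' (h y hy') (show |1 - (y*N - j)| ≤ 1 by rw [abs_le]; constructor <;> linarith)
    simpa using this
  · unfold IL
    rw [← intervalIntegral.integral_sub (hi.mul_continuousOn (by fun_prop)) (Continuous.intervalIntegrable (by fun_prop) _ _)]
    rw [← Real.norm_eq_abs]
    refine (intervalIntegral.norm_integral_le_of_norm_le_const (C := ε) fun y hy => ?_).trans (le_of_eq (by rw [l]; ring))
    rw [uIoc_of_le (Ms_le j)] at hy
    have hy' := Ioc_subset_Icc_self hy
    obtain ⟨h1, h2⟩ := (Ms_iff hN).1 hy'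
    rw [← sub_mul, Real.norm_eq_abs]
    have := abs_mul_le' (h y hy') (show |y*N - j| ≤ 1 by rw [abs_le]; constructor <;> linarith)
    simpa using this

end

section
open Set MeasureTheory

theorem Sh_lin {N : ℕ} (hN : 0 < N) {f : ℝ → ℝ} (hf : f ∈ Sh N 2 0 (Ms N)) {j : ℕ} (hj : j < N) {y : ℝ}
    (hy : y ∈ Icc ((j:ℝ)/N) (((j+1:ℕ):ℝ)/N)) : f y = f (Ms N j) + (f (Ms N (j+1)) - f (Ms N j)) * (y*N-j) := by
  have hN' : (N:ℝ) ≠ 0 := by positivity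
  obtain ⟨p, hp, h⟩ := hf.2 j hj
  obtain ⟨a, b, rfl⟩ := Polynomial.exists_eq_X_add_C_of_natDegree_le_one (p := p) hp
  rw [h y hy, h (Ms N j) (left_mem_Icc.2 (Ms_le j)), h (Ms N (j+1)) (right_mem_Icc.2 (Ms_le j))]
  simp only [Polynomial.eval_add, Polynomial.eval_mul, Polynomial.eval_C, Polynomial.eval_X, Ms]
  push_cast; field_simp; ring

theorem el_id {N : ℕ} (hN : 0 < N) {f : ℝ → ℝ} (hf : f ∈ Sh N 2 0 (Ms N)) :
    EL N f (fun j => f (Ms N j)) (fun j => f (Ms N (j+1)) - f (Ms N j)) := fun _ hj _ hy => Sh_lin hN hf hj (Ioo_subset_Icc_self hy)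

theorem sh_hd {N : ℕ} (hN : 0 < N) {f : ℝ → ℝ} (hf : f ∈ Sh N 2 0 (Ms N)) {j : ℕ} (hj : j < N) {y : ℝ}
    (hy : y ∈ Ioo ((j:ℝ)/N) (((j+1:ℕ):ℝ)/N)) : HasDerivAt f ((f (Ms N (j+1)) - f (Ms N j)) * N) y := by
  have hz : HasDerivAt (fun y : ℝ => y*N-j) N y := by
    simpa using ((hasDerivAt_id y).mul_const (N:ℝ)).sub_const (j:ℝ)
  refine ((hz.const_mul (f (Ms N (j+1)) - f (Ms N j))).const_add (f (Ms N j))).congr_of_eventuallyEq ?_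
  filter_upwards [Ioo_mem_nhds hy.1 hy.2] with z hz
  exact Sh_lin hN hf hj (Ioo_subset_Icc_self hz)

theorem el_d {N : ℕ} (hN : 0 < N) {f : ℝ → ℝ} (hf : f ∈ Sh N 2 0 (Ms N)) :
    EL N (deriv f) (fun j => (f (Ms N (j+1)) - f (Ms N j))*N) (fun _ => 0) := fun j hj y hy => by
  rw [(sh_hd hN hf hj hy).deriv]; ring

theorem el_dd {N : ℕ} (hN : 0 < N) {f g : ℝ → ℝ} (hf : f ∈ Sh N 2 0 (Ms N)) (hg : g ∈ Sh N 2 0 (Ms N)) :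
    EL N (deriv (fun y => f y * g y)) (fun j => ((f (Ms N (j+1)) - f (Ms N j))*g (Ms N j) + f (Ms N j) * (g (Ms N (j+1)) - g (Ms N j)))*N)
     (fun j => 2*((f (Ms N (j+1)) - f (Ms N j))* (g (Ms N (j+1)) - g (Ms N j)))*N) := fun j hj y hy => by
  show deriv (f * g) y = _
  rw [((sh_hd hN hf hj hy).mul (sh_hd hN hg hj hy)).deriv, el_id hN hf j hj y hy, el_id hN hg j hj y hy]; ring

theorem el_fd {N : ℕ} (hN : 0 < N) {f : ℝ → ℝ} (hf : f ∈ Sh N 2 0 (Ms N)) :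
    EL N (fun y => f y * deriv f y) (fun j => f (Ms N j) * (f (Ms N (j+1)) - f (Ms N j))*N)
     (fun j => (f (Ms N (j+1)) - f (Ms N j))^2*N) := fun j hj y hy => by
  show f y * deriv f y = _
  rw [(sh_hd hN hf hj hy).deriv, el_id hN hf j hj y hy]; ring

theorem red_int {N : ℕ} (hN : 0 < N) {F : ℤ → ℝ} {s : ℝ} (pF : Per (2*N) F) (nF : ∀ i, F (-i) = s * F i)
    (h : ∀ k : ℕ, k ≤ N → F k = 0) (i : ℤ) : F i = 0 := by
  have hp : Function.Periodic F ((2*N:ℕ):ℤ) := pF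
  have h1 : F (i % (2*N:ℕ)) = F i := by
    rw [Int.emod_def]
    have := hp.sub_zsmul_eq (x := i) (i / (2*N:ℕ))
    simpa [mul_comm] using this
  have a1 := Int.emod_nonneg i (show ((2*N:ℕ):ℤ) ≠ 0 by omega)
  have a2 := Int.emod_lt_of_pos i (show 0 < ((2*N:ℕ):ℤ) by omega)
  rw [← h1]
  set r := i % (2*N:ℕ)
  by_cases hr : r ≤ N
  · have := h r.toNat (by omega)
    rwa [Int.toNat_of_nonneg a1] at this
  · have := h ((2*N:ℕ) - r).toNat (by omega)
    rw [Int.toNat_of_nonneg (by omega)] at this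
    rw [show r = -(((2*N:ℕ):ℤ) - r) + (2*N:ℕ) by ring, pF, nF, this, mul_zero]

def AA (a b : ℤ → ℝ) (i : ℤ) : ℝ := (2 * a i * b i + a i * b (i+1) + a (i+1) * b i + 2 * a (i+1) * b (i+1))/6

theorem N1_AA (h : ℝ) (a b : ℤ → ℝ) (i : ℤ) : N1 h a b i = (AA a b i - AA a b (i-1))/h := by
  unfold N1 AA; rw [show i - 1 + 1 = i by ring]; rcases eq_or_ne h 0 with e | e
  · subst e; simp
  · field_simp

theorem fin1 {N : ℕ} (hN : 0 < N) {D G U : ℤ → ℝ} {h : ℝ} (h0 : 0 < h) (pD : Per (2*N) D) (pG : Per (2*N) G) (pU : Per (2*N) U)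
    (nD : ∀ i, D (-i) = D i) (nG : ∀ i, G (-i) = G i) (nU : ∀ i, U (-i) = - U i)
    (hz : h*(2*D 0 + D 1)/6 + (-(G 0 * U 0) + AA G U 0) = 0)
    (hm : ∀ k : ℕ, k + 1 < N → h*(D k + 4*D (k+1) + D (k+2))/6 + (AA G U (k+1) - AA G U k) = 0)
    (hn : h*(2*D N + D (N-1))/6 + (G N * U N - AA G U (N-1)) = 0) (i : ℤ) : Mm D i + N1 h G U i = 0 := by
  refine red_int (s := 1) hN (pD.Mm.add (pG.N1 h pU)) (fun i => ?_) (fun k hk => ?_) i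
  · show Mm D (-i) + N1 h G U (-i) = 1 * (Mm D i + N1 h G U i)
    unfold Mm N1
    simp only [show -i + 1 = -(i-1) by ring, show -i - 1 = -(i+1) by ring, nD, nG, nU]
    field_simp; ring
  · show Mm D k + N1 h G U k = 0
    have U0 : U 0 = 0 := by have := nU 0; simp at this; linarith
    have UN : U N = 0 := by
      have := nU N
      have h2 := pU (-N)
      push_cast at h2
      rw [show -(N:ℤ) + 2*N = N by ring] at h2
      linarith
    suffices e : h * (Mm D k + N1 h G U k) = 0 from (mul_eq_zero.1 e).resolve_left h0.ne'
    rw [N1_AA]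
    rcases Nat.eq_zero_or_pos k with r | r
    · subst r
      have u1 := nU 1
      have g1 := nG 1
      have d1 := nD 1
      have : AA G U (-1) = - AA G U 0 := by
        unfold AA; simp [u1, g1, U0]; ring
      simp only [Nat.cast_zero, zero_sub, this, Mm, zero_add, d1]
      rw [U0] at hz
      field_simp; linarith
    · obtain ⟨k, rfl⟩ := Nat.exists_eq_succ_of_ne_zero r.ne'
      rcases hk.lt_or_eq with e | e
      · have := hm k e
        unfold Mm
        push_cast
        rw [show (k:ℤ) + 1 - 1 = k by ring, show (k:ℤ) + 1 + 1 = k + 2 by ring]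
        field_simp; linarith
      · rw [Nat.succ_eq_add_one] at *
        rw [e]
        have X : ∀ {f : ℤ → ℝ}, Per (2*N) f → f (N+1) = f (-(N-1)) := fun {f} hf => by
          rw [← hf (-(N-1))]; congr 1; push_cast; ring
        have d1 := (X pD).trans (nD _)
        have g1 := (X pG).trans (nG _)
        have u1 := (X pU).trans (nU _)
        have : AA G U N = - AA G U (N-1) := by
          unfold AA; simp [u1, g1, UN]; ring
        unfold Mm
        rw [this, d1]
        rw [UN] at hn
        field_simp; linarith

theorem fin2 {N : ℕ} (hN : 0 < N) {D G U : ℤ → ℝ} {h : ℝ} (h0 : 0 < h) (pD : Per (2*N) D) (pG : Per (2*N) G) (pU : Per (2*N) U)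
    (nD : ∀ i, D (-i) = - D i) (nG : ∀ i, G (-i) = G i) (nU : ∀ i, U (-i) = - U i)
    (hm : ∀ k : ℕ, k + 1 < N → h*(D k + 4*D (k+1) + D (k+2))/6 + (G (k+2) - G k)/2 + 1/2*(AA U U (k+1) - AA U U k) = 0)
    (i : ℤ) : Mm D i + N1 h G (fun _ => 1) i + 1/2*N1 h U U i = 0 := by
  have p1 : Per (2*N) (fun _ : ℤ => (1:ℝ)) := fun i => rfl
  have PF := ((pD.Mm.add (pG.N1 h p1)).add ((pU.N1 h pU).cmul (1/2)))
  have nF : ∀ i, Mm D (-i) + N1 h G (fun _ => 1) (-i) + 1/2*N1 h U U (-i) = (-1) * (Mm D i + N1 h G (fun _ => 1) i + 1/2*N1 h U U i) := by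
    intro i
    unfold Mm N1
    simp only [show -i + 1 = -(i-1) by ring, show -i - 1 = -(i+1) by ring, nD, nG, nU]
    field_simp; ring
  refine red_int (s := -1) hN PF nF (fun k hk => ?_) i
  show Mm D k + N1 h G (fun _ => 1) k + 1/2*N1 h U U k = 0
  rcases Nat.eq_zero_or_pos k with r | r
  · subst r
    have := nF 0
    simp only [neg_zero, Nat.cast_zero] at *; linarith
  · obtain ⟨k, rfl⟩ := Nat.exists_eq_succ_of_ne_zero r.ne'
    rcases hk.lt_or_eq with e | e
    · have := hm k e
      suffices e : h * (Mm D (k+1) + N1 h G (fun _ => 1) (k+1) + 1/2*N1 h U U (k+1)) = 0 by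
        have := (mul_eq_zero.1 e).resolve_left h0.ne'
        exact_mod_cast this
      rw [N1_AA, N1_AA]
      have a1 : AA G (fun _ => 1) (k+1) - AA G (fun _ => 1) k = (G (k+2) - G k)/2 := by
        unfold AA
        rw [show (k:ℤ) + 1 + 1 = k + 2 by ring]; ring
      unfold Mm
      rw [show (k:ℤ) + 1 - 1 = k by ring, show (k:ℤ) + 1 + 1 = k + 2 by ring, a1]
      field_simp; linarith
    · rw [Nat.succ_eq_add_one] at *
      rw [e]
      have h1 := nF N
      have h2 := PF (-N)
      simp only at h2
      push_cast at h2
      rw [show -(N:ℤ) + 2*N = N by ring] at h2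
      linarith

end

section
open Set MeasureTheory

def nd (s : ℝ) (N : ℕ) (f : ℝ → ℝ) (i : ℤ) : ℝ := ex s f (i*(1/(N:ℝ)))

theorem nd_nat {s : ℝ} {N : ℕ} (hN : 0 < N) {f : ℝ → ℝ} (h1 : f 1 = s * f 1) {k : ℕ} (hk : k ≤ N) : nd s N f k = f (Ms N k) := by
  have hN' : (0:ℝ) < N := by positivity
  unfold nd
  rw [show ((k:ℤ):ℝ)*(1/(N:ℝ)) = (k:ℝ)/N by push_cast; ring]
  refine ex_mem h1 ⟨by positivity, ?_⟩
  rw [div_le_one hN']; exact_mod_cast hk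

theorem hN2 {N : ℕ} (hN : 0 < N) : (1/(N:ℝ)) * (2*N:ℕ) = 2 := by
  have hN' : (0:ℝ) < N := by positivity
  push_cast; field_simp

theorem nd_per {s : ℝ} {N : ℕ} (hN : 0 < N) (f : ℝ → ℝ) : Per (2*N) (nd s N f) :=
  per_nodes (f := ex s f) (ex_per s f) (hN2 hN)

theorem nd_neg {s : ℝ} (hs : s * s = 1) {N : ℕ} {f : ℝ → ℝ} (h0 : f 0 = s * f 0) (h1 : f 1 = s * f 1) (i : ℤ) :
    nd s N f (-i) = s * nd s N f i := by
  unfold nd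
  rw [← ex_neg hs h0 h1]; congr 1; push_cast; ring

theorem nd_deriv {s : ℝ} {N : ℕ} {f f' : ℝ → ℝ → ℝ} {J : Set ℝ} {t : ℝ}
    (h : ∀ y ∈ Icc (0:ℝ) 1, HasDerivWithinAt (fun τ => f τ y) (f' t y) J t) (i : ℤ) :
    HasDerivWithinAt (fun τ => nd s N (f τ) i) (nd s N (f' t) i) J t := by
  unfold nd ex
  have hr := red_mem (i*(1/(N:ℝ)))
  split_ifs with h0
  · exact h _ ⟨h0, hr.2.le⟩
  · exact (h _ ⟨by linarith, by linarith⟩).const_mul s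

theorem gal_of {N : ℕ} (hN : 0 < N) {T : ℝ} {ηh uh dηh duh : ℝ → ℝ → ℝ} (S : SolvesSWGalerkin N 2 0 (Ms N) T ηh uh dηh duh) :
    Gal T (1/(N:ℝ)) (2*N) (fun t => nd 1 N (fun y => 1 + ηh t y)) (fun t => nd (-1) N (uh t)) (fun t => nd 1 N (dηh t)) (fun t => nd (-1) N (duh t)) := by
  obtain ⟨S1, S2, S3, S4⟩ := S
  have hN' : (0:ℝ) < N := by positivity
  have h0 : 0 < 1/(N:ℝ) := by positivity
  refine ⟨fun t _ => nd_per hN _, fun t _ => nd_per hN _, fun t _ => nd_per hN _, fun t _ => nd_per hN _, ?_, ?_, ?_, ?_⟩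
  · intro t ht i
    exact nd_deriv (f := fun t y => 1 + ηh t y) (f' := dηh) (fun y hy => (S2 y hy t ht).1.const_add 1) i
  · intro t ht i
    exact nd_deriv (fun y hy => (S2 y hy t ht).2) i
  · intro t ht
    obtain ⟨me, ⟨mu, u0, u1⟩, md, -⟩ := S1 t ht
    have W := (S4 t ht).1
    refine fin1 hN h0 (nd_per hN _) (nd_per hN _) (nd_per hN _) (fun i => by rw [nd_neg] <;> simp) (fun i => by rw [nd_neg] <;> simp)
      (fun i => by rw [nd_neg] <;> simp [u0, u1]) ?_ ?_ ?_
    · have e := W _ (hat_mem hN 0)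
      rw [ip_hat0 hN (el_id hN md).pi, ip_hat0 hN (el_d hN mu).pi, ip_hat0 hN (el_dd hN me mu).pi,
        ((el_id hN md).ir hN).1, ((el_d hN mu).ir hN).1, ((el_dd hN me mu).ir hN).1] at e
      have c0 : (0:ℤ) = ((0:ℕ):ℤ) := rfl
      have c1 : (1:ℤ) = ((1:ℕ):ℤ) := rfl
      simp only [AA, zero_add]
      rw [c0, c1]
      iterate 6 rw [nd_nat hN (by simp [u1]) (by omega)]
      rw [← e]
      field_simp; ring
    · intro k hk
      have e := W _ (hat_mem hN (k+1))
      rw [ip_hatm hk (el_id hN md).pi, ip_hatm hk (el_d hN mu).pi, ip_hatm hk (el_dd hN me mu).pi,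
        ((el_id hN md).ir hk).1, ((el_d hN mu).ir hk).1, ((el_dd hN me mu).ir hk).1,
        ((el_id hN md).ir (show k < N by omega)).2, ((el_d hN mu).ir (show k < N by omega)).2, ((el_dd hN me mu).ir (show k < N by omega)).2] at e
      have c1 : (k:ℤ)+1 = ((k+1:ℕ):ℤ) := rfl
      have c2 : (k:ℤ)+2 = ((k+1+1:ℕ):ℤ) := by push_cast; ring
      simp only [AA, add_assoc (k:ℤ) 1 1, show (1:ℤ)+1 = 2 by rfl]
      rw [c1, c2]
      iterate 9 rw [nd_nat hN (by simp [u1]) (by omega)]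
      rw [← e]
      field_simp; ring
    · obtain ⟨k, rfl⟩ := Nat.exists_eq_succ_of_ne_zero hN.ne'
      rw [Nat.succ_eq_add_one] at *
      have e := W _ (hat_mem hN (k+1))
      rw [ip_hatN rfl (el_id hN md).pi, ip_hatN rfl (el_d hN mu).pi, ip_hatN rfl (el_dd hN me mu).pi,
        ((el_id hN md).ir (show k < k+1 by omega)).2, ((el_d hN mu).ir (show k < k+1 by omega)).2, ((el_dd hN me mu).ir (show k < k+1 by omega)).2] at e
      have c1 : ((k+1:ℕ):ℤ) - 1 = (k:ℤ) := by push_cast; ring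
      have c2 : (k:ℤ)+1 = ((k+1:ℕ):ℤ) := rfl
      simp only [AA, c1]
      rw [c2]
      iterate 6 rw [nd_nat hN (by simp [u1]) (by omega)]
      rw [← e]
      field_simp; ring
  · intro t ht
    obtain ⟨me, ⟨mu, u0, u1⟩, -, md, d0, d1⟩ := S1 t ht
    have W := (S4 t ht).2
    refine fin2 hN h0 (nd_per hN _) (nd_per hN _) (nd_per hN _) (fun i => by rw [nd_neg] <;> simp [d0, d1]) (fun i => by rw [nd_neg] <;> simp)
      (fun i => by rw [nd_neg] <;> simp [u0, u1]) ?_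
    · intro k hk
      have e := W _ (hat_mem0 hN (Nat.succ_pos k) hk)
      rw [ip_hatm hk (el_id hN md).pi, ip_hatm hk (el_d hN me).pi, ip_hatm hk (el_fd hN mu).pi,
        ((el_id hN md).ir hk).1, ((el_d hN me).ir hk).1, ((el_fd hN mu).ir hk).1,
        ((el_id hN md).ir (show k < N by omega)).2, ((el_d hN me).ir (show k < N by omega)).2, ((el_fd hN mu).ir (show k < N by omega)).2] at e
      have c1 : (k:ℤ)+1 = ((k+1:ℕ):ℤ) := rfl
      have c2 : (k:ℤ)+2 = ((k+1+1:ℕ):ℤ) := by push_cast; ring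
      simp only [AA, add_assoc (k:ℤ) 1 1, show (1:ℤ)+1 = 2 by rfl]
      rw [c1, c2]
      iterate 8 rw [nd_nat hN (by simp [u1, d1]) (by omega)]
      rw [← e]
      field_simp; ring

end

section
open Set MeasureTheory

theorem red_bd {N : ℕ} (hN : 0 < N) {F : ℤ → ℝ} {s ε : ℝ} (hs : |s| = 1) (pF : Per (2*N) F) (nF : ∀ i, F (-i) = s * F i)
    (h : ∀ k : ℕ, k ≤ N → |F k| ≤ ε) (i : ℤ) : |F i| ≤ ε := by
  have hp : Function.Periodic F ((2*N:ℕ):ℤ) := pF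
  have h1 : F (i % (2*N:ℕ)) = F i := by
    rw [Int.emod_def]
    have := hp.sub_zsmul_eq (x := i) (i / (2*N:ℕ))
    simpa [mul_comm] using this
  have a1 := Int.emod_nonneg i (show ((2*N:ℕ):ℤ) ≠ 0 by omega)
  have a2 := Int.emod_lt_of_pos i (show 0 < ((2*N:ℕ):ℤ) by omega)
  rw [← h1]
  set r := i % (2*N:ℕ)
  by_cases hr : r ≤ N
  · have := h r.toNat (by omega)
    rwa [Int.toNat_of_nonneg a1] at this
  · have := h ((2*N:ℕ) - r).toNat (by omega)
    rw [Int.toNat_of_nonneg (by omega)] at this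
    rwa [show r = -(((2*N:ℕ):ℤ) - r) + (2*N:ℕ) by ring, pF, nF, abs_mul, hs, one_mul]

theorem Mcf_bd {W : ℤ → ℝ} {h q0 q1 q2 ε : ℝ} {i : ℤ} (H : ∀ j : ℤ, |j| ≤ 2 → |W (i+j) - (q0 + q1*(j*h) + q2*(j*h)^2)| ≤ ε) :
    |Mm (cf W) i - (q0 + q2*h^2/6)| ≤ 2*ε := by
  have e1 := H (-2) (by norm_num)
  have e2 := H (-1) (by norm_num)
  have e3 := H 0 (by norm_num)
  have e4 := H 1 (by norm_num)
  have e5 := H 2 (by norm_num)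
  unfold Mm cf del2
  rw [show i - 1 + 1 = i by ring, show i + 1 - 1 = i by ring, show i - 1 - 1 = i + -2 by ring, show i + 1 + 1 = i + 2 by ring, show i - 1 = i + -1 by ring]
  push_cast at *
  rw [add_zero] at e3
  rw [abs_le] at *
  constructor <;> linarith

theorem pi_of_cont {N : ℕ} (hN : 0 < N) {g : ℝ → ℝ} (hg : ContinuousOn g (Icc 0 1)) : PI N g := fun j hj => by
  refine (hg.mono ?_).intervalIntegrable
  have hN' : (0:ℝ) < N := by positivity
  rw [uIcc_of_le (Ms_le j)]
  refine Icc_subset_Icc (by positivity) ?_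
  rw [div_le_one hN']; exact_mod_cast hj

/-- right element expansion -/
theorem ir_exp {N : ℕ} (hN : 0 < N) {g F : ℝ → ℝ} {c : ℕ → ℝ} {h q0 q1 q2 ε : ℝ} (hh : h = 1/(N:ℝ)) {j : ℕ} (hj : j < N) (hi : PI N g)
    (hg : ∀ y ∈ Icc ((j:ℝ)/N) (((j+1:ℕ):ℝ)/N), g y = F y - (c j + (c (j+1) - c j)*(y*N-j)))
    (hq : ∀ s, |s| ≤ 2*h → |F (j*h+s) - (q0+q1*s+q2*s^2)| ≤ ε) :
    |IR N g j - ((q0/2+q1*h/6+q2*h^2/12) - (c j/3+c (j+1)/6))/N| ≤ ε/N := by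
  have hN' : (0:ℝ) < N := by positivity
  have := (I_err hN (p := q0 - c j) (q := q1*h - (c (j+1) - c j)) (r := q2*h^2) (ε := ε) (hi j hj) ?_).1
  · refine le_trans (le_of_eq ?_) this
    congr 2; ring
  · intro y hy
    obtain ⟨h1, h2⟩ := (Ms_iff hN).1 hy
    have hs : |(y*N-j)*h| ≤ 2*h := by
      have : 0 < h := by rw [hh]; positivity
      rw [abs_of_nonneg (mul_nonneg (by linarith) this.le)]; nlinarith
    have := hq _ hs
    rw [hg y hy]
    rw [show j*h + (y*N-j)*h = y by rw [hh]; field_simp; ring] at this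
    refine le_trans (le_of_eq ?_) this
    congr 1; ring

theorem il_exp {N : ℕ} (hN : 0 < N) {g F : ℝ → ℝ} {c : ℕ → ℝ} {h q0 q1 q2 ε : ℝ} (hh : h = 1/(N:ℝ)) {j : ℕ} (hj : j < N) (hi : PI N g)
    (hg : ∀ y ∈ Icc ((j:ℝ)/N) (((j+1:ℕ):ℝ)/N), g y = F y - (c j + (c (j+1) - c j)*(y*N-j)))
    (hq : ∀ s, |s| ≤ 2*h → |F ((j+1:ℕ)*h+s) - (q0+q1*s+q2*s^2)| ≤ ε) :
    |IL N g j - ((q0/2-q1*h/6+q2*h^2/12) - (c (j+1)/3+c j/6))/N| ≤ ε/N := by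
  have hN' : (0:ℝ) < N := by positivity
  have := (I_err hN (p := q0 - q1*h + q2*h^2 - c j) (q := q1*h - 2*q2*h^2 - (c (j+1) - c j)) (r := q2*h^2) (ε := ε) (hi j hj) ?_).2
  · refine le_trans (le_of_eq ?_) this
    congr 2; ring
  · intro y hy
    obtain ⟨h1, h2⟩ := (Ms_iff hN).1 hy
    have hs : |(y*N-j-1)*h| ≤ 2*h := by
      have : 0 < h := by rw [hh]; positivity
      rw [abs_of_nonpos (mul_nonpos_of_nonpos_of_nonneg (by linarith) this.le)]; nlinarith
    have := hq _ hs
    rw [hg y hy]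
    rw [show (j+1:ℕ)*h + (y*N-j-1)*h = y by rw [hh]; push_cast; field_simp; ring] at this
    refine le_trans (le_of_eq ?_) this
    congr 1; ring

theorem mulN {n r A ε : ℝ} (hn : 0 < n) (h : |r - A/n| ≤ ε/n) : |r*n - A| ≤ ε := by
  have : r*n - A = (r - A/n)*n := by field_simp
  rw [this, abs_mul, abs_of_pos hn]
  rwa [le_div_iff₀ hn] at h

theorem node_mid {N : ℕ} {g F : ℝ → ℝ} {c : ℕ → ℝ} {h q0 q1 q2 ε : ℝ} (hh : h = 1/(N:ℝ)) {k : ℕ} (hk : k + 1 < N) (hi : PI N g)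
    (hg : ∀ j < N, ∀ y ∈ Icc ((j:ℝ)/N) (((j+1:ℕ):ℝ)/N), g y = F y - (c j + (c (j+1) - c j)*(y*N-j)))
    (hq : ∀ s, |s| ≤ 2*h → |F ((k+1:ℕ)*h+s) - (q0+q1*s+q2*s^2)| ≤ ε) (h0 : ip g (hat N (k+1)) = 0) :
    |(c k + 4 * c (k+1) + c (k+2))/6 - (q0+q2*h^2/6)| ≤ 3*ε := by
  have hN : 0 < N := by omega
  have hN' : (0:ℝ) < N := by positivity
  rw [ip_hatm hk hi] at h0
  have e1 := ir_exp hN hh hk hi (hg (k+1) hk) hq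
  have e2 := il_exp hN hh (show k < N by omega) hi (hg k (by omega)) hq
  have ε0 : 0 ≤ ε := (abs_nonneg _).trans (hq 0 (by rw [hh]; simp))
  have e1 := mulN hN' e1
  have e2 := mulN hN' e2
  have e3 : IR N g (k+1) * N + IL N g k * N = 0 := by rw [← add_mul, h0, zero_mul]
  rw [show k + 1 + 1 = k + 2 from rfl] at e1
  rw [abs_le] at *
  constructor <;> linarith

theorem node_0 {N : ℕ} (hN : 0 < N) {g F : ℝ → ℝ} {c : ℕ → ℝ} {h q0 q1 q2 ε : ℝ} (hh : h = 1/(N:ℝ)) (hi : PI N g)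
    (hg : ∀ j < N, ∀ y ∈ Icc ((j:ℝ)/N) (((j+1:ℕ):ℝ)/N), g y = F y - (c j + (c (j+1) - c j)*(y*N-j)))
    (hq : ∀ s, |s| ≤ 2*h → |F ((0:ℕ)*h+s) - (q0+q1*s+q2*s^2)| ≤ ε) (h0 : ip g (hat N 0) = 0) (hF : ∀ s, F ((0:ℕ)*h + -s) = F ((0:ℕ)*h + s)) :
    |(4 * c 0 + 2 * c 1)/6 - (q0+q2*h^2/6)| ≤ 3*ε := by
  have hN' : (0:ℝ) < N := by positivity
  rw [ip_hat0 hN hi] at h0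
  have hp : 0 < h := by rw [hh]; positivity
  have e1 := ir_exp hN hh hN hi (hg 0 hN) hq
  have e2 := hq h (by rw [abs_of_pos hp]; linarith)
  have e3 := hq (-h) (by rw [abs_neg, abs_of_pos hp]; linarith)
  rw [hF] at e3
  rw [h0, zero_sub, abs_neg, abs_div, abs_of_pos hN', div_le_div_iff_of_pos_right hN'] at e1
  rw [zero_add] at e1
  rw [abs_le] at *
  constructor <;> linarith

theorem node_N {N k : ℕ} (hN : k + 1 = N) {g F : ℝ → ℝ} {c : ℕ → ℝ} {h q0 q1 q2 ε : ℝ} (hh : h = 1/(N:ℝ)) (hi : PI N g)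
    (hg : ∀ j < N, ∀ y ∈ Icc ((j:ℝ)/N) (((j+1:ℕ):ℝ)/N), g y = F y - (c j + (c (j+1) - c j)*(y*N-j)))
    (hq : ∀ s, |s| ≤ 2*h → |F ((k+1:ℕ)*h+s) - (q0+q1*s+q2*s^2)| ≤ ε) (h0 : ip g (hat N (k+1)) = 0) (hF : ∀ s, F ((k+1:ℕ)*h + -s) = F ((k+1:ℕ)*h + s)) :
    |(4 * c (k+1) + 2 * c k)/6 - (q0+q2*h^2/6)| ≤ 3*ε := by
  have hN0 : 0 < N := by omega
  have hN' : (0:ℝ) < N := by positivity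
  rw [ip_hatN hN hi] at h0
  have hp : 0 < h := by rw [hh]; positivity
  have e1 := il_exp hN0 hh (show k < N by omega) hi (hg k (by omega)) hq
  have e2 := hq h (by rw [abs_of_pos hp]; linarith)
  have e3 := hq (-h) (by rw [abs_neg, abs_of_pos hp]; linarith)
  rw [hF] at e3
  rw [h0, zero_sub, abs_neg, abs_div, abs_of_pos hN', div_le_div_iff_of_pos_right hN'] at e1
  rw [abs_le] at *
  constructor <;> linarith

theorem QA.at {F : ℝ → ℝ} {K : ℝ} (Q : QA F K) {N : ℕ} (hN : 2 ≤ N) {h : ℝ} (hh : h = 1/(N:ℝ)) (x : ℝ) :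
    ∃ q0 q1 q2, ∀ s, |s| ≤ 2*h → |F (x+s) - (q0+q1*s+q2*s^2)| ≤ 8*K*h^3 := by
  have hN' : (2:ℝ) ≤ N := by exact_mod_cast hN
  obtain ⟨q0, q1, q2, -, -, -, H⟩ := Q x (2*h) (by rw [hh]; positivity) (by rw [hh]; rw [mul_one_div, div_le_one (by linarith)]; exact hN')
  exact ⟨q0, q1, q2, fun s hs => (H s hs).trans (le_of_eq (by ring))⟩

theorem Mm_sub (f g : ℤ → ℝ) (i : ℤ) : Mm (fun j => f j - g j) i = Mm f i - Mm g i := by unfold Mm; ring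

/-- initial data, even case -/
theorem init_even {N : ℕ} (hN : 2 ≤ N) {F g c : ℝ → ℝ} {K h : ℝ} (hh : h = 1/(N:ℝ)) (Q : QA F K) (pF : ∀ x, F (x+2) = F x) (nF : ∀ x, F (-x) = F x)
    (hgc : ContinuousOn g (Icc 0 1))
    (hg : ∀ j < N, ∀ y ∈ Icc ((j:ℝ)/N) (((j+1:ℕ):ℝ)/N), g y = F y - (c (Ms N j) + (c (Ms N (j+1)) - c (Ms N j))*(y*N-j)))
    (h0 : ∀ i, ip g (hat N i) = 0) (i : ℤ) : |Mm (fun j => nd 1 N c j - cf (fun j => F (j*h)) j) i| ≤ 40*K*h^3 := by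
  have hN0 : 0 < N := by omega
  have hNr : (0:ℝ) < N := by positivity
  have hi := pi_of_cont hN0 hgc
  have pc := nd_per (s := 1) hN0 c
  have pW : Per (2*N) (fun j : ℤ => F (j*h)) := per_nodes pF (by rw [hh]; exact hN2 hN0)
  have nW : ∀ j : ℤ, F ((-j:ℤ)*h) = F (j*h) := fun j => by rw [← nF]; congr 1; push_cast; ring
  have nc : ∀ j, nd 1 N c (-j) = nd 1 N c j := fun j => by rw [nd_neg] <;> simp
  have sh : ∀ (k : ℕ) (q0 q1 q2 : ℝ), (∀ s, |s| ≤ 2*h → |F (k*h+s) - (q0+q1*s+q2*s^2)| ≤ 8*K*h^3) →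
      |Mm (cf (fun j => F (j*h))) k - (q0+q2*h^2/6)| ≤ 2*(8*K*h^3) := fun k q0 q1 q2 H => by
    refine Mcf_bd (q1 := q1) fun j hj => ?_
    have := H (j*h) (jsh (by rw [hh]; positivity) hj)
    refine le_trans (le_of_eq ?_) this
    congr 2; push_cast; ring_nf
  refine red_bd (s := 1) hN0 (by simp) (pc.sub (cf_per pW)).Mm (fun i => ?_) (fun k hk => ?_) i
  · unfold Mm cf del2
    have m1 : ∀ a : ℤ, -a - 1 = -(a+1) := fun a => by ring
    have m2 : ∀ a : ℤ, -a + 1 = -(a-1) := fun a => by ring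
    simp only [m1, m2, nW, nc]
    ring
  · rw [Mm_sub]
    obtain ⟨q0, q1, q2, H⟩ := Q.at hN hh (k*h)
    have s1 := sh k q0 q1 q2 H
    have X : |Mm (nd 1 N c) k - (q0+q2*h^2/6)| ≤ 3*(8*K*h^3) := by
      rcases Nat.eq_zero_or_pos k with r | r
      · subst r
        have := node_0 (c := fun j => c (Ms N j)) hN0 hh hi hg H (h0 0) (fun s => by simp [nF])
        refine le_trans (le_of_eq ?_) this
        have c1 : (1:ℤ) = ((1:ℕ):ℤ) := rfl
        have c0 : ((0:ℕ):ℤ) = 0 := rfl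
        unfold Mm
        rw [c0, zero_sub, nc, zero_add, ← c0, c1, nd_nat hN0 (by simp) (by omega), nd_nat hN0 (by simp) (by omega)]
        congr 2; ring
      · obtain ⟨k, rfl⟩ := Nat.exists_eq_succ_of_ne_zero r.ne'
        rw [Nat.succ_eq_add_one] at *
        rcases hk.lt_or_eq with e | e
        · have := node_mid (c := fun j => c (Ms N j)) hh e hi hg H (h0 (k+1))
          refine le_trans (le_of_eq ?_) this
          unfold Mm
          rw [show ((k+1:ℕ):ℤ) - 1 = (k:ℕ) by push_cast; ring, show ((k+1:ℕ):ℤ) + 1 = (k+2:ℕ) by push_cast; ring]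
          iterate 3 rw [nd_nat hN0 (by simp) (by omega)]
        · have k1 : ((k+1:ℕ):ℝ)*h = 1 := by rw [hh, e]; field_simp
          have := node_N (c := fun j => c (Ms N j)) e hh hi hg H (h0 (k+1)) (fun s => by
            rw [k1, ← nF, ← pF]; congr 1; ring)
          refine le_trans (le_of_eq ?_) this
          unfold Mm
          rw [show ((k+1:ℕ):ℤ) + 1 = -(k:ℕ) + (2*N:ℕ) by push_cast; rw [← e]; push_cast; ring, pc, nc, show ((k+1:ℕ):ℤ) - 1 = (k:ℕ) by push_cast; ring]
          iterate 2 rw [nd_nat hN0 (by simp) (by omega)]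
          congr 2; ring
    rw [abs_le] at *; constructor <;> linarith

theorem init_odd {N : ℕ} (hN : 2 ≤ N) {F g c : ℝ → ℝ} {K h : ℝ} (hh : h = 1/(N:ℝ)) (Q : QA F K) (pF : ∀ x, F (x+2) = F x) (nF : ∀ x, F (-x) = - F x)
    (hgc : ContinuousOn g (Icc 0 1)) (c0 : c 0 = 0) (c1 : c 1 = 0)
    (hg : ∀ j < N, ∀ y ∈ Icc ((j:ℝ)/N) (((j+1:ℕ):ℝ)/N), g y = F y - (c (Ms N j) + (c (Ms N (j+1)) - c (Ms N j))*(y*N-j)))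
    (h0 : ∀ i, 0 < i → i < N → ip g (hat N i) = 0) (i : ℤ) : |Mm (fun j => nd (-1) N c j - cf (fun j => F (j*h)) j) i| ≤ 40*K*h^3 := by
  have hN0 : 0 < N := by omega
  have hNr : (0:ℝ) < N := by positivity
  have hi := pi_of_cont hN0 hgc
  have pc := nd_per (s := -1) hN0 c
  have pW : Per (2*N) (fun j : ℤ => F (j*h)) := per_nodes pF (by rw [hh]; exact hN2 hN0)
  have nW : ∀ j : ℤ, F ((-j:ℤ)*h) = - F (j*h) := fun j => by rw [← nF]; congr 1; push_cast; ring
  have nc : ∀ j, nd (-1) N c (-j) = - nd (-1) N c j := fun j => by rw [nd_neg] <;> simp [c0, c1]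
  have K0 : 0 ≤ 8*K*h^3 := by
    obtain ⟨q0, q1, q2, H⟩ := Q.at hN hh 0
    exact (abs_nonneg _).trans (H 0 (by rw [hh]; simp))
  have PF := (pc.sub (cf_per pW)).Mm
  have NF : ∀ i, Mm (fun j => nd (-1) N c j - cf (fun j => F (j*h)) j) (-i) = (-1) * Mm (fun j => nd (-1) N c j - cf (fun j => F (j*h)) j) i := by
    intro i
    unfold Mm cf del2
    have m1 : ∀ a : ℤ, -a - 1 = -(a+1) := fun a => by ring
    have m2 : ∀ a : ℤ, -a + 1 = -(a-1) := fun a => by ring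
    simp only [m1, m2, nW, nc]
    ring
  refine red_bd (s := -1) hN0 (by simp) PF NF (fun k hk => ?_) i
  rcases Nat.eq_zero_or_pos k with r | r
  · subst r
    have := NF 0
    rw [neg_zero] at this
    rw [show ((0:ℕ):ℤ) = 0 from rfl, show Mm (fun j => nd (-1) N c j - cf (fun j => F (j*h)) j) 0 = 0 by linarith, abs_zero]; linarith
  · obtain ⟨k, rfl⟩ := Nat.exists_eq_succ_of_ne_zero r.ne'
    rw [Nat.succ_eq_add_one] at *
    rcases hk.lt_or_eq with e | e
    · rw [Mm_sub]
      obtain ⟨q0, q1, q2, H⟩ := Q.at hN hh ((k+1:ℕ)*h)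
      have s1 : |Mm (cf (fun j => F (j*h))) (k+1:ℕ) - (q0+q2*h^2/6)| ≤ 2*(8*K*h^3) := by
        refine Mcf_bd (q1 := q1) fun j hj => ?_
        have := H (j*h) (jsh (by rw [hh]; positivity) hj)
        refine le_trans (le_of_eq ?_) this
        congr 2; push_cast; ring_nf
      have X : |Mm (nd (-1) N c) (k+1:ℕ) - (q0+q2*h^2/6)| ≤ 3*(8*K*h^3) := by
        have := node_mid (c := fun j => c (Ms N j)) hh e hi hg H (h0 (k+1) (by omega) e)
        refine le_trans (le_of_eq ?_) this
        unfold Mm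
        rw [show ((k+1:ℕ):ℤ) - 1 = (k:ℕ) by push_cast; ring, show ((k+1:ℕ):ℤ) + 1 = (k+2:ℕ) by push_cast; ring]
        iterate 3 rw [nd_nat hN0 (by simp [c1]) (by omega)]
      rw [abs_le] at *; constructor <;> linarith
    · have h1 := NF N
      have h2 := PF (-N)
      push_cast at h2
      rw [show -(N:ℤ) + 2*N = N by ring] at h2
      rw [e, show Mm (fun j => nd (-1) N c j - cf (fun j => F (j*h)) j) N = 0 by linarith, abs_zero]; linarith

end

section
open Set MeasureTheory

theorem conv_bd {a b r B : ℝ} (h0 : 0 ≤ r) (h1 : r ≤ 1) (ha : |a| ≤ B) (hb : |b| ≤ B) : |a + (b - a)*r| ≤ B := by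
  rw [abs_le] at *
  constructor <;> nlinarith

set_option maxHeartbeats 800000 in
theorem interp_bd {F : ℝ → ℝ} {K C h : ℝ} (Q : QA F K) {N : ℕ} (hN : 2 ≤ N) (hh : h = 1/(N:ℝ)) {j : ℕ} {y : ℝ}
    (hy : y ∈ Icc ((j:ℝ)/N) (((j+1:ℕ):ℝ)/N)) {c d : ℝ}
    (hc : |c - cf (fun i => F (i*h)) j| ≤ C * h^2) (hd : |d - cf (fun i => F (i*h)) (j+1:ℕ)| ≤ C*h^2) :
    |F y - (c + (d - c)*(y*N-j))| ≤ (C+20*K)*h^2 := by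
  have hN0 : 0 < N := by omega
  have hNr : (0:ℝ) < N := by positivity
  have hN2 : (2:ℝ) ≤ N := by exact_mod_cast hN
  have h0 : 0 < h := by rw [hh]; positivity
  have h2 : h ≤ 1/2 := by rw [hh, div_le_div_iff₀ hNr (by norm_num)]; linarith
  obtain ⟨r0, r1⟩ := (Ms_iff hN0).1 hy
  set r := y*N - j with hr
  have hyr : y = j*h + r*h := by rw [hr, hh]; field_simp; ring
  obtain ⟨q0, q1, q2, -, -, b2, bd⟩ := Q (j*h) (2*h) (by linarith) (by linarith)
  have K0 : 0 ≤ K := (abs_nonneg _).trans b2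
  have e3 : K * (2*h)^3 ≤ 4*K*h^2 := by
    nlinarith [mul_nonneg (mul_nonneg K0 (sq_nonneg h)) (sub_nonneg.2 h2)]
  have B : ∀ s, |s| ≤ 2*h → |F (j*h+s) - (q0 + q1*s + q2*s^2)| ≤ 4*K*h^2 := fun s hs => (bd s hs).trans e3
  have Bm := B (-h) (by rw [abs_neg, abs_of_pos h0]; linarith)
  have B0 := B 0 (by simp; linarith)
  have Bp := B h (by rw [abs_of_pos h0]; linarith)
  have Bq := B (2*h) (by rw [abs_of_pos (by linarith)])
  have hrh : |r*h| ≤ 2*h := by rw [abs_of_nonneg (mul_nonneg (by linarith) h0.le)]; nlinarith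
  have Br := B (r*h) hrh
  rw [← hyr] at Br
  rw [add_zero] at B0
  unfold cf del2 at hc hd
  have e1 : ((((j:ℕ):ℤ) - 1:ℤ):ℝ)*h = j*h + -h := by push_cast; ring
  have e2 : ((((j:ℕ):ℤ) + 1:ℤ):ℝ)*h = j*h + h := by push_cast; ring
  have e3 : ((((j+1:ℕ):ℤ) + 1:ℤ):ℝ)*h = j*h + 2*h := by push_cast; ring
  have e4 : ((((j+1:ℕ):ℤ) - 1:ℤ):ℝ)*h = j*h := by push_cast; ring
  have e5' : ((j+1:ℕ):ℝ)*h = j*h + h := by push_cast; ring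
  simp only [e1, e2, e3, e4, Int.cast_natCast, e5'] at hc hd
  set f0 := F (j*h)
  set f1 := F (j*h+h)
  set fm := F (j*h + -h)
  set f2 := F (j*h+2*h)
  have hq2 : |q2*h^2| ≤ K*h^2 := by rw [abs_mul, abs_of_nonneg (sq_nonneg h)]; gcongr
  have c1 : |c - f0| ≤ (C + 2*K)*h^2 := by
    rw [abs_le] at Bm B0 Bp hq2 hc ⊢
    constructor <;> linarith only [Bm, B0, Bp, hq2, hc]
  have d1 : |d - f1| ≤ (C + 2*K)*h^2 := by
    rw [abs_le] at Bq B0 Bp hq2 hd ⊢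
    constructor <;> linarith only [Bq, B0, Bp, hq2, hd]
  have x0 : 0 ≤ r := by linarith
  have x1 : r ≤ 1 := by linarith
  have m1 := conv_bd x0 x1 c1 d1
  have m2 := conv_bd x0 x1 B0 Bp
  have m3 : |q2*h^2*(r^2-r)| ≤ K*h^2 := by
    have : |r^2-r| ≤ 1 := by rw [abs_le]; constructor <;> nlinarith only [x0, x1]
    rw [abs_mul]
    exact (mul_le_mul hq2 this (abs_nonneg _) (by positivity)).trans (by rw [mul_one])
  have key : F y - (c + (d-c)*r) = (F y - (q0+q1*(r*h)+q2*(r*h)^2)) - ((f0 - (q0 + q1*0+q2*0^2)) + ((f1 - (q0+q1*h+q2*h^2)) - (f0 - (q0 + q1*0+q2*0^2)))*r)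
     - ((c-f0) + ((d-f1)-(c-f0))*r) + q2*h^2*(r^2-r) := by ring
  rw [key]
  have := mul_nonneg K0 (sq_nonneg h)
  rw [abs_le] at Br m1 m2 m3 ⊢
  constructor <;> linarith only [Br, m1, m2, m3, this]

theorem ex_elem {N : ℕ} (hN : 0 < N) {y : ℝ} (hy : y ∈ Icc (0:ℝ) 1) : ∃ j < N, y ∈ Icc ((j:ℝ)/N) (((j+1:ℕ):ℝ)/N) := by
  have hNr : (0:ℝ) < N := by positivity
  have hyN : 0 ≤ y*N := mul_nonneg hy.1 hNr.le
  by_cases h : ⌊y*N⌋₊ < N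
  · exact ⟨_, h, (Ms_iff hN).2 ⟨Nat.floor_le hyN, (Nat.lt_floor_add_one _).le⟩⟩
  · push Not at h
    have h1 : (N:ℝ) ≤ y*N := (Nat.le_floor_iff hyN).1 h
    have h2 : y*N ≤ N := by nlinarith [hy.2]
    refine ⟨N-1, by omega, (Ms_iff hN).2 ?_⟩
    rw [Nat.cast_sub hN]; push_cast; constructor <;> linarith

theorem mem_elem {N : ℕ} (hN : 0 < N) {j : ℕ} (hj : j < N) {y : ℝ} (hy : y ∈ Icc ((j:ℝ)/N) (((j+1:ℕ):ℝ)/N)) : y ∈ Icc (0:ℝ) 1 := by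
  have hNr : (0:ℝ) < N := by positivity
  have hj' : ((j+1:ℕ):ℝ) ≤ N := by exact_mod_cast hj
  exact ⟨le_trans (by positivity) hy.1, hy.2.trans ((div_le_one hNr).2 hj')⟩

theorem main_large {T α : ℝ} {ηs us : ℕ → ℝ → ℝ → ℝ} (H : HY T α ηs us) : ∃ (C : ℝ) (N0 : ℕ), ∀ N : ℕ, 2 ≤ N → N0 ≤ N →
    ∀ ηh uh dηh duh : ℝ → ℝ → ℝ, SolvesSWGalerkin N 2 0 (Ms N) T ηh uh dηh duh →
      IsL2ProjOn (Sh N 2 0 (Ms N)) (fun y => ηs 0 y 0) (ηh 0) →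
      IsL2ProjOn (Sh0 N 2 0 (Ms N)) (fun y => us 0 y 0) (uh 0) →
      ∀ t ∈ Icc (0:ℝ) T, ∀ y ∈ Icc (0:ℝ) 1, |ηs 0 y t - ηh t y| ≤ C * (1/(N:ℝ))^2 ∧ |us 0 y t - uh t y| ≤ C * (1/(N:ℝ))^2 := by
  obtain ⟨K, w, v, w1, v1, P, hwv⟩ := H.pk
  have K1 := P.K1
  have hT := H.hT
  have hα := H.hα
  obtain ⟨C, h0, h0p, hB⟩ := boot (T := T) (K := 5000*K^2) (α := α/2) hT (by nlinarith) (by linarith)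
  obtain ⟨n1, hn1⟩ := exists_nat_gt (1/h0)
  obtain ⟨n2, hn2⟩ := exists_nat_gt (2*K/α)
  refine ⟨C + 20*K, max n1 n2, fun N hN hN0 ηh uh dηh duh S p1 p2 t ht y hy => ?_⟩
  have z0 : (0:ℝ) ∈ Icc 0 T := ⟨le_rfl, hT.le⟩
  have Np : 0 < N := by omega
  have hNr : (0:ℝ) < N := by positivity
  have hN2' : (2:ℝ) ≤ N := by exact_mod_cast hN
  set h := 1/(N:ℝ) with hh
  have hp : 0 < h := by positivity
  have h1 : h ≤ 1 := by rw [hh, div_le_one hNr]; linarith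
  have hle : h ≤ h0 := by
    have : (n1:ℝ) ≤ N := by exact_mod_cast (le_max_left _ _).trans hN0
    rw [hh, div_le_iff₀ hNr]; rw [div_lt_iff₀ h0p] at hn1; nlinarith
  have hs : K * h ≤ α/2 := by
    have : (n2:ℝ) ≤ N := by exact_mod_cast (le_max_right _ _).trans hN0
    rw [div_lt_iff₀ hα] at hn2
    rw [hh, mul_one_div, div_le_iff₀ hNr]; nlinarith
  have hS := S.1
  have cη : ContinuousOn (fun y => ηs 0 y 0) (Icc 0 1) := (H.hη.2.1 0 (by norm_num) 0 z0).continuousOn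
  have cu : ContinuousOn (fun y => us 0 y 0) (Icc 0 1) := (H.hu.2.1 0 (by norm_num) 0 z0).continuousOn
  have K40 : 40*K*h^3 ≤ 5000*K^2*h^3 := by
    have : 40*K ≤ 5000*K^2 := by nlinarith
    gcongr
  have i1 := fun i => (init_even hN hh (P.qw 0 z0) (fun x => P.pw x 0) (P.nw 0 z0) (g := fun y => ηs 0 y 0 - ηh 0 y) (c := fun y => 1 + ηh 0 y)
    (cη.sub (hS 0 z0).1.1.continuousOn) (fun j hj y hy => by
      rw [(hwv 0 z0 y (mem_elem Np hj hy)).1, Sh_lin Np (hS 0 z0).1 hj hy]; ring) (fun i => p1.2 _ (hat_mem Np i)) i).trans K40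
  have i2 := fun i => (init_odd hN hh (P.qv 0 z0) (fun x => P.pv x 0) (P.nv 0 z0) (g := fun y => us 0 y 0 - uh 0 y) (c := fun y => uh 0 y)
    (cu.sub (hS 0 z0).2.1.1.1.continuousOn) (hS 0 z0).2.1.2.1 (hS 0 z0).2.1.2.2 (fun j hj y hy => by
      rw [(hwv 0 z0 y (mem_elem Np hj hy)).2, Sh_lin Np (hS 0 z0).2.1.1 hj hy]) (fun i hi hi' => p2.2 _ (hat_mem0 Np hi hi')) i).trans K40
  have D := mk_dat (P.cmp hα hp h1 hs (hN2 Np)) (gal_of Np S) i1 i2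
  have B := hB _ _ hp hle (hN2 Np) _ _ _ _ _ _ _ _ D t ht
  obtain ⟨j, hj, hyj⟩ := ex_elem Np hy
  constructor
  · have n0 := (B j).1
    have n1 := (B (j+1:ℕ)).1
    rw [nd_nat Np (by ring) hj.le] at n0
    rw [nd_nat Np (by ring) hj] at n1
    have := interp_bd (P.qw t ht) hN hh hyj n0 n1
    rw [(hwv t ht y hy).1] at this
    rw [Sh_lin Np (hS t ht).1 hj hyj]
    convert this using 2; ring
  · have n0 := (B j).2
    have n1 := (B (j+1:ℕ)).2
    rw [nd_nat Np (by rw [(hS t ht).2.1.2.2]; ring) hj.le] at n0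
    rw [nd_nat Np (by rw [(hS t ht).2.1.2.2]; ring) hj] at n1
    have := interp_bd (P.qv t ht) hN hh hyj n0 n1
    rw [(hwv t ht y hy).2] at this
    rw [Sh_lin Np (hS t ht).2.1.1 hj hyj]
    exact this

end

section
open Set MeasureTheory

theorem gbd {T : ℝ} {n : ℕ} (n0 : 0 < n) {F : ℝ → ℤ → ℝ} (pF : ∀ t ∈ Icc 0 T, Per n (F t))
    (hF : ∀ i, ContinuousOn (fun t => F t i) (Icc 0 T)) : ∃ W : ℝ, 1 ≤ W ∧ ∀ t ∈ Icc 0 T, ∀ i, |F t i| ≤ W := by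
  have hc : ContinuousOn (fun t => SS n (fun i => F t i^2)) (Icc 0 T) := by
    unfold SS
    exact continuousOn_finsetSum _ fun i _ => (hF i).pow 2
  obtain ⟨B, hB⟩ := isCompact_Icc.exists_bound_of_continuousOn hc
  refine ⟨1 + |B|, by linarith [abs_nonneg B], fun t ht i => ?_⟩
  have h1 := SS_single n0 (pF t ht).sq (fun i => sq_nonneg _) i
  have h2 := hB t ht
  rw [Real.norm_eq_abs] at h2
  have h3 : F t i^2 ≤ |B| := h1.trans ((le_abs_self _).trans (h2.trans (le_abs_self _)))
  exact abs_le_of_sq_le_sq (by nlinarith [abs_nonneg B]) (by positivity)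

theorem fN_bd {n : ℕ} {h W : ℝ} (h0 : 0 < h) {f w x : ℤ → ℝ} (px : Per n x) (hw : ∀ i, |w i| ≤ W) :
    h * |SS n (fun i => f i * N1 h w x i)| ≤ 1/2 * SS n (fun i => f i^2) + 3*W^2*SS n (fun i => x i^2) := by
  have h1 := N1_sqS h0 px hw
  have a1 : SS n (fun i => h * (f i * N1 h w x i)) ≤ SS n (fun i => 1/2 * f i^2 + 1/2 * (h * N1 h w x i)^2) :=
    SS_le fun i => by nlinarith [sq_nonneg (f i - h * N1 h w x i)]
  have a2 : SS n (fun i => (-h) * (f i * N1 h w x i)) ≤ SS n (fun i => 1/2 * f i^2 + 1/2 * (h * N1 h w x i)^2) :=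
    SS_le fun i => by nlinarith [sq_nonneg (f i + h * N1 h w x i)]
  rw [SS_add, SS_mul, SS_mul, SS_mul] at a1 a2
  rw [← abs_of_pos h0, ← abs_mul, abs_of_pos h0, abs_le]
  constructor <;> linarith

theorem gal_unique {T h : ℝ} {n : ℕ} (h0 : 0 < h) (n0 : 0 < n) {Γ U Γd Ud Γ' U' Γd' Ud' : ℝ → ℤ → ℝ}
    (g : Gal T h n Γ U Γd Ud) (g' : Gal T h n Γ' U' Γd' Ud') (e1 : ∀ i, Γ 0 i = Γ' 0 i) (e2 : ∀ i, U 0 i = U' 0 i) :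
    ∀ t ∈ Icc 0 T, ∀ i, Γ t i = Γ' t i ∧ U t i = U' t i := by
  obtain ⟨W1, w1, b1⟩ := gbd n0 g.pG (fun i t ht => (g.dG t ht i).continuousWithinAt)
  obtain ⟨W2, w2, b2⟩ := gbd n0 g.pU (fun i t ht => (g.dU t ht i).continuousWithinAt)
  obtain ⟨W3, w3, b3⟩ := gbd n0 g'.pU (fun i t ht => (g'.dU t ht i).continuousWithinAt)
  set W := max W1 (max W2 W3) with hW
  have W1' : 1 ≤ W := w1.trans (le_max_left _ _)
  have c1 : ∀ t ∈ Icc 0 T, ∀ i, |Γ t i| ≤ W := fun t ht i => (b1 t ht i).trans (le_max_left _ _)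
  have c2 : ∀ t ∈ Icc 0 T, ∀ i, |U t i| ≤ W := fun t ht i => (b2 t ht i).trans ((le_max_left _ _).trans (le_max_right _ _))
  have c3 : ∀ t ∈ Icc 0 T, ∀ i, |U' t i| ≤ W := fun t ht i => (b3 t ht i).trans ((le_max_right _ _).trans (le_max_right _ _))
  set x : ℝ → ℤ → ℝ := fun t i => Γ t i - Γ' t i with hx
  set y : ℝ → ℤ → ℝ := fun t i => U t i - U' t i with hy
  set q : ℝ → ℤ → ℝ := fun t i => Γd t i - Γd' t i with hq
  set p : ℝ → ℤ → ℝ := fun t i => Ud t i - Ud' t i with hp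
  have px : ∀ t ∈ Icc 0 T, Per n (x t) := fun t ht => (g.pG t ht).sub (g'.pG t ht)
  have py : ∀ t ∈ Icc 0 T, Per n (y t) := fun t ht => (g.pU t ht).sub (g'.pU t ht)
  have pq : ∀ t ∈ Icc 0 T, Per n (q t) := fun t ht => (g.pGd t ht).sub (g'.pGd t ht)
  have pp : ∀ t ∈ Icc 0 T, Per n (p t) := fun t ht => (g.pUd t ht).sub (g'.pUd t ht)
  set E : ℝ → ℝ := fun τ => 1/2 * (SS n (fun i => y τ i * Mm (y τ) i) + SS n (fun i => (1:ℝ) * (x τ i * Mm (x τ) i))) with hE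
  set E' : ℝ → ℝ := fun t => SS n (fun i => y t i * Mm (p t) i) + SS n (fun i => x t i * Mm (q t) i) with hE'
  have dE : ∀ t ∈ Icc 0 T, HasDerivWithinAt E (E' t) (Icc 0 T) t := fun t ht => by
    have := E_hasDeriv (a := fun _ _ => 1) (ad := fun _ _ => 0) (s := Icc 0 T) (pp t ht) (py t ht) (x := x) (q := q)
      (fun i => (g.dG t ht i).sub (g'.dG t ht i)) (fun i => (g.dU t ht i).sub (g'.dU t ht i)) (fun i => hasDerivWithinAt_const _ _ _)
    convert this using 1
    simp only [one_mul, zero_mul]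
    rw [M_symm (pq t ht) (px t ht)]
    simp only [hE', SS, Finset.sum_const_zero]; ring
  have En : ∀ t ∈ Icc 0 T, SS n (fun i => x t i^2) + SS n (fun i => y t i^2) ≤ 6 * E t := fun t ht => by
    have m1 := M_pos (px t ht)
    have m2 := M_pos (py t ht)
    simp only [hE, one_mul]
    linarith
  have bE : ∀ t ∈ Icc 0 T, |E' t| ≤ 6*(1+6*W^2)/h * |E t| := fun t ht => by
    have r1 : ∀ i, Mm (q t) i = -(N1 h (Γ t) (y t) i + N1 h (U' t) (x t) i) := fun i => by
      have e1 := g.g1 t ht i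
      have e2 := g'.g1 t ht i
      have : Mm (q t) i = Mm (Γd t) i - Mm (Γd' t) i := by simp only [hq, Mm]; ring
      rw [this]
      have : N1 h (Γ t) (y t) i + N1 h (U' t) (x t) i = N1 h (Γ t) (U t) i - N1 h (Γ' t) (U' t) i := by
        simp only [hx, hy, N1]; ring
      rw [this]; linarith
    have r2 : ∀ i, Mm (p t) i = -(N1 h (fun _ => 1) (x t) i + 1/2 * (N1 h (U t) (y t) i + N1 h (U' t) (y t) i)) := fun i => by
      have e1 := g.g2 t ht i
      have e2 := g'.g2 t ht i
      have : Mm (p t) i = Mm (Ud t) i - Mm (Ud' t) i := by simp only [hp, Mm]; ring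
      rw [this]
      have : N1 h (fun _ => 1) (x t) i + 1/2 * (N1 h (U t) (y t) i + N1 h (U' t) (y t) i)
          = (N1 h (Γ t) (fun _ => 1) i + 1/2 * N1 h (U t) (U t) i) - (N1 h (Γ' t) (fun _ => 1) i + 1/2 * N1 h (U' t) (U' t) i) := by
        simp only [hx, hy, N1]; ring
      rw [this]; linarith
    have s1 : E' t = -(SS n (fun i => x t i * N1 h (Γ t) (y t) i) + SS n (fun i => x t i * N1 h (U' t) (x t) i)
       + SS n (fun i => y t i * N1 h (fun _ => 1) (x t) i) + 1/2 * SS n (fun i => y t i * N1 h (U t) (y t) i)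
       + 1/2 * SS n (fun i => y t i * N1 h (U' t) (y t) i)) := by
      simp only [hE', r1, r2]
      rw [← SS_mul, ← SS_mul, ← SS_add, ← SS_add, ← SS_add, ← SS_add, ← SS_add, ← neg_one_mul, ← SS_mul]
      congr 1; funext i; ring
    have t1 := fN_bd h0 (f := x t) (py t ht) (c1 t ht)
    have t2 := fN_bd h0 (f := x t) (px t ht) (c3 t ht)
    have t3 := fN_bd h0 (f := y t) (w := fun _ => 1) (px t ht) (W := W) (fun i => by rw [abs_one]; exact W1')
    have t4 := fN_bd h0 (f := y t) (py t ht) (c2 t ht)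
    have t5 := fN_bd h0 (f := y t) (py t ht) (c3 t ht)
    have X0 : 0 ≤ SS n (fun i => x t i^2) := SS_nonneg fun i => sq_nonneg _
    have Y0 : 0 ≤ SS n (fun i => y t i^2) := SS_nonneg fun i => sq_nonneg _
    have En' := En t ht
    have En'' := le_abs_self (E t)
    rw [div_mul_eq_mul_div, le_div_iff₀ h0, s1, abs_neg]
    generalize SS n (fun i => x t i * N1 h (Γ t) (y t) i) = A1 at *
    generalize SS n (fun i => x t i * N1 h (U' t) (x t) i) = A2 at *
    generalize SS n (fun i => y t i * N1 h (fun _ => 1) (x t) i) = A3 at *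
    generalize SS n (fun i => y t i * N1 h (U t) (y t) i) = A4 at *
    generalize SS n (fun i => y t i * N1 h (U' t) (y t) i) = A5 at *
    generalize SS n (fun i => x t i^2) = X at *
    generalize SS n (fun i => y t i^2) = Y at *
    have q1 : |A1 + A2 + A3 + 1/2*A4 + 1/2*A5| ≤ |A1| + |A2| + |A3| + 1/2*|A4| + 1/2*|A5| := by
      have := abs_add_le (A1+A2+A3+1/2*A4) (1/2*A5)
      have := abs_add_le (A1+A2+A3) (1/2*A4)
      have := abs_add_le (A1+A2) A3
      have := abs_add_le A1 A2
      have : |1/2*A4| = 1/2*|A4| := by rw [abs_mul]; norm_num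
      have : |1/2*A5| = 1/2*|A5| := by rw [abs_mul]; norm_num
      linarith
    have q2 := mul_le_mul_of_nonneg_right q1 h0.le
    have q3 : (1+6*W^2)*(X+Y) ≤ (1+6*W^2)*(6*|E t|) := mul_le_mul_of_nonneg_left (by linarith) (by positivity)
    linarith
  have E0 : E 0 = 0 := by
    have z1 : ∀ i, x 0 i = 0 := fun i => by simp only [hx, e1, sub_self]
    have z2 : ∀ i, y 0 i = 0 := fun i => by simp only [hy, e2, sub_self]
    simp only [hE, z1, z2, zero_mul, mul_zero, SS, Finset.sum_const_zero, add_zero]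
  have Z := eq_zero_of_abs_deriv_le_mul_abs_self_of_eq_zero_right (f := E) (f' := E') (a := 0) (b := T)
    (fun t ht => (dE t ht).continuousWithinAt) (fun t ht => ((dE t ⟨ht.1, ht.2.le⟩).mono_of_mem_nhdsWithin (Icc_mem_nhdsGE_of_mem ht))) E0
    (fun t ht => bE t ⟨ht.1, ht.2.le⟩)
  intro t ht i
  have En' := En t ht
  rw [Z t ht] at En'
  have X0 := SS_single n0 (px t ht).sq (fun i => sq_nonneg _) i
  have Y0 := SS_single n0 (py t ht).sq (fun i => sq_nonneg _) i
  have k1 := sq_nonneg (x t i)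
  have k2 := sq_nonneg (y t i)
  have j1 : x t i = 0 := pow_eq_zero_iff (two_ne_zero) |>.1 (le_antisymm (by
    have : 0 ≤ SS n (fun i => y t i^2) := SS_nonneg fun i => sq_nonneg _
    linarith) k1)
  have j2 : y t i = 0 := pow_eq_zero_iff (two_ne_zero) |>.1 (le_antisymm (by
    have : 0 ≤ SS n (fun i => x t i^2) := SS_nonneg fun i => sq_nonneg _
    linarith) k2)
  exact ⟨sub_eq_zero.1 j1, sub_eq_zero.1 j2⟩

theorem Sh_sub {N : ℕ} {f g : ℝ → ℝ} (hf : f ∈ Sh N 2 0 (Ms N)) (hg : g ∈ Sh N 2 0 (Ms N)) : (fun y => f y - g y) ∈ Sh N 2 0 (Ms N) := by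
  refine ⟨hf.1.sub hg.1, fun j hj => ?_⟩
  obtain ⟨p, hp, ep⟩ := hf.2 j hj
  obtain ⟨q, hq, eq⟩ := hg.2 j hj
  refine ⟨p - q, (Polynomial.natDegree_sub_le p q).trans (max_le hp hq), fun y hy => ?_⟩
  show f y - g y = _
  rw [Polynomial.eval_sub, ep y hy, eq y hy]

theorem proj_aux {f g g' : ℝ → ℝ} (hf : ContinuousOn f (Icc 0 1)) (hg : ContinuousOn g (Icc 0 1)) (hg' : ContinuousOn g' (Icc 0 1))
    (h1 : ip (fun y => f y - g y) (fun y => g y - g' y) = 0) (h2 : ip (fun y => f y - g' y) (fun y => g y - g' y) = 0) :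
    ∀ y ∈ Icc (0:ℝ) 1, g y = g' y := by
  have hd := hg.sub hg'
  have I : ∀ {F : ℝ → ℝ}, ContinuousOn F (Icc 0 1) → IntervalIntegrable F volume 0 1 := fun hF =>
    ContinuousOn.intervalIntegrable (by rwa [uIcc_of_le zero_le_one])
  have h3 : ∫ y in (0:ℝ)..1, (g y - g' y)^2 = 0 := by
    have := intervalIntegral.integral_sub (I ((hf.sub hg').mul hd)) (I ((hf.sub hg).mul hd))
    unfold ip at h1 h2
    have e : ∀ y, (g y - g' y)^2 = ((f y - g' y) * (g y - g' y)) - ((f y - g y) * (g y - g' y)) := fun y => by ring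
    simp_rw [e]
    refine this.trans ?_
    exact (congrArg₂ (· - ·) h2 h1).trans (sub_zero _)
  by_contra hc
  push Not at hc
  obtain ⟨y, hy, hne⟩ := hc
  have := intervalIntegral.integral_pos (f := fun y => (g y - g' y)^2) zero_lt_one (hd.pow 2) (fun _ _ => sq_nonneg _)
    ⟨y, hy, by have := sub_ne_zero.2 hne; positivity⟩
  linarith

end

section
open Set MeasureTheory

theorem nd_congr {s : ℝ} {N : ℕ} {f g : ℝ → ℝ} (h : ∀ y ∈ Icc (0:ℝ) 1, f y = g y) (i : ℤ) : nd s N f i = nd s N g i := by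
  unfold nd ex
  have hr := red_mem (i*(1/(N:ℝ)))
  split_ifs with h0
  · exact h _ ⟨h0, hr.2.le⟩
  · rw [h _ ⟨by linarith, by linarith [hr.1]⟩]

theorem sol_unique {T : ℝ} (hT : 0 < T) {N : ℕ} (hN : 0 < N) {ηh uh dηh duh ηh' uh' dηh' duh' : ℝ → ℝ → ℝ}
    (S : SolvesSWGalerkin N 2 0 (Ms N) T ηh uh dηh duh) (S' : SolvesSWGalerkin N 2 0 (Ms N) T ηh' uh' dηh' duh')
    {f f2 : ℝ → ℝ} (hf : ContinuousOn f (Icc 0 1)) (hf2 : ContinuousOn f2 (Icc 0 1))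
    (p1 : IsL2ProjOn (Sh N 2 0 (Ms N)) f (ηh 0)) (p2 : IsL2ProjOn (Sh0 N 2 0 (Ms N)) f2 (uh 0))
    (q1 : IsL2ProjOn (Sh N 2 0 (Ms N)) f (ηh' 0)) (q2 : IsL2ProjOn (Sh0 N 2 0 (Ms N)) f2 (uh' 0)) :
    ∀ t ∈ Icc 0 T, ∀ y ∈ Icc (0:ℝ) 1, ηh t y = ηh' t y ∧ uh t y = uh' t y := by
  have hN' : (0:ℝ) < N := by positivity
  have m1 := Sh_sub p1.1 q1.1
  have m2 : (fun y => uh 0 y - uh' 0 y) ∈ Sh0 N 2 0 (Ms N) :=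
    ⟨Sh_sub p2.1.1 q2.1.1, by simp [p2.1.2.1, q2.1.2.1], by simp [p2.1.2.2, q2.1.2.2]⟩
  have z1 := proj_aux hf p1.1.1.continuousOn q1.1.1.continuousOn (p1.2 _ m1) (q1.2 _ m1)
  have z2 := proj_aux hf2 p2.1.1.1.continuousOn q2.1.1.1.continuousOn (p2.2 _ m2) (q2.2 _ m2)
  have G := gal_unique (by positivity) (by omega) (gal_of hN S) (gal_of hN S')
    (fun i => nd_congr (fun y hy => by rw [z1 y hy]) i) (fun i => nd_congr z2 i)
  intro t ht y hy
  obtain ⟨j, hj, hyj⟩ := ex_elem hN hy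
  have a := S.1 t ht
  have b := S'.1 t ht
  have k0 := G t ht j
  have k1 := G t ht (j+1:ℕ)
  rw [nd_nat hN (by ring) hj.le, nd_nat hN (by ring) hj.le, nd_nat hN (by rw [a.2.1.2.2]; ring) hj.le, nd_nat hN (by rw [b.2.1.2.2]; ring) hj.le] at k0
  rw [nd_nat hN (by ring) hj, nd_nat hN (by ring) hj, nd_nat hN (by rw [a.2.1.2.2]; ring) hj, nd_nat hN (by rw [b.2.1.2.2]; ring) hj] at k1
  rw [Sh_lin hN a.1 hj hyj, Sh_lin hN b.1 hj hyj, Sh_lin hN a.2.1.1 hj hyj, Sh_lin hN b.2.1.1 hj hyj]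
  rw [add_left_cancel k0.1, add_left_cancel k1.1, k0.2, k1.2]
  exact ⟨rfl, rfl⟩

theorem sol_bd {T : ℝ} {N : ℕ} (hN : 0 < N) {ηh uh dηh duh : ℝ → ℝ → ℝ}
    (S : SolvesSWGalerkin N 2 0 (Ms N) T ηh uh dηh duh) : ∃ W : ℝ, ∀ t ∈ Icc 0 T, ∀ y ∈ Icc (0:ℝ) 1, |1 + ηh t y| ≤ W ∧ |uh t y| ≤ W := by
  have g := gal_of hN S
  obtain ⟨W1, w1, b1⟩ := gbd (by omega) g.pG (fun i t ht => (g.dG t ht i).continuousWithinAt)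
  obtain ⟨W2, w2, b2⟩ := gbd (by omega) g.pU (fun i t ht => (g.dU t ht i).continuousWithinAt)
  refine ⟨max W1 W2, fun t ht y hy => ?_⟩
  obtain ⟨j, hj, hyj⟩ := ex_elem hN hy
  have a := S.1 t ht
  have x0 := b1 t ht j
  have x1 := b1 t ht (j+1:ℕ)
  have y0 := b2 t ht j
  have y1 := b2 t ht (j+1:ℕ)
  rw [nd_nat hN (by ring) hj.le] at x0
  rw [nd_nat hN (by ring) hj] at x1
  rw [nd_nat hN (by rw [a.2.1.2.2]; ring) hj.le] at y0
  rw [nd_nat hN (by rw [a.2.1.2.2]; ring) hj] at y1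
  obtain ⟨r0, r1⟩ := (Ms_iff hN).1 hyj
  have c1 := conv_bd (r := y*N-j) (by linarith) (by linarith) x0 x1
  have c2 := conv_bd (r := y*N-j) (by linarith) (by linarith) y0 y1
  rw [Sh_lin hN a.1 hj hyj, Sh_lin hN a.2.1.1 hj hyj]
  refine ⟨le_trans (le_of_eq ?_) (c1.trans (le_max_left _ _)), c2.trans (le_max_right _ _)⟩
  congr 1; ring

theorem main_small {T α : ℝ} {ηs us : ℕ → ℝ → ℝ → ℝ} (H : HY T α ηs us) (N : ℕ) : ∃ C : ℝ, 0 ≤ C ∧ (2 ≤ N →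
    ∀ ηh uh dηh duh : ℝ → ℝ → ℝ, SolvesSWGalerkin N 2 0 (Ms N) T ηh uh dηh duh →
      IsL2ProjOn (Sh N 2 0 (Ms N)) (fun y => ηs 0 y 0) (ηh 0) →
      IsL2ProjOn (Sh0 N 2 0 (Ms N)) (fun y => us 0 y 0) (uh 0) →
      ∀ t ∈ Icc (0:ℝ) T, ∀ y ∈ Icc (0:ℝ) 1, |ηs 0 y t - ηh t y| ≤ C * (1/(N:ℝ))^2 ∧ |us 0 y t - uh t y| ≤ C * (1/(N:ℝ))^2) := by
  by_cases hN : 2 ≤ N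
  swap
  · exact ⟨0, le_rfl, fun h => absurd h hN⟩
  have Np : 0 < N := by omega
  have hNr : (0:ℝ) < N := by positivity
  have hT := H.hT
  have z0 : (0:ℝ) ∈ Icc 0 T := ⟨le_rfl, hT.le⟩
  have cη : ContinuousOn (fun y => ηs 0 y 0) (Icc 0 1) := (H.hη.2.1 0 (by norm_num) 0 z0).continuousOn
  have cu : ContinuousOn (fun y => us 0 y 0) (Icc 0 1) := (H.hu.2.1 0 (by norm_num) 0 z0).continuousOn
  by_cases hex : ∃ ηh uh dηh duh : ℝ → ℝ → ℝ, SolvesSWGalerkin N 2 0 (Ms N) T ηh uh dηh duh ∧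
      IsL2ProjOn (Sh N 2 0 (Ms N)) (fun y => ηs 0 y 0) (ηh 0) ∧
      IsL2ProjOn (Sh0 N 2 0 (Ms N)) (fun y => us 0 y 0) (uh 0)
  swap
  · exact ⟨0, le_rfl, fun _ a b c d e f g => absurd ⟨a, b, c, d, e, f, g⟩ hex⟩
  obtain ⟨ηh', uh', dηh', duh', S', q1, q2⟩ := hex
  obtain ⟨W, hW⟩ := sol_bd Np S'
  obtain ⟨K, w, v, w1, v1, P, hwv⟩ := H.pk
  have W0 : 0 ≤ W := (abs_nonneg _).trans (hW 0 z0 0 ⟨le_rfl, zero_le_one⟩).1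
  have K1 := P.K1
  refine ⟨(K + W)*(N:ℝ)^2, by positivity, fun _ ηh uh dηh duh S p1 p2 t ht y hy => ?_⟩
  have u := sol_unique hT Np S S' cη cu p1 p2 q1 q2 t ht y hy
  rw [u.1, u.2, show (K+W)*(N:ℝ)^2*(1/(N:ℝ))^2 = K + W by field_simp]
  obtain ⟨b1, b2⟩ := hW t ht y hy
  have b3 := P.bw t ht y
  have b4 := P.bv t ht y
  rw [(hwv t ht y hy).1] at b3
  rw [(hwv t ht y hy).2] at b4
  rw [abs_le] at b1 b2 b3 b4
  constructor <;> rw [abs_le] <;> constructor <;> linarith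

theorem main_all {T α : ℝ} {ηs us : ℕ → ℝ → ℝ → ℝ} (H : HY T α ηs us) : ∃ C : ℝ, ∀ N : ℕ, 2 ≤ N →
    ∀ ηh uh dηh duh : ℝ → ℝ → ℝ, SolvesSWGalerkin N 2 0 (Ms N) T ηh uh dηh duh →
      IsL2ProjOn (Sh N 2 0 (Ms N)) (fun y => ηs 0 y 0) (ηh 0) →
      IsL2ProjOn (Sh0 N 2 0 (Ms N)) (fun y => us 0 y 0) (uh 0) →
      ∀ t ∈ Icc (0:ℝ) T, ∀ y ∈ Icc (0:ℝ) 1, |ηs 0 y t - ηh t y| ≤ C * (1/(N:ℝ))^2 ∧ |us 0 y t - uh t y| ≤ C * (1/(N:ℝ))^2 := by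
  obtain ⟨C, N0, hC⟩ := main_large H
  choose D D0 hD using main_small H
  have mono : ∀ {a b : ℝ} (N : ℕ), a ≤ b → a * (1/(N:ℝ))^2 ≤ b * (1/(N:ℝ))^2 := fun N hab => mul_le_mul_of_nonneg_right hab (sq_nonneg _)
  have SD : 0 ≤ ∑ k ∈ Finset.range N0, D k := Finset.sum_nonneg fun k _ => D0 k
  refine ⟨|C| + ∑ k ∈ Finset.range N0, D k, fun N hN ηh uh dηh duh S p1 p2 t ht y hy => ?_⟩
  by_cases h : N0 ≤ N
  · have := hC N hN h ηh uh dηh duh S p1 p2 t ht y hy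
    have m : C ≤ |C| + ∑ k ∈ Finset.range N0, D k := by linarith [le_abs_self C]
    exact ⟨this.1.trans (mono N m), this.2.trans (mono N m)⟩
  · have := hD N hN ηh uh dηh duh S p1 p2 t ht y hy
    have m : D N ≤ |C| + ∑ k ∈ Finset.range N0, D k := by
      have := Finset.single_le_sum (f := D) (fun k _ => D0 k) (Finset.mem_range.2 (not_le.1 h))
      linarith [abs_nonneg C]
    exact ⟨this.1.trans (mono N m), this.2.trans (mono N m)⟩

theorem nrm_bd {f : ℝ → ℝ} {B : ℝ} (h : ∀ y ∈ Icc (0:ℝ) 1, |f y| ≤ B) : nrm f ≤ B := by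
  have B0 : 0 ≤ B := (abs_nonneg _).trans (h 0 ⟨le_rfl, zero_le_one⟩)
  refine Real.sqrt_le_iff.2 ⟨B0, ?_⟩
  have := intervalIntegral.norm_integral_le_of_norm_le_const (a := 0) (b := 1) (f := fun y => (f y)^2) (C := B^2) (fun y hy => by
    rw [uIoc_of_le zero_le_one] at hy
    rw [Real.norm_eq_abs, abs_pow]
    exact pow_le_pow_left₀ (abs_nonneg _) (h y ⟨hy.1.le, hy.2⟩) 2)
  rw [sub_zero, abs_one, mul_one] at this
  exact (le_abs_self _).trans this

theorem sup_bd {f : ℝ → ℝ} {B : ℝ} (h : ∀ y ∈ Icc (0:ℝ) 1, |f y| ≤ B) : sSup ((fun y => |f y|) '' Icc (0:ℝ) 1) ≤ B := by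
  refine csSup_le ⟨_, 0, ⟨le_rfl, zero_le_one⟩, rfl⟩ ?_
  rintro _ ⟨y, hy, rfl⟩
  exact h y hy

end

theorem stmt_13 (T α : ℝ) (hT : 0 < T) (hα : 0 < α)
    (ηs us : ℕ → ℝ → ℝ → ℝ)
    (hηsm : SmoothChain T 4 1 ηs) (husm : SmoothChain T 4 1 us)
    (hsol : SW T (ηs 0) (us 0) (ηs 1) (us 1))
    (hlow : ∀ y ∈ Icc (0:ℝ) 1, ∀ t ∈ Icc (0:ℝ) T, α ≤ 1 + ηs 0 y t)
    (hc10 : derivWithin (fun y => ηs 0 y 0) (Icc (0:ℝ) 1) 0 = 0)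
    (hc11 : derivWithin (fun y => ηs 0 y 0) (Icc (0:ℝ) 1) 1 = 0)
    (hc20 : iteratedDerivWithin 2 (fun y => us 0 y 0) (Icc (0:ℝ) 1) 0 = 0)
    (hc21 : iteratedDerivWithin 2 (fun y => us 0 y 0) (Icc (0:ℝ) 1) 1 = 0) :
    ∃ C : ℝ, ∀ N : ℕ, 2 ≤ N →
      ∀ ηh uh dηh duh : ℝ → ℝ → ℝ,
        SolvesSWGalerkin N 2 0 (fun i => (i : ℝ)/N) T ηh uh dηh duh →
        IsL2ProjOn (Sh N 2 0 (fun i => (i : ℝ)/N)) (fun y => ηs 0 y 0) (ηh 0) →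
        IsL2ProjOn (Sh0 N 2 0 (fun i => (i : ℝ)/N)) (fun y => us 0 y 0) (uh 0) →
        ∀ t ∈ Icc (0:ℝ) T,
          nrm (fun y => ηs 0 y t - ηh t y) + nrm (fun y => us 0 y t - uh t y)
              ≤ C * ((1:ℝ)/N) ^ 2 ∧
          sSup ((fun y => |ηs 0 y t - ηh t y|) '' Icc (0:ℝ) 1)
              + sSup ((fun y => |us 0 y t - uh t y|) '' Icc (0:ℝ) 1)
              ≤ C * ((1:ℝ)/N) ^ 2 := by
  obtain ⟨C, hC⟩ := main_all (T := T) (α := α) (ηs := ηs) (us := us) ⟨hT, hα, hηsm, husm, hsol, hlow, hc10, hc11, hc20, hc21⟩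
  refine ⟨2*C, fun N hN ηh uh dηh duh S p1 p2 t ht => ?_⟩
  have b := hC N hN ηh uh dηh duh S p1 p2 t ht
  have n1 := nrm_bd (f := fun y => ηs 0 y t - ηh t y) (fun y hy => (b y hy).1)
  have n2 := nrm_bd (f := fun y => us 0 y t - uh t y) (fun y hy => (b y hy).2)
  have s1 := sup_bd (f := fun y => ηs 0 y t - ηh t y) (fun y hy => (b y hy).1)
  have s2 := sup_bd (f := fun y => us 0 y t - uh t y) (fun y hy => (b y hy).2)
  constructor <;> linarith
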